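/- There is a constant c > 0 such that for all integers h ≥ 1 and n ≥ 2, the number of simple graphs on the vertex set {0,…,n−1} that admit an obstacle representation with at most h obstacles is at most 2^{c·h·n·log n}. -/

import Mathlib

open scoped Classical

noncomputable section

/-- A simple polygon in the plane, given by `k ≥ 3` pairwise distinct vertices
`p₀, …, p_{k-1}` (indexed cyclically by `ZMod k`): consecutive boundary segments
meet exactly in their shared endpoint, and non-consecutive ones are disjoint. -/
structure SimplePolygon where
  k : ℕ
  three_le : 3 ≤ k
  verts : ZMod k → ℝ × ℝ
  inj : Function.Injective verts
  consec : ∀ i : ZMod k,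
    segment ℝ (verts i) (verts (i + 1)) ∩ segment ℝ (verts (i + 1)) (verts (i + 2)) =
      {verts (i + 1)}
  nonconsec : ∀ i j : ZMod k, j ≠ i → j ≠ i + 1 → i ≠ j + 1 →
    Disjoint (segment ℝ (verts i) (verts (i + 1))) (segment ℝ (verts j) (verts (j + 1)))

/-- The union `C` of the boundary segments of a simple polygon. -/
def SimplePolygon.boundary (P : SimplePolygon) : Set (ℝ × ℝ) :=
  ⋃ i : ZMod P.k, segment ℝ (P.verts i) (P.verts (i + 1))

/-- The simple polygon as a set: the boundary `C` together with the union `B` of all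
bounded connected components of the complement of `C`. -/
def SimplePolygon.toSet (P : SimplePolygon) : Set (ℝ × ℝ) :=
  P.boundary ∪ {x | x ∉ P.boundary ∧ Bornology.IsBounded (connectedComponentIn P.boundaryᶜ x)}

/-- An obstacle representation of a simple graph `G`: an injective placement of the
vertices in general position together with finitely many pairwise disjoint simple
polygons (obstacles) such that edges are unobstructed segments and non-edges are
blocked by some obstacle. -/
structure ObstacleRep {V : Type*} (G : SimpleGraph V) where
  pos : V → ℝ × ℝ
  posInj : Function.Injective pos
  genPos : ∀ u v w : V, u ≠ v → u ≠ w → v ≠ w →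
    ¬ Collinear ℝ ({pos u, pos v, pos w} : Set (ℝ × ℝ))
  numObs : ℕ
  obs : Fin numObs → SimplePolygon
  disj : ∀ i j : Fin numObs, i ≠ j → Disjoint (obs i).toSet (obs j).toSet
  edges_clear : ∀ u v : V, G.Adj u v → ∀ i,
    Disjoint (segment ℝ (pos u) (pos v)) (obs i).toSet
  nonedges_blocked : ∀ u v : V, u ≠ v → ¬ G.Adj u v →
    ∃ i, (segment ℝ (pos u) (pos v) ∩ (obs i).toSet).Nonempty

open Filter Topology in
theorem MvPolynomial.tendsto_eval_div_pow {σ : Type*} [Fintype σ] (g : MvPolynomial σ ℝ) (m : ℕ)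
    (hg : ∀ j < m, MvPolynomial.homogeneousComponent j g = 0)
    (w : ℝ → σ → ℝ) (y : σ → ℝ)
    (hw : ∀ i, Tendsto (fun t => w t i / t) (𝓝[≠] 0) (𝓝 (y i))) :
    Tendsto (fun t => MvPolynomial.eval (w t) g / t ^ m) (𝓝[≠] 0)
      (𝓝 (MvPolynomial.eval y (MvPolynomial.homogeneousComponent m g))) := by
  have key : ∀ d ∈ g.support, Tendsto (fun t => (g.coeff d * ∏ i, w t i ^ d i) / t ^ m) (𝓝[≠] 0)
      (𝓝 (if d.degree = m then g.coeff d * ∏ i, y i ^ d i else 0)) := by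
    intro d hd
    have hdm : m ≤ d.degree := by
      by_contra! hlt
      have := congrArg (MvPolynomial.coeff d) (hg _ hlt)
      rw [MvPolynomial.coeff_homogeneousComponent] at this
      simp at this
      exact (MvPolynomial.mem_support_iff.1 hd) this
    have h1 : Tendsto (fun t : ℝ => t ^ (d.degree - m) * (g.coeff d * ∏ i, (w t i / t) ^ d i))
        (𝓝[≠] 0) (𝓝 ((0:ℝ) ^ (d.degree - m) * (g.coeff d * ∏ i, y i ^ d i))) := by
      apply Tendsto.mul
      · exact ((continuous_pow _).tendsto' _ _ rfl).mono_left nhdsWithin_le_nhds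
      · apply Tendsto.const_mul
        exact tendsto_finsetProd _ fun i _ => (hw i).pow _
    have h2 : (if d.degree = m then g.coeff d * ∏ i, y i ^ d i else 0) =
        (0:ℝ) ^ (d.degree - m) * (g.coeff d * ∏ i, y i ^ d i) := by
      split_ifs with h
      · simp [h]
      · rw [zero_pow (by omega)]; simp
    rw [h2]
    refine h1.congr' ?_
    filter_upwards [self_mem_nhdsWithin] with t ht
    have ht : t ≠ 0 := ht
    simp only [div_pow, Finset.prod_div_distrib, Finset.prod_pow_eq_pow_sum]
    have : ∑ i, d i = d.degree := by rw [Finsupp.degree_eq_sum]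
    rw [this]
    have h3 : t ^ d.degree = t ^ (d.degree - m) * t ^ m := by
      rw [← pow_add]; congr 1; omega
    rw [h3]
    field_simp
  have := tendsto_finsetSum _ key
  refine (this.congr ?_).trans_eq ?_
  · intro t
    rw [MvPolynomial.eval_eq', Finset.sum_div]
  · congr 1
    rw [MvPolynomial.homogeneousComponent_apply, map_sum, Finset.sum_filter]
    refine Finset.sum_congr rfl fun d _ => ?_
    split_ifs
    · rw [MvPolynomial.eval_monomial, Finsupp.prod_fintype _ _ (by simp)]
    · rfl

theorem MvPolynomial.finrank_restrictDegree {σ : Type*} [Fintype σ] (t : ℕ) :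
    Module.finrank ℝ (MvPolynomial.restrictDegree σ ℝ t) = (t + 1) ^ Fintype.card σ := by
  have e : {n : σ →₀ ℕ | ∀ i, n i ≤ t} ≃ (σ → Fin (t + 1)) :=
    { toFun := fun f i => ⟨f.1 i, Nat.lt_succ_of_le (f.2 i)⟩
      invFun := fun f => ⟨Finsupp.equivFunOnFinite.symm fun i => (f i : ℕ), fun i => by
        simpa using Nat.lt_succ_iff.1 (f i).2⟩
      left_inv := fun f => by ext; simp
      right_inv := fun f => by ext; simp }
  rw [MvPolynomial.restrictDegree, Module.finrank_eq_nat_card_basis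
    (MvPolynomial.basisRestrictSupport ℝ _), Nat.card_congr e]
  simp

theorem MvPolynomial.exists_interpolator {σ : Type*} [Fintype σ] (Z : Finset (σ → ℝ)) (z : σ → ℝ) :
    ∃ f : MvPolynomial σ ℝ, f.totalDegree ≤ Z.card ∧ MvPolynomial.eval z f = 1 ∧
      ∀ x ∈ Z, x ≠ z → MvPolynomial.eval x f = 0 := by
  have h1 : ∀ x : σ → ℝ, ∃ f : MvPolynomial σ ℝ, f.totalDegree ≤ 1 ∧
      MvPolynomial.eval z f = 1 ∧ (x ≠ z → MvPolynomial.eval x f = 0) := by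
    intro x
    by_cases h : x = z
    · exact ⟨1, by simp, by simp, fun h' => absurd h h'⟩
    · obtain ⟨i, hi⟩ := Function.ne_iff.1 h
      have : z i - x i ≠ 0 := sub_ne_zero.2 (Ne.symm hi)
      refine ⟨(z i - x i)⁻¹ • (MvPolynomial.X i - MvPolynomial.C (x i)), ?_, ?_, ?_⟩
      · refine (MvPolynomial.totalDegree_smul_le _ _).trans
          ((MvPolynomial.totalDegree_sub_C_le _ _).trans ?_)
        simp
      · simp [MvPolynomial.smul_eval, this]
      · intro _; simp [MvPolynomial.smul_eval]
  choose F hF1 hF2 hF3 using h1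
  refine ⟨∏ x ∈ Z, F x, ?_, ?_, ?_⟩
  · refine (MvPolynomial.totalDegree_finsetProd _ _).trans ?_
    refine (Finset.sum_le_sum fun x _ => hF1 x).trans ?_
    simp
  · rw [map_prod]; exact Finset.prod_eq_one fun x _ => hF2 x
  · intro x hx hxz
    rw [map_prod]; exact Finset.prod_eq_zero hx (hF3 x hxz)

theorem MvPolynomial.totalDegree_aeval_le {σ : Type*} [Fintype σ] (Q : σ → MvPolynomial σ ℝ) (D t : ℕ)
    (hQ : ∀ r, (Q r).totalDegree ≤ D) (g : MvPolynomial σ ℝ)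
    (hg : g ∈ MvPolynomial.restrictDegree σ ℝ t) :
    (MvPolynomial.aeval Q g).totalDegree ≤ t * (Fintype.card σ * D) := by
  rw [MvPolynomial.aeval_def, MvPolynomial.eval₂_eq']
  refine MvPolynomial.totalDegree_finsetSum_le fun d hd => ?_
  refine (MvPolynomial.totalDegree_mul _ _).trans ?_
  rw [MvPolynomial.algebraMap_eq, MvPolynomial.totalDegree_C, zero_add]
  refine (MvPolynomial.totalDegree_finsetProd _ _).trans ?_
  have : ∀ i ∈ (Finset.univ : Finset σ), (Q i ^ d i).totalDegree ≤ t * D := by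
    intro i _
    refine (MvPolynomial.totalDegree_pow _ _).trans ?_
    exact Nat.mul_le_mul ((MvPolynomial.mem_restrictDegree _ _ _).1 hg d hd i) (hQ i)
  refine (Finset.sum_le_sum this).trans ?_
  simp
  apply le_of_eq; ring

open Filter Topology in
/-- Common zeros at which the system has an invertible differential are few. -/
theorem MvPolynomial.card_nondegenerate_zeros_le {σ : Type*} [Fintype σ]
    (Q : σ → MvPolynomial σ ℝ) (D : ℕ)
    (hQ : ∀ r, (Q r).totalDegree ≤ D) (Z : Finset (σ → ℝ))
    (hZ : ∀ z ∈ Z, ∀ r, MvPolynomial.eval z (Q r) = 0)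
    (hJ : ∀ z ∈ Z, ∀ y : σ → ℝ, ∃ u : σ → ℝ, ∀ r,
      HasDerivAt (fun t : ℝ => MvPolynomial.eval (z + t • u) (Q r)) (y r) 0) :
    Z.card ≤ (Fintype.card σ * D + 1) ^ Fintype.card σ := by
  set k := Fintype.card σ with hk
  set N := Z.card with hN
  choose f hf1 hf2 hf3 using MvPolynomial.exists_interpolator Z
  have hmem : ∀ g : Z → MvPolynomial.restrictDegree σ ℝ N,
      (∑ z : Z, f z * MvPolynomial.aeval Q (g z : MvPolynomial σ ℝ)) ∈
        MvPolynomial.restrictDegree σ ℝ (N + N * (k * D)) := by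
    intro g
    refine Submodule.sum_mem _ fun z _ => ?_
    apply MvPolynomial.restrictTotalDegree_le_restrictDegree
    rw [MvPolynomial.mem_restrictTotalDegree]
    refine (MvPolynomial.totalDegree_mul _ _).trans ?_
    exact Nat.add_le_add (hf1 _) (MvPolynomial.totalDegree_aeval_le Q D N hQ _ (g z).2)
  let L : (Z → MvPolynomial.restrictDegree σ ℝ N) →ₗ[ℝ]
      MvPolynomial.restrictDegree σ ℝ (N + N * (k * D)) :=
    { toFun := fun g => ⟨_, hmem g⟩
      map_add' := fun g g' => by
        ext1; simp [mul_add, Finset.sum_add_distrib]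
      map_smul' := fun c g => by
        ext1; simp [Finset.smul_sum] }
  have hinj : Function.Injective L := by
    rw [← LinearMap.ker_eq_bot, LinearMap.ker_eq_bot']
    intro g hg
    have hg' : ∑ z : Z, f z * MvPolynomial.aeval Q (g z : MvPolynomial σ ℝ) = 0 :=
      congrArg Subtype.val hg
    have hcomp : ∀ m, ∀ z : Z,
        MvPolynomial.homogeneousComponent m (g z : MvPolynomial σ ℝ) = 0 := by
      intro m
      induction m using Nat.strong_induction_on with
      | _ m ih =>
        intro z
        apply MvPolynomial.funext
        intro y
        rw [map_zero]
        obtain ⟨u, hu⟩ := hJ z z.2 y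
        have hw : ∀ r, Tendsto (fun t : ℝ => MvPolynomial.eval ((z:σ → ℝ) + t • u) (Q r) / t)
            (𝓝[≠] 0) (𝓝 (y r)) := by
          intro r
          have := (hu r).tendsto_slope
          refine this.congr fun t => ?_
          simp [slope, hZ z z.2 r, div_eq_inv_mul]
        have hlim : ∀ z' : Z, Tendsto (fun t : ℝ => MvPolynomial.eval ((z:σ → ℝ) + t • u) (f z') *
            (MvPolynomial.eval (fun r => MvPolynomial.eval ((z:σ → ℝ) + t • u) (Q r))
              (g z' : MvPolynomial σ ℝ) / t ^ m)) (𝓝[≠] 0)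
            (𝓝 (MvPolynomial.eval (z : σ → ℝ) (f z') *
              MvPolynomial.eval y (MvPolynomial.homogeneousComponent m (g z' : MvPolynomial σ ℝ)))) := by
          intro z'
          refine Tendsto.mul ?_ (MvPolynomial.tendsto_eval_div_pow _ m (fun j hj => ih j hj z') _ _ hw)
          have : Continuous fun t : ℝ => MvPolynomial.eval ((z:σ → ℝ) + t • u) (f z') :=
            (MvPolynomial.continuous_eval _).comp (by fun_prop)
          exact (this.tendsto' 0 _ (by simp)).mono_left nhdsWithin_le_nhds
        have hsum := tendsto_finsetSum (Finset.univ : Finset Z) (fun z' _ => hlim z')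
        rw [Finset.sum_eq_single z] at hsum
        · rw [hf2, one_mul] at hsum
          refine tendsto_nhds_unique hsum ?_
          refine tendsto_const_nhds.congr fun t => ?_
          have := congrArg (MvPolynomial.eval ((z:σ → ℝ) + t • u)) hg'
          rw [map_sum, map_zero] at this
          simp only [← mul_div_assoc]
          rw [← Finset.sum_div]
          rw [eq_comm, div_eq_zero_iff]; left
          rw [← this]
          refine Finset.sum_congr rfl fun z' _ => ?_
          rw [map_mul]
          congr 1
          rw [MvPolynomial.aeval_def, MvPolynomial.eval₂_eq', MvPolynomial.eval_eq', map_sum]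
          simp
        · intro z' _ hne
          rw [hf3 z' z z.2 (fun h => hne (Subtype.ext h.symm)), zero_mul]
        · simp
    ext1 z
    ext1
    change (g z : MvPolynomial σ ℝ) = 0
    rw [← MvPolynomial.sum_homogeneousComponent (g z : MvPolynomial σ ℝ)]
    exact Finset.sum_eq_zero fun m _ => hcomp m z
  have h := LinearMap.finrank_le_finrank_of_injective hinj
  rw [Module.finrank_pi_fintype, MvPolynomial.finrank_restrictDegree] at h
  simp only [MvPolynomial.finrank_restrictDegree, Finset.sum_const, Finset.card_univ,
    Fintype.card_coe, smul_eq_mul, ← hk, ← hN] at h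
  have h2 : N + N * (k * D) + 1 ≤ (N + 1) * (k * D + 1) := by nlinarith [Nat.zero_le (k * D)]
  have h3 := h.trans (Nat.pow_le_pow_left h2 k)
  rw [mul_pow, mul_comm] at h3
  exact Nat.le_of_mul_le_mul_left h3 (by positivity)

theorem MvPolynomial.totalDegree_pderiv_le {σ : Type*} (p : MvPolynomial σ ℝ) (r : σ) :
    (MvPolynomial.pderiv r p).totalDegree ≤ p.totalDegree := by
  conv_lhs => rw [p.as_sum]
  rw [map_sum]
  refine MvPolynomial.totalDegree_finsetSum_le fun d hd => ?_
  rw [MvPolynomial.pderiv_monomial]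
  refine (MvPolynomial.totalDegree_monomial_le _ _).trans ?_
  refine le_trans ?_ (MvPolynomial.le_totalDegree hd)
  change (d - Finsupp.single r 1).degree ≤ d.degree
  exact Finsupp.degree_mono tsub_le_self

theorem MvPolynomial.hasDerivAt_eval_line {σ : Type*} [Fintype σ] (p : MvPolynomial σ ℝ)
    (z : σ → ℝ) (r : σ) :
    HasDerivAt (fun t : ℝ => MvPolynomial.eval (z + t • Pi.single r (1:ℝ)) p)
      (MvPolynomial.eval z (MvPolynomial.pderiv r p)) 0 := by
  induction p using MvPolynomial.induction_on with
  | C a => simpa using hasDerivAt_const (0:ℝ) a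
  | add p q hp hq =>
    simp only [map_add]
    exact hp.fun_add hq
  | mul_X p i hp =>
    have hx : HasDerivAt (fun t : ℝ => (z + t • (Pi.single r (1:ℝ) : σ → ℝ)) i)
        ((Pi.single r (1:ℝ) : σ → ℝ) i) 0 := by
      simpa using ((hasDerivAt_id (0:ℝ)).mul_const ((Pi.single r (1:ℝ) : σ → ℝ) i)).const_add (z i)
    have := hp.fun_mul hx
    simp only [map_mul, MvPolynomial.eval_X]
    refine this.congr_deriv ?_
    rw [MvPolynomial.pderiv_mul, map_add, map_mul, map_mul, MvPolynomial.pderiv_X,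
      MvPolynomial.eval_X]
    by_cases h : r = i
    · subst h; simp
    · simp [h]

open Filter Topology in
/-- Bounded open sets on which a polynomial does not vanish, but on whose frontiers it does. -/
theorem MvPolynomial.card_bounded_domains_le {σ ι : Type*} [Fintype σ] [Fintype ι]
    (p : MvPolynomial σ ℝ) (D : ℕ) (hp : p.totalDegree ≤ D) (U : ι → Set (σ → ℝ))
    (hdisj : ∀ i j, i ≠ j → Disjoint (U i) (U j)) (ho : ∀ i, IsOpen (U i))
    (hb : ∀ i, Bornology.IsBounded (U i)) (hne : ∀ i, (U i).Nonempty)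
    (hU : ∀ i, ∀ x ∈ U i, MvPolynomial.eval x p ≠ 0)
    (hF : ∀ i, ∀ x ∈ closure (U i), MvPolynomial.eval x p ≠ 0 → x ∈ U i) :
    Fintype.card ι ≤ (Fintype.card σ * D + 1) ^ Fintype.card σ := by
  set Φ : (σ → ℝ) → (σ → ℝ) := fun x r =>
    MvPolynomial.eval x (MvPolynomial.pderiv r p) / MvPolynomial.eval x p with hΦ
  have hdiff : ∀ q : MvPolynomial σ ℝ, Differentiable ℝ fun x => MvPolynomial.eval x q := fun q =>
    differentiableOn_univ.1 (AnalyticOnNhd.eval_mvPolynomial q).differentiableOn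
  have hΦd : ∀ x, MvPolynomial.eval x p ≠ 0 → DifferentiableAt ℝ Φ x := by
    intro x hx
    rw [differentiableAt_pi]
    intro r
    simp only [hΦ, div_eq_mul_inv]
    have h1 := hdiff (MvPolynomial.pderiv r p) x
    have h2 := (hdiff p x).fun_inv (by exact hx)
    exact h1.fun_mul h2
  set S : Set (σ → ℝ) := {x | MvPolynomial.eval x p ≠ 0 ∧ (fderiv ℝ Φ x).det = 0} with hS
  have hnull : MeasureTheory.volume (Φ '' S) = 0 :=
    MeasureTheory.addHaar_image_eq_zero_of_det_fderivWithin_eq_zero _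
      (f' := fun x => fderiv ℝ Φ x)
      (fun x hx => (hΦd x hx.1).hasFDerivAt.hasFDerivWithinAt) (fun x hx => hx.2)
  obtain ⟨v, hv⟩ : ∃ v, v ∉ Φ '' S := by
    by_contra! h
    have : Φ '' S = Set.univ := Set.eq_univ_of_forall h
    rw [this] at hnull
    exact (NeZero.ne (MeasureTheory.volume : MeasureTheory.Measure (σ → ℝ)))
      (MeasureTheory.Measure.measure_univ_eq_zero.1 hnull)
  have hex : ∀ i, ∃ z ∈ U i, ∀ r, MvPolynomial.eval z (MvPolynomial.pderiv r p) =
      v r * MvPolynomial.eval z p := by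
    intro i
    set F : (σ → ℝ) → ℝ := fun x => MvPolynomial.eval x p ^ 2 * Real.exp (-2 * ∑ j, v j * x j)
      with hFdef
    have hFc : Continuous F := by
      have := MvPolynomial.continuous_eval p
      fun_prop
    have hcomp : IsCompact (closure (U i)) := (hb i).isCompact_closure
    obtain ⟨z, hz, hzmax⟩ := hcomp.exists_isMaxOn (hne i).closure hFc.continuousOn
    obtain ⟨x0, hx0⟩ := hne i
    have hF0 : 0 < F x0 := by
      have := hU i x0 hx0
      simp only [hFdef]; positivity
    have hFz : 0 < F z := hF0.trans_le (hzmax (subset_closure hx0))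
    have hpz : MvPolynomial.eval z p ≠ 0 := by
      intro h0
      simp [hFdef, h0] at hFz
    have hzU := hF i z hz hpz
    refine ⟨z, hzU, fun r => ?_⟩
    have hline : Continuous fun t : ℝ => z + t • (Pi.single r (1:ℝ) : σ → ℝ) := by fun_prop
    have hloc : IsLocalMax (fun t : ℝ => F (z + t • (Pi.single r (1:ℝ) : σ → ℝ))) 0 := by
      have : ∀ᶠ t in 𝓝 (0:ℝ), z + t • (Pi.single r (1:ℝ) : σ → ℝ) ∈ U i :=
        hline.continuousAt.eventually_mem ((ho i).mem_nhds (by simpa using hzU))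
      filter_upwards [this] with t ht
      simpa using hzmax (subset_closure ht)
    have hd1 := (MvPolynomial.hasDerivAt_eval_line p z r).pow 2
    have hd2 : HasDerivAt (fun t : ℝ => -2 * ∑ j, v j * (z + t • (Pi.single r (1:ℝ) : σ → ℝ)) j)
        (-2 * ∑ j, v j * (Pi.single r (1:ℝ) : σ → ℝ) j) 0 := by
      apply HasDerivAt.const_mul
      apply HasDerivAt.fun_sum
      intro j _
      apply HasDerivAt.const_mul
      simpa using ((hasDerivAt_id (0:ℝ)).mul_const ((Pi.single r (1:ℝ) : σ → ℝ) j)).const_add (z j)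
    have h0 := hloc.hasDerivAt_eq_zero (hd1.mul hd2.exp)
    simp only [zero_smul, add_zero, Pi.single_apply, mul_ite, mul_one, mul_zero,
      Finset.sum_ite_eq', Finset.mem_univ, if_true, Pi.pow_apply] at h0
    have hexp := Real.exp_pos (-2 * ∑ j, v j * z j)
    set E := Real.exp (-2 * ∑ j, v j * z j)
    have : (2 * MvPolynomial.eval z p * E) *
      (MvPolynomial.eval z (MvPolynomial.pderiv r p) - v r * MvPolynomial.eval z p) = 0 := by
      linear_combination h0
    rcases mul_eq_zero.1 this with h | h
    · have : 2 * MvPolynomial.eval z p * E ≠ 0 := by positivity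
      exact absurd h this
    · linarith
  choose z hzU hz using hex
  have hzinj : Function.Injective z := by
    intro i j hij
    by_contra hne
    exact Set.disjoint_left.1 (hdisj i j hne) (hzU i) (hij ▸ hzU j)
  have := MvPolynomial.card_nondegenerate_zeros_le
    (fun r => MvPolynomial.pderiv r p - MvPolynomial.C (v r) * p) D ?_
    (Finset.univ.image z) ?_ ?_
  · rwa [Finset.card_image_of_injective _ hzinj, Finset.card_univ] at this
  · intro r
    refine (MvPolynomial.totalDegree_sub _ _).trans (max_le ?_ ?_)
    · exact (MvPolynomial.totalDegree_pderiv_le p r).trans hp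
    · refine (MvPolynomial.totalDegree_mul _ _).trans ?_
      simpa using hp
  · intro x hx r
    obtain ⟨i, -, rfl⟩ := Finset.mem_image.1 hx
    simp [hz i r]
  · intro x hx y
    obtain ⟨i, -, rfl⟩ := Finset.mem_image.1 hx
    have hpz := hU i _ (hzU i)
    have hΦz : Φ (z i) = v := by
      ext r
      simp [hΦ, hz i r, hpz]
    have hdet : (fderiv ℝ Φ (z i)).det ≠ 0 := fun h => hv ⟨z i, ⟨hpz, h⟩, hΦz⟩
    have hsurj : Function.Surjective (fderiv ℝ Φ (z i)) := by
      have hu : IsUnit (LinearMap.det (fderiv ℝ Φ (z i) : (σ → ℝ) →ₗ[ℝ] (σ → ℝ))) :=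
        isUnit_iff_ne_zero.2 hdet
      exact ((LinearMap.isUnit_iff_isUnit_det _).2 hu |> (Module.End.isUnit_iff _).1).2
    obtain ⟨u, hu⟩ := hsurj ((MvPolynomial.eval (z i) p)⁻¹ • y)
    refine ⟨u, fun r => ?_⟩
    have hline : HasDerivAt (fun t : ℝ => z i + t • u) u 0 := by
      simpa using ((hasDerivAt_id (0:ℝ)).smul_const u).const_add (z i)
    have hΦ1 : HasDerivAt (fun t : ℝ => Φ (z i + t • u)) (fderiv ℝ Φ (z i) u) 0 := by
      have h1 : HasFDerivAt Φ (fderiv ℝ Φ (z i)) (z i + (0:ℝ) • u) := by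
        simpa using (hΦd _ hpz).hasFDerivAt
      exact h1.comp_hasDerivAt (0:ℝ) hline
    have hΦ2 := (hasDerivAt_pi.1 hΦ1 r).sub_const (v r)
    have hp1 : HasDerivAt (fun t : ℝ => MvPolynomial.eval (z i + t • u) p)
        (fderiv ℝ (fun x => MvPolynomial.eval x p) (z i) u) 0 := by
      have h1 : HasFDerivAt (fun x => MvPolynomial.eval x p)
          (fderiv ℝ (fun x => MvPolynomial.eval x p) (z i)) (z i + (0:ℝ) • u) := by
        simpa using (hdiff p (z i)).hasFDerivAt
      exact h1.comp_hasDerivAt (0:ℝ) hline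
    have hprod := hp1.mul hΦ2
    have hne : ∀ᶠ t in 𝓝 (0:ℝ), MvPolynomial.eval (z i + t • u) p ≠ 0 := by
      have : ContinuousAt (fun t : ℝ => MvPolynomial.eval (z i + t • u) p) 0 := hp1.continuousAt
      exact this.eventually_ne (by simpa using hpz)
    refine (hprod.congr_of_eventuallyEq ?_).congr_deriv ?_
    · filter_upwards [hne] with t ht
      simp only [hΦ, Pi.mul_apply, map_sub, map_mul, MvPolynomial.eval_C]
      field_simp
    · rw [hu]
      simp [hΦz, hpz]

theorem MvPolynomial.card_signVectors_le_aux {σ ι : Type*} [Fintype σ] [Fintype ι]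
    (f : ι → MvPolynomial σ ℝ) (d : ℕ) (hf : ∀ i, (f i).totalDegree ≤ d)
    (S : Finset (ι → SignType))
    (hS : ∀ s ∈ S, ∃ x : σ → ℝ, ∀ i, SignType.sign (MvPolynomial.eval x (f i)) = s i) :
    S.card ≤ (Fintype.card σ * (2 + Fintype.card ι * (2 * d)) + 1) ^ Fintype.card σ := by
  have hS' : ∀ s : S, ∃ x : σ → ℝ, ∀ i, SignType.sign (MvPolynomial.eval x (f i)) = s.1 i :=
    fun s => hS s s.2
  choose x hx using hS'
  obtain ⟨ε, hε, hεx⟩ : ∃ ε : ℝ, 0 < ε ∧ ∀ s i, MvPolynomial.eval (x s) (f i) ≠ 0 →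
      ε < |MvPolynomial.eval (x s) (f i)| := by
    have hfin : (Set.univ : Set (S × ι)).Finite := Set.finite_univ
    have : ∀ᶠ ε in nhdsWithin (0:ℝ) (Set.Ioi 0), ∀ si : S × ι,
        MvPolynomial.eval (x si.1) (f si.2) ≠ 0 → ε < |MvPolynomial.eval (x si.1) (f si.2)| := by
      rw [Filter.eventually_all]
      intro si
      rw [Filter.eventually_imp_distrib_left]
      intro h
      exact Filter.Eventually.filter_mono nhdsWithin_le_nhds (eventually_lt_nhds (abs_pos.2 h))
    obtain ⟨ε, h1, h2⟩ := (this.and self_mem_nhdsWithin).exists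
    exact ⟨ε, h2, fun s i => h1 (s, i)⟩
  obtain ⟨R, hR⟩ : ∃ R : ℝ, ∀ s, ∑ j, x s j ^ 2 < R :=
    ⟨∑ s, ∑ j, x s j ^ 2 + 1, fun s => lt_of_le_of_lt
      (Finset.single_le_sum (f := fun s => ∑ j, x s j ^ 2)
        (fun s _ => Finset.sum_nonneg fun j _ => sq_nonneg _) (Finset.mem_univ s)) (lt_add_one _)⟩
  set p : MvPolynomial σ ℝ := (MvPolynomial.C R - ∑ j, MvPolynomial.X j ^ 2) *
    ∏ i, (f i ^ 2 - MvPolynomial.C (ε ^ 2)) with hp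
  have hpe : ∀ y, MvPolynomial.eval y p = (R - ∑ j, y j ^ 2) *
      ∏ i, (MvPolynomial.eval y (f i) ^ 2 - ε ^ 2) := by
    intro y
    simp only [hp, map_mul, map_sub, map_sum, map_pow, MvPolynomial.eval_C, MvPolynomial.eval_X,
      map_prod]
  have hpe' : ∀ y, MvPolynomial.eval y p ≠ 0 ↔ (R - ∑ j, y j ^ 2) ≠ 0 ∧
      ∀ i, MvPolynomial.eval y (f i) ^ 2 ≠ ε ^ 2 := by
    intro y
    rw [hpe, mul_ne_zero_iff, Finset.prod_ne_zero_iff]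
    simp [sub_eq_zero]
  let W : SignType → ℝ → Prop := fun s a =>
    (s = 0 → |a| < ε) ∧ (s = 1 → ε < a) ∧ (s = -1 → a < -ε)
  let W' : SignType → ℝ → Prop := fun s a =>
    (s = 0 → |a| ≤ ε) ∧ (s = 1 → ε ≤ a) ∧ (s = -1 → a ≤ -ε)
  let U : S → Set (σ → ℝ) := fun s =>
    {y | ∑ j, y j ^ 2 < R ∧ ∀ i, W (s.1 i) (MvPolynomial.eval y (f i))}
  have hcont : ∀ i, Continuous fun y : σ → ℝ => MvPolynomial.eval y (f i) :=
    fun i => MvPolynomial.continuous_eval _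
  have h3 : ∀ s : SignType, s = 0 ∨ s = 1 ∨ s = -1 := by decide
  have := MvPolynomial.card_bounded_domains_le p (2 + Fintype.card ι * (2 * d)) ?_ U ?_ ?_ ?_ ?_ ?_ ?_
  · simpa using this
  · refine (MvPolynomial.totalDegree_mul _ _).trans (Nat.add_le_add ?_ ?_)
    · refine (MvPolynomial.totalDegree_sub _ _).trans (max_le (by simp) ?_)
      refine MvPolynomial.totalDegree_finsetSum_le fun j _ => ?_
      simp
    · refine (MvPolynomial.totalDegree_finsetProd _ _).trans ?_
      rw [← smul_eq_mul, ← Finset.card_univ]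
      refine Finset.sum_le_card_nsmul _ _ _ fun i _ => ?_
      refine (MvPolynomial.totalDegree_sub_C_le _ _).trans
        ((MvPolynomial.totalDegree_pow _ _).trans ?_)
      exact Nat.mul_le_mul_left 2 (hf i)
  · intro s t hst
    rw [Set.disjoint_left]
    rintro y ⟨-, hy⟩ ⟨-, hy'⟩
    apply hst
    ext1; ext i
    have h1 := hy i
    have h2 := hy' i
    simp only [W] at h1 h2
    rcases h3 (s.1 i) with hs | hs | hs <;> rcases h3 (t.1 i) with ht | ht | ht <;>
      simp only [hs, ht] at h1 h2 ⊢ <;> exfalso <;>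
      simp [abs_lt] at h1 h2 <;> linarith
  · intro s
    simp only [U, W, Set.ofPred_and, Set.ofPred_forall]
    refine IsOpen.inter (isOpen_lt (by fun_prop) continuous_const) ?_
    refine isOpen_iInter_of_finite fun i => ?_
    refine IsOpen.inter ?_ (IsOpen.inter ?_ ?_)
    · exact isOpen_iInter_of_finite fun _ => isOpen_lt (hcont i).abs continuous_const
    · exact isOpen_iInter_of_finite fun _ => isOpen_lt continuous_const (hcont i)
    · exact isOpen_iInter_of_finite fun _ => isOpen_lt (hcont i) continuous_const
  · intro s
    rw [Metric.isBounded_iff_subset_closedBall 0]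
    refine ⟨R + 1, ?_⟩
    rintro y ⟨hy, -⟩
    have hR0 : 0 ≤ R := le_trans (Finset.sum_nonneg fun j _ => sq_nonneg _) hy.le
    rw [mem_closedBall_zero_iff, pi_norm_le_iff_of_nonneg (by linarith)]
    intro j
    have h1 : y j ^ 2 < R := lt_of_le_of_lt
      (Finset.single_le_sum (f := fun j => y j ^ 2) (fun j _ => sq_nonneg _) (Finset.mem_univ j)) hy
    rw [Real.norm_eq_abs]
    nlinarith [sq_abs (y j), abs_nonneg (y j), sq_nonneg (|y j| - 1)]
  · intro s
    refine ⟨x s, hR s, fun i => ?_⟩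
    have h1 := hx s i
    refine ⟨fun h => ?_, fun h => ?_, fun h => ?_⟩
    · rw [h, sign_eq_zero_iff] at h1
      rw [h1]; simpa using hε
    · rw [h, sign_eq_one_iff] at h1
      have := hεx s i h1.ne'
      rwa [abs_of_pos h1] at this
    · rw [h, sign_eq_neg_one_iff] at h1
      have := hεx s i h1.ne
      rw [abs_of_neg h1] at this
      linarith
  · rintro s y ⟨hy, hy'⟩
    rw [hpe']
    refine ⟨by linarith, fun i h => ?_⟩
    have h2 := hy' i
    rw [sq_eq_sq_iff_abs_eq_abs, abs_of_pos hε] at h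
    simp only [W] at h2
    rcases h3 (s.1 i) with hs | hs | hs <;> simp [hs] at h2
    · linarith
    · have := le_abs_self (MvPolynomial.eval y (f i))
      linarith
    · have := neg_le_abs (MvPolynomial.eval y (f i))
      linarith
  · intro s y hy hpy
    rw [hpe'] at hpy
    have hcl : IsClosed {y : σ → ℝ | ∑ j, y j ^ 2 ≤ R ∧
        ∀ i, W' (s.1 i) (MvPolynomial.eval y (f i))} := by
      simp only [W', Set.ofPred_and, Set.ofPred_forall]
      refine IsClosed.inter (isClosed_le (by fun_prop) continuous_const) ?_
      refine isClosed_iInter fun i => ?_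
      refine IsClosed.inter ?_ (IsClosed.inter ?_ ?_)
      · exact isClosed_iInter fun _ => isClosed_le (hcont i).abs continuous_const
      · exact isClosed_iInter fun _ => isClosed_le continuous_const (hcont i)
      · exact isClosed_iInter fun _ => isClosed_le (hcont i) continuous_const
    have hsub : U s ⊆ {y : σ → ℝ | ∑ j, y j ^ 2 ≤ R ∧
        ∀ i, W' (s.1 i) (MvPolynomial.eval y (f i))} := by
      rintro y ⟨h1, h2⟩
      exact ⟨h1.le, fun i => ⟨fun h => ((h2 i).1 h).le, fun h => ((h2 i).2.1 h).le,
        fun h => ((h2 i).2.2 h).le⟩⟩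
    obtain ⟨h1, h2⟩ := closure_minimal hsub hcl hy
    refine ⟨lt_of_le_of_ne h1 fun h => hpy.1 (by rw [h]; ring), fun i => ?_⟩
    have h4 := hpy.2 i
    have h5 := h2 i
    have h6 : |MvPolynomial.eval y (f i)| ≠ ε := fun h => h4 (by
      rw [sq_eq_sq_iff_abs_eq_abs, abs_of_pos hε, h])
    refine ⟨fun h => lt_of_le_of_ne (h5.1 h) h6, fun h => lt_of_le_of_ne (h5.2.1 h) ?_,
      fun h => lt_of_le_of_ne (h5.2.2 h) ?_⟩
    · intro h7; exact h6 (by rw [← h7, abs_of_pos hε])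
    · intro h7; exact h6 (by rw [h7, abs_neg, abs_of_pos hε])

/-- A bound on the number of sign vectors realised by finitely many real polynomials. -/
theorem MvPolynomial.ncard_signVectors_le {σ ι : Type*} [Fintype σ] [Fintype ι]
    (f : ι → MvPolynomial σ ℝ) (d : ℕ) (hf : ∀ i, (f i).totalDegree ≤ d) :
    (Set.range fun (x : σ → ℝ) (i : ι) => SignType.sign (MvPolynomial.eval x (f i))).ncard ≤
      (Fintype.card σ * (2 + Fintype.card ι * (2 * d)) + 1) ^ Fintype.card σ := by
  have hfin : (Set.range fun (x : σ → ℝ) (i : ι) =>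
      SignType.sign (MvPolynomial.eval x (f i))).Finite := Set.toFinite _
  rw [Set.ncard_eq_toFinset_card _ hfin]
  refine MvPolynomial.card_signVectors_le_aux f d hf _ fun s hs => ?_
  obtain ⟨x, rfl⟩ := hfin.mem_toFinset.1 hs
  exact ⟨x, fun i => rfl⟩

/-- A finite family of affine functions `(x, y) ↦ A x + B y + C` on the plane. -/
structure AffineFamily (T : Type*) where
  A : T → ℝ
  B : T → ℝ
  C : T → ℝ

namespace AffineFamily

variable {T : Type*} (F F' : AffineFamily T)

def val (t : T) (y : ℝ × ℝ) : ℝ := F.A t * y.1 + F.B t * y.2 + F.C t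

def cross (s t : T) : ℝ := F.A s * F.B t - F.A t * F.B s

def det (r s t : T) : ℝ :=
  F.A r * (F.B s * F.C t - F.B t * F.C s) - F.B r * (F.A s * F.C t - F.A t * F.C s) +
    F.C r * (F.A s * F.B t - F.A t * F.B s)

def slope (t : T) (d : ℝ × ℝ) : ℝ := F.A t * d.1 + F.B t * d.2

theorem val_add_smul (t : T) (y d : ℝ × ℝ) (β : ℝ) :
    F.val t (y + β • d) = F.val t y + β * F.slope t d := by
  simp [val, slope]; ring

theorem continuous_val (t : T) : Continuous (F.val t) := by
  unfold val; fun_prop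

/-- Some point has the same signs with respect to `F'` as `y` has with respect to `F`. -/
def Transfers (y : ℝ × ℝ) : Prop :=
  ∃ y', ∀ t, SignType.sign (F'.val t y') = SignType.sign (F.val t y)

variable {F F'}

theorem transfers_of_cross_ne_zero
    (hc : ∀ s t, SignType.sign (F'.cross s t) = SignType.sign (F.cross s t))
    (hd : ∀ r s t, SignType.sign (F'.det r s t) = SignType.sign (F.det r s t))
    {y : ℝ × ℝ} {s t : T} (hs : F.val s y = 0) (ht : F.val t y = 0) (hst : F.cross s t ≠ 0) :
    F.Transfers F' y := by
  have hst' : F'.cross s t ≠ 0 := by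
    rw [← sign_ne_zero, hc, sign_ne_zero]; exact hst
  set y' : ℝ × ℝ := ((F'.B s * F'.C t - F'.B t * F'.C s) / F'.cross s t,
    (F'.C s * F'.A t - F'.C t * F'.A s) / F'.cross s t) with hy'
  have hdet : ∀ r, F'.det r s t = F'.cross s t * F'.val r y' := by
    intro r
    simp only [hy', val]
    field_simp
    simp only [det, cross]; ring
  have hdet0 : ∀ r, F.det r s t = F.cross s t * F.val r y := by
    intro r
    simp only [val] at hs ht
    have : F.C s = -(F.A s * y.1 + F.B s * y.2) := by linarith
    have h2 : F.C t = -(F.A t * y.1 + F.B t * y.2) := by linarith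
    simp only [det, cross, val, this, h2]; ring
  refine ⟨y', fun r => ?_⟩
  have h1 := hd r s t
  rw [hdet, hdet0, sign_mul, sign_mul, hc] at h1
  exact mul_left_cancel₀ (by rwa [sign_ne_zero]) h1

/-- The signs of `F` at `z` are obtained from those at `y` by replacing some of them by zero. -/
def WeakSigns (F : AffineFamily T) (y z : ℝ × ℝ) : Prop :=
  ∀ t, (0 ≤ F.val t y → 0 ≤ F.val t z) ∧ (F.val t y ≤ 0 → F.val t z ≤ 0)

theorem Transfers.between {y d : ℝ × ℝ} {α β : ℝ} (hα : 0 < α) (hβ : 0 < β)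
    (h1 : F.Transfers F' (y + α • (-d))) (h2 : F.Transfers F' (y + β • d))
    (w1 : F.WeakSigns y (y + α • (-d))) (w2 : F.WeakSigns y (y + β • d)) :
    F.Transfers F' y := by
  obtain ⟨z1, hz1⟩ := h1
  obtain ⟨z2, hz2⟩ := h2
  refine ⟨(1 / 2 : ℝ) • (z1 + z2), fun t => ?_⟩
  have hv : F'.val t ((1 / 2 : ℝ) • (z1 + z2)) = (F'.val t z1 + F'.val t z2) / 2 := by
    simp [val]; ring
  have e1 := hz1 t
  have e2 := hz2 t
  have u1 := w1 t
  have u2 := w2 t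
  have k1 := F.val_add_smul t y (-d) α
  have k2 := F.val_add_smul t y d β
  have hneg : F.slope t (-d) = - F.slope t d := by simp [slope]; ring
  rw [hneg] at k1
  have key : β * F.val t (y + α • (-d)) + α * F.val t (y + β • d) = (α + β) * F.val t y := by
    rw [k1, k2]; ring
  rw [hv]
  rcases lt_trichotomy (F.val t y) 0 with h | h | h
  · have a1 := u1.2 h.le
    have a2 := u2.2 h.le
    rw [sign_neg h, sign_eq_neg_one_iff]
    have b1 : F'.val t z1 ≤ 0 := by
      rw [← sign_nonpos_iff, e1, sign_nonpos_iff]; exact a1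
    have b2 : F'.val t z2 ≤ 0 := by
      rw [← sign_nonpos_iff, e2, sign_nonpos_iff]; exact a2
    rcases a1.lt_or_eq with c | c
    · rw [sign_neg c, sign_eq_neg_one_iff] at e1; linarith
    · rcases a2.lt_or_eq with c' | c'
      · rw [sign_neg c', sign_eq_neg_one_iff] at e2; linarith
      · rw [c, c'] at key; nlinarith
  · have a1 := le_antisymm (u1.2 h.le) (u1.1 h.ge)
    have a2 := le_antisymm (u2.2 h.le) (u2.1 h.ge)
    rw [a1, sign_zero, sign_eq_zero_iff] at e1
    rw [a2, sign_zero, sign_eq_zero_iff] at e2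
    simp [e1, e2, h]
  · have a1 := u1.1 h.le
    have a2 := u2.1 h.le
    rw [sign_pos h, sign_eq_one_iff]
    have b1 : 0 ≤ F'.val t z1 := by
      rw [← sign_nonneg_iff, e1, sign_nonneg_iff]; exact a1
    have b2 : 0 ≤ F'.val t z2 := by
      rw [← sign_nonneg_iff, e2, sign_nonneg_iff]; exact a2
    rcases a1.lt_or_eq with c | c
    · rw [sign_pos c, sign_eq_one_iff] at e1; linarith
    · rcases a2.lt_or_eq with c' | c'
      · rw [sign_pos c', sign_eq_one_iff] at e2; linarith
      · rw [← c, ← c'] at key; nlinarith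

/-- Three members of the family bound a triangle. -/
structure IsTriangle (F : AffineFamily T) (t0 t1 t2 : T) : Prop where
  sumA : F.A t0 + F.A t1 + F.A t2 = 0
  sumB : F.B t0 + F.B t1 + F.B t2 = 0
  cross_ne : F.cross t0 t1 ≠ 0

/-- The triangle on which the three given members of the family are nonnegative. -/
def triangle (F : AffineFamily T) (t0 t1 t2 : T) : Set (ℝ × ℝ) :=
  {y | 0 ≤ F.val t0 y ∧ 0 ≤ F.val t1 y ∧ 0 ≤ F.val t2 y}

theorem exists_step [Finite T] {t0 t1 t2 : T} (hT : F.IsTriangle t0 t1 t2) {y : ℝ × ℝ}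
    (hy : y ∈ F.triangle t0 t1 t2) {d : ℝ × ℝ} (hd : d ≠ 0)
    (ht : ∀ t, F.val t y = 0 → F.slope t d = 0) :
    ∃ β : ℝ, 0 < β ∧ F.WeakSigns y (y + β • d) ∧
      ∃ t, F.val t (y + β • d) = 0 ∧ F.slope t d ≠ 0 := by
  cases nonempty_fintype T
  set S := Finset.univ.filter fun t => F.val t y * F.slope t d < 0 with hS
  have hne : S.Nonempty := by
    by_contra hemp
    rw [Finset.not_nonempty_iff_eq_empty, Finset.filter_eq_empty_iff] at hemp
    have hall : ∀ t, 0 ≤ F.val t y → 0 ≤ F.slope t d := by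
      intro t h
      by_contra! hlt
      rcases h.lt_or_eq with h | h
      · exact hemp (Finset.mem_univ t) (mul_neg_of_pos_of_neg h hlt)
      · rw [ht t h.symm] at hlt; exact lt_irrefl _ hlt
    have h0 := hall t0 hy.1
    have h1 := hall t1 hy.2.1
    have h2 := hall t2 hy.2.2
    have hsum : F.slope t0 d + F.slope t1 d + F.slope t2 d = 0 := by
      simp only [slope]
      linear_combination d.1 * hT.sumA + d.2 * hT.sumB
    have z0 : F.slope t0 d = 0 := by linarith
    have z1 : F.slope t1 d = 0 := by linarith
    simp only [slope] at z0 z1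
    have c1 : F.cross t0 t1 * d.1 = 0 := by
      simp only [cross]; linear_combination F.B t1 * z0 - F.B t0 * z1
    have c2 : F.cross t0 t1 * d.2 = 0 := by
      simp only [cross]; linear_combination F.A t0 * z1 - F.A t1 * z0
    exact hd (Prod.ext ((mul_eq_zero.1 c1).resolve_left hT.cross_ne)
      ((mul_eq_zero.1 c2).resolve_left hT.cross_ne))
  obtain ⟨m, hm, hmin⟩ := S.exists_min_image (fun t => -F.val t y / F.slope t d) hne
  have hm' : F.val m y * F.slope m d < 0 := (Finset.mem_filter.1 hm).2
  have hsl : ∀ t, F.val t y * F.slope t d < 0 → F.slope t d ≠ 0 := fun t h h0 => by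
    rw [h0, mul_zero] at h; exact lt_irrefl _ h
  have hβ : 0 < -F.val m y / F.slope m d := by
    rcases lt_or_gt_of_ne (hsl m hm') with h | h
    · exact div_pos_of_neg_of_neg (by nlinarith) h
    · exact div_pos (by nlinarith) h
  refine ⟨_, hβ, fun t => ?_, m, ?_, hsl m hm'⟩
  · rw [val_add_smul]
    set β := -F.val m y / F.slope m d
    have hb : F.val t y * F.slope t d < 0 → β ≤ -F.val t y / F.slope t d := fun h =>
      hmin t (Finset.mem_filter.2 ⟨Finset.mem_univ _, h⟩)
    constructor
    · intro h
      by_cases hs : 0 ≤ F.slope t d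
      · positivity
      · push Not at hs
        rcases h.lt_or_eq with h | h
        · have := hb (mul_neg_of_pos_of_neg h hs)
          rw [le_div_iff_of_neg hs] at this
          linarith
        · exact absurd (ht t h.symm) hs.ne
    · intro h
      by_cases hs : F.slope t d ≤ 0
      · nlinarith
      · push Not at hs
        rcases h.lt_or_eq with h | h
        · have := hb (mul_neg_of_neg_of_pos h hs)
          rw [le_div_iff₀ hs] at this
          linarith
        · exact absurd (ht t h) hs.ne'
  · rw [val_add_smul]
    have := hsl m hm'
    field_simp
    ring

theorem WeakSigns.mem_triangle {t0 t1 t2 : T} {y z : ℝ × ℝ} (h : F.WeakSigns y z)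
    (hy : y ∈ F.triangle t0 t1 t2) : z ∈ F.triangle t0 t1 t2 :=
  ⟨(h t0).1 hy.1, (h t1).1 hy.2.1, (h t2).1 hy.2.2⟩

theorem slope_neg (t : T) (d : ℝ × ℝ) : F.slope t (-d) = -F.slope t d := by
  simp [slope]; ring

theorem transfers_of_mem_triangle [Finite T] {t0 t1 t2 : T}
    (hT : F.IsTriangle t0 t1 t2)
    (hc : ∀ s t, SignType.sign (F'.cross s t) = SignType.sign (F.cross s t))
    (hd : ∀ r s t, SignType.sign (F'.det r s t) = SignType.sign (F.det r s t))
    {y : ℝ × ℝ} (hy : y ∈ F.triangle t0 t1 t2) : F.Transfers F' y := by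
  have step1 : ∀ y ∈ F.triangle t0 t1 t2, ∀ s, F.val s y = 0 → (F.A s ≠ 0 ∨ F.B s ≠ 0) →
      F.Transfers F' y := by
    intro y hy s hs hAB
    by_cases hvert : ∃ t, F.val t y = 0 ∧ F.cross s t ≠ 0
    · obtain ⟨t, ht, hst⟩ := hvert
      exact transfers_of_cross_ne_zero hc hd hs ht hst
    · push Not at hvert
      set d : ℝ × ℝ := (-F.B s, F.A s) with hdd
      have hd0 : d ≠ 0 := by
        intro h
        rw [Prod.ext_iff] at h
        simp [hdd] at h
        tauto
      have hsl : ∀ t, F.slope t d = F.cross s t := by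
        intro t; simp only [slope, cross, hdd]; ring
      have ht : ∀ t, F.val t y = 0 → F.slope t d = 0 := fun t h => by rw [hsl]; exact hvert t h
      obtain ⟨β, hβ, w2, t2', v2, s2⟩ := exists_step hT hy hd0 ht
      obtain ⟨α, hα, w1, t1', v1, s1⟩ := exists_step hT hy (neg_ne_zero.2 hd0)
        (fun t h => by rw [slope_neg, ht t h, neg_zero])
      have hs1 := le_antisymm ((w1 s).2 hs.le) ((w1 s).1 hs.ge)
      have hs2 := le_antisymm ((w2 s).2 hs.le) ((w2 s).1 hs.ge)
      refine Transfers.between hα hβ ?_ ?_ w1 w2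
      · refine transfers_of_cross_ne_zero hc hd hs1 v1 ?_
        rw [← hsl]; rw [slope_neg] at s1; exact fun h => s1 (by rw [h, neg_zero])
      · refine transfers_of_cross_ne_zero hc hd hs2 v2 ?_
        rw [← hsl]; exact s2
  by_cases h : ∃ s, F.val s y = 0 ∧ (F.A s ≠ 0 ∨ F.B s ≠ 0)
  · obtain ⟨s, hs, hAB⟩ := h
    exact step1 y hy s hs hAB
  · push Not at h
    have hd0 : ((1, 0) : ℝ × ℝ) ≠ 0 := by simp
    have ht : ∀ t, F.val t y = 0 → F.slope t (1, 0) = 0 := fun t ht => by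
      simp [slope, (h t ht).1]
    have hAB : ∀ t d, F.slope t d ≠ 0 → F.A t ≠ 0 ∨ F.B t ≠ 0 := by
      intro t d hs
      by_contra! hAB
      exact hs (by simp [slope, hAB.1, hAB.2])
    obtain ⟨β, hβ, w2, t2', v2, s2⟩ := exists_step hT hy hd0 ht
    obtain ⟨α, hα, w1, t1', v1, s1⟩ := exists_step hT hy (neg_ne_zero.2 hd0)
      (fun t h => by rw [slope_neg, ht t h, neg_zero])
    exact Transfers.between hα hβ (step1 _ (w1.mem_triangle hy) _ v1 (hAB _ _ s1))
      (step1 _ (w2.mem_triangle hy) _ v2 (hAB _ _ s2)) w1 w2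

end AffineFamily

namespace AffineFamily

variable {T : Type*} {F F' : AffineFamily T}

theorem val_segment (t : T) (y z : ℝ × ℝ) {a b : ℝ} (hab : a + b = 1) :
    F.val t (a • y + b • z) = a * F.val t y + b * F.val t z := by
  have : F.C t = a * F.C t + b * F.C t := by rw [← add_mul, hab, one_mul]
  simp [val]; linear_combination this

/-- The sign vector of a point with respect to an affine family. -/
def signs (F : AffineFamily T) (y : ℝ × ℝ) : T → SignType := fun t => SignType.sign (F.val t y)

theorem convex_val_nonpos (t : T) : Convex ℝ {y | F.val t y ≤ 0} := by
  intro y hy z hz a b ha hb hab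
  simp only [Set.mem_ofPred_eq] at *
  rw [val_segment t y z hab]
  nlinarith

theorem eventually_signs [Finite T] (y : ℝ × ℝ) :
    ∀ᶠ z in nhds y, ∀ t, F.signs y t ≠ 0 → F.signs z t = F.signs y t := by
  rw [Filter.eventually_all]
  intro t
  have hc := (continuous_val (F := F) t).continuousAt (x := y)
  rcases lt_trichotomy (F.val t y) 0 with h | h | h
  · filter_upwards [hc.eventually_lt_const h] with z hz _
    rw [signs, signs, sign_neg h, sign_neg hz]
  · exact Filter.Eventually.of_forall fun z hz => by simp [signs, h] at hz
  · filter_upwards [hc.eventually_const_lt h] with z hz _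
    rw [signs, signs, sign_pos h, sign_pos hz]

theorem signs_segment {y z : ℝ × ℝ} (h : ∀ t, F.signs y t ≠ 0 → F.signs z t = F.signs y t)
    {a b : ℝ} (ha : 0 < a) (hb : 0 ≤ b) (hab : a + b = 1) :
    F.signs (a • z + b • y) = F.signs z := by
  funext t
  have h1 := h t
  simp only [signs, val_segment t z y hab] at h1 ⊢
  rcases lt_trichotomy (F.val t y) 0 with hy | hy | hy
  · have := h1 (by simp [sign_neg hy])
    rw [this]
    rw [sign_neg hy, sign_eq_neg_one_iff] at this
    rw [sign_neg hy, sign_eq_neg_one_iff]; nlinarith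
  · rw [hy, mul_zero, add_zero, sign_mul, sign_pos ha, one_mul]
  · have := h1 (by simp [sign_pos hy])
    rw [this]
    rw [sign_pos hy, sign_eq_one_iff] at this
    rw [sign_pos hy, sign_eq_one_iff]; nlinarith

/-- Sign vectors realized in the component of `o` in a sign-defined set are, inside the triangle,
realized only in the component of `o'` in the corresponding set of an equivalent family. -/
theorem mem_component_of_signs_eq [Finite T] {t0 t1 t2 : T}
    (hT : F.IsTriangle t0 t1 t2)
    (hc : ∀ s t, SignType.sign (F'.cross s t) = SignType.sign (F.cross s t))
    (hd : ∀ r s t, SignType.sign (F'.det r s t) = SignType.sign (F.det r s t))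
    (D : Set (T → SignType)) {o o' : ℝ × ℝ}
    (hK : ∀ y, F'.val t0 y ≤ 0 ∨ F'.val t1 y ≤ 0 ∨ F'.val t2 y ≤ 0 → F'.signs y ∉ D)
    (h01 : ∃ y, F'.val t0 y ≤ 0 ∧ F'.val t1 y ≤ 0)
    (h12 : ∃ y, F'.val t1 y ≤ 0 ∧ F'.val t2 y ≤ 0)
    (ho : F.val t0 o ≤ 0) (ho' : F'.val t0 o' ≤ 0) {y y' : ℝ × ℝ}
    (hy : y ∈ connectedComponentIn {y | F.signs y ∉ D} o)
    (hyT : y ∈ F.triangle t0 t1 t2) (hyy : F'.signs y' = F.signs y) :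
    y' ∈ connectedComponentIn {y | F'.signs y ∉ D} o' := by
  set S' := {y | F'.signs y ∉ D} with hS'
  have hKconn : IsPreconnected ({y | F'.val t0 y ≤ 0} ∪ {y | F'.val t1 y ≤ 0} ∪
      {y | F'.val t2 y ≤ 0}) := by
    obtain ⟨p, hp⟩ := h01
    obtain ⟨q, hq⟩ := h12
    refine IsPreconnected.union q (Or.inr hq.1) hq.2 ?_ (convex_val_nonpos t2).isPreconnected
    exact IsPreconnected.union p hp.1 hp.2 (convex_val_nonpos t0).isPreconnected
      (convex_val_nonpos t1).isPreconnected
  have hKO : ∀ y, F'.val t0 y ≤ 0 ∨ F'.val t1 y ≤ 0 ∨ F'.val t2 y ≤ 0 →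
      y ∈ connectedComponentIn S' o' := by
    intro y hy
    refine hKconn.subset_connectedComponentIn (F := S') (Or.inl (Or.inl ho')) ?_ ?_
    · rintro z ((hz | hz) | hz)
      · exact hK z (Or.inl hz)
      · exact hK z (Or.inr (Or.inl hz))
      · exact hK z (Or.inr (Or.inr hz))
    · rcases hy with h | h | h
      · exact Or.inl (Or.inl h)
      · exact Or.inl (Or.inr h)
      · exact Or.inr h
  have hKO' : ∀ y y', F'.signs y' = F.signs y →
      (F.val t0 y ≤ 0 ∨ F.val t1 y ≤ 0 ∨ F.val t2 y ≤ 0) → y' ∈ connectedComponentIn S' o' := by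
    intro y y' hs h
    have aux : ∀ t, F.val t y ≤ 0 → F'.val t y' ≤ 0 := by
      intro t ht
      have := congrFun hs t
      simp only [signs] at this
      rcases ht.lt_or_eq with h | h
      · rw [sign_neg h, sign_eq_neg_one_iff] at this; exact this.le
      · rw [h, sign_zero, sign_eq_zero_iff] at this; exact this.le
    exact hKO _ (h.imp (aux _) (Or.imp (aux _) (aux _)))
  let good : ℝ × ℝ → Prop := fun y => y ∈ F.triangle t0 t1 t2 → ∀ y', F'.signs y' = F.signs y →
    y' ∈ connectedComponentIn S' o'
  have hoS : o ∈ {y | F.signs y ∉ D} := by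
    by_contra h
    rw [connectedComponentIn_eq_empty h] at hy
    exact hy
  have key := (isPreconnected_connectedComponentIn
    (F := {y | F.signs y ∉ D}) (x := o)).induction₂ (fun x y => good x ↔ good y) ?_
    ?_ ?_ (mem_connectedComponentIn hoS) hy
  · exact key.1 (fun _ o'' h => hKO' o o'' h (Or.inl ho)) hyT y' hyy
  · intro x hx
    have hxS : F.signs x ∉ D := connectedComponentIn_subset _ _ hx
    filter_upwards [eventually_nhdsWithin_of_eventually_nhds (eventually_signs (F := F) x),
      self_mem_nhdsWithin] with z hz hzO
    have hzS : F.signs z ∉ D := connectedComponentIn_subset _ _ hzO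
    have htri : z ∈ F.triangle t0 t1 t2 → x ∈ F.triangle t0 t1 t2 := by
      have aux : ∀ t, 0 ≤ F.val t z → 0 ≤ F.val t x := by
        intro t ht
        by_contra! h
        have := hz t (by simp [signs, sign_neg h])
        simp only [signs] at this
        rw [sign_neg h, sign_eq_neg_one_iff] at this; linarith
      rintro ⟨h0, h1, h2⟩
      exact ⟨aux _ h0, aux _ h1, aux _ h2⟩
    by_cases hxT : x ∈ F.triangle t0 t1 t2
    swap
    · exact iff_of_true (fun h => absurd h hxT) (fun h => absurd (htri h) hxT)
    by_cases hzT : z ∈ F.triangle t0 t1 t2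
    swap
    · refine iff_of_true (fun _ x' hx' => hKO' x x' hx' ?_) (fun h => absurd h hzT)
      have aux : ∀ t, F.val t z < 0 → F.val t x ≤ 0 := by
        intro t ht
        by_contra! h
        have := hz t (by simp [signs, sign_pos h])
        simp only [signs] at this
        rw [sign_pos h, sign_eq_one_iff] at this; linarith
      by_contra! h
      refine hzT ⟨?_, ?_, ?_⟩ <;> by_contra! h'
      · exact absurd (aux _ h') h.1.not_ge
      · exact absurd (aux _ h') h.2.1.not_ge
      · exact absurd (aux _ h') h.2.2.not_ge
    have hseg : ∀ x' z', F'.signs x' = F.signs x → F'.signs z' = F.signs z →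
        (x' ∈ connectedComponentIn S' o' ↔ z' ∈ connectedComponentIn S' o') := by
      intro x' z' hx' hz'
      have hsub : segment ℝ z' x' ⊆ S' := by
        rintro _ ⟨a, b, ha, hb, hab, rfl⟩
        rcases ha.lt_or_eq with ha | ha
        · simp only [hS', Set.mem_ofPred_eq]
          rw [signs_segment (F := F') (by rw [hx', hz']; exact hz) ha hb hab, hz']
          exact hzS
        · obtain rfl : b = 1 := by linarith
          simp only [hS', Set.mem_ofPred_eq, ← ha, zero_smul, one_smul, zero_add, hx']
          exact hxS
      have hpre := (convex_segment (𝕜 := ℝ) z' x').isPreconnected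
      constructor
      · intro h
        rw [connectedComponentIn_eq h]
        exact hpre.subset_connectedComponentIn (right_mem_segment _ _ _) hsub
          (left_mem_segment _ _ _)
      · intro h
        rw [connectedComponentIn_eq h]
        exact hpre.subset_connectedComponentIn (left_mem_segment _ _ _) hsub
          (right_mem_segment _ _ _)
    constructor
    · intro h _ z' hz'
      obtain ⟨x', hx'⟩ := transfers_of_mem_triangle hT hc hd hxT
      exact (hseg x' z' (funext hx') hz').1 (h hxT x' (funext hx'))
    · intro h _ x' hx'
      obtain ⟨z', hz'⟩ := transfers_of_mem_triangle hT hc hd hzT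
      exact (hseg x' z' hx' (funext hz')).2 (h hzT z' (funext hz'))
  · intro x y z _ _ _ h1 h2; exact h1.trans h2
  · intro x y _ _ h; exact h.symm

end AffineFamily

/-- Twice the signed area of the triangle `p q y`. -/
def orient (p q y : ℝ × ℝ) : ℝ := (q.1 - p.1) * (y.2 - p.2) - (q.2 - p.2) * (y.1 - p.1)

theorem mem_segment_iff_orient {u v y : ℝ × ℝ} {K : Set (ℝ × ℝ)}
    (hK : ∃ k ∈ K, orient u v k ≠ 0) :
    y ∈ segment ℝ u v ↔ orient u v y = 0 ∧
      ∀ k ∈ K, 0 ≤ orient v k y * orient u v k ∧ 0 ≤ orient k u y * orient u v k := by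
  constructor
  · rintro ⟨a, b, ha, hb, hab, rfl⟩
    obtain rfl : a = 1 - b := by linarith
    refine ⟨by simp [orient]; ring, fun k _ => ⟨?_, ?_⟩⟩
    · have : orient v k ((1 - b) • u + b • v) * orient u v k =
          (1 - b) * (orient u v k * orient u v k) := by simp [orient]; ring
      rw [this]; exact mul_nonneg ha (mul_self_nonneg _)
    · have : orient k u ((1 - b) • u + b • v) * orient u v k =
          b * (orient u v k * orient u v k) := by simp [orient]; ring
      rw [this]; exact mul_nonneg hb (mul_self_nonneg _)
  · rintro ⟨h0, h⟩
    obtain ⟨k, hkK, hk⟩ := hK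
    obtain ⟨h1, h2⟩ := h k hkK
    have hpos : 0 < orient u v k * orient u v k := mul_self_pos.2 hk
    have hsum : orient v k y + orient k u y = orient u v k := by
      have : orient v k y + orient k u y + orient u v y = orient u v k := by
        simp [orient]; ring
      linarith
    refine ⟨orient v k y / orient u v k, orient k u y / orient u v k, ?_, ?_, ?_, ?_⟩
    · rw [← mul_div_mul_right _ _ hk]; exact div_nonneg h1 hpos.le
    · rw [← mul_div_mul_right _ _ hk]; exact div_nonneg h2 hpos.le
    · rw [← add_div, hsum, div_self hk]
    · have e1 : orient v k y * u.1 + orient k u y * v.1 + orient u v y * k.1 =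
        orient u v k * y.1 := by simp [orient]; ring
      have e2 : orient v k y * u.2 + orient k u y * v.2 + orient u v y * k.2 =
        orient u v k * y.2 := by simp [orient]; ring
      rw [h0, zero_mul, add_zero] at e1 e2
      ext
      · simp only [Prod.fst_add, Prod.smul_fst, smul_eq_mul]
        field_simp; linear_combination e1
      · simp only [Prod.snd_add, Prod.smul_snd, smul_eq_mul]
        field_simp; linear_combination e2

/-- The affine functions `orient (P i) (P j)`, for all pairs of points of a configuration. -/
def lineFamily {W : Type*} (P : W → ℝ × ℝ) : AffineFamily (W × W) where
  A t := (P t.1).2 - (P t.2).2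
  B t := (P t.2).1 - (P t.1).1
  C t := (P t.1).1 * (P t.2).2 - (P t.2).1 * (P t.1).2

theorem lineFamily_val {W : Type*} (P : W → ℝ × ℝ) (t : W × W) (y : ℝ × ℝ) :
    (lineFamily P).val t y = orient (P t.1) (P t.2) y := by
  simp [lineFamily, AffineFamily.val, orient]; ring

abbrev TypeIndex (W : Type*) :=
  ((W × W) × (W × W)) ⊕ ((W × W) × (W × W) × (W × W)) ⊕ (W × W × W) ⊕ (W × W)

/-- The combinatorial type of a configuration of points. -/
def configType {W : Type*} (P : W → ℝ × ℝ) : TypeIndex W → SignType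
  | .inl t => SignType.sign ((lineFamily P).cross t.1 t.2)
  | .inr (.inl t) => SignType.sign ((lineFamily P).det t.1 t.2.1 t.2.2)
  | .inr (.inr (.inl t)) => SignType.sign (orient (P t.1) (P t.2.1) (P t.2.2))
  | .inr (.inr (.inr t)) => SignType.sign ((P t.1).1 - (P t.2).1)

section Count

open MvPolynomial

variable {W : Type*}

def coordX (i : W) : MvPolynomial (W × Bool) ℝ := X (i, false)
def coordY (i : W) : MvPolynomial (W × Bool) ℝ := X (i, true)
def coeffA (t : W × W) : MvPolynomial (W × Bool) ℝ := coordY t.1 - coordY t.2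
def coeffB (t : W × W) : MvPolynomial (W × Bool) ℝ := coordX t.2 - coordX t.1
def coeffC (t : W × W) : MvPolynomial (W × Bool) ℝ :=
  coordX t.1 * coordY t.2 - coordX t.2 * coordY t.1

def typePolynomial : TypeIndex W → MvPolynomial (W × Bool) ℝ
  | .inl t => coeffA t.1 * coeffB t.2 - coeffA t.2 * coeffB t.1
  | .inr (.inl t) =>
    coeffA t.1 * (coeffB t.2.1 * coeffC t.2.2 - coeffB t.2.2 * coeffC t.2.1) -
      coeffB t.1 * (coeffA t.2.1 * coeffC t.2.2 - coeffA t.2.2 * coeffC t.2.1) +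
    coeffC t.1 * (coeffA t.2.1 * coeffB t.2.2 - coeffA t.2.2 * coeffB t.2.1)
  | .inr (.inr (.inl t)) => coeffA (t.1, t.2.1) * coordX t.2.2 +
      coeffB (t.1, t.2.1) * coordY t.2.2 + coeffC (t.1, t.2.1)
  | .inr (.inr (.inr t)) => coordX t.1 - coordX t.2

theorem totalDegree_mul_le_add {σ : Type*} {p q : MvPolynomial σ ℝ} {a b c : ℕ}
    (hp : p.totalDegree ≤ a) (hq : q.totalDegree ≤ b) (h : a + b ≤ c) :
    (p * q).totalDegree ≤ c :=
  (totalDegree_mul _ _).trans (by omega)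

theorem totalDegree_sub_le_of_le {σ : Type*} {p q : MvPolynomial σ ℝ} {a : ℕ}
    (hp : p.totalDegree ≤ a) (hq : q.totalDegree ≤ a) : (p - q).totalDegree ≤ a :=
  (totalDegree_sub _ _).trans (max_le hp hq)

theorem totalDegree_add_le_of_le {σ : Type*} {p q : MvPolynomial σ ℝ} {a : ℕ}
    (hp : p.totalDegree ≤ a) (hq : q.totalDegree ≤ a) : (p + q).totalDegree ≤ a :=
  (totalDegree_add _ _).trans (max_le hp hq)

theorem totalDegree_typePolynomial_le (t : TypeIndex W) : (typePolynomial t).totalDegree ≤ 4 := by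
  have hx : ∀ i : W, (coordX i).totalDegree ≤ 1 := fun i => (totalDegree_X _).le
  have hy : ∀ i : W, (coordY i).totalDegree ≤ 1 := fun i => (totalDegree_X _).le
  have hA : ∀ t : W × W, (coeffA t).totalDegree ≤ 1 := fun t =>
    totalDegree_sub_le_of_le (hy _) (hy _)
  have hB : ∀ t : W × W, (coeffB t).totalDegree ≤ 1 := fun t =>
    totalDegree_sub_le_of_le (hx _) (hx _)
  have hC : ∀ t : W × W, (coeffC t).totalDegree ≤ 2 := fun t =>
    totalDegree_sub_le_of_le (totalDegree_mul_le_add (hx _) (hy _) (by norm_num))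
      (totalDegree_mul_le_add (hx _) (hy _) (by norm_num))
  have hAB : ∀ s t : W × W, (coeffA s * coeffB t - coeffA t * coeffB s).totalDegree ≤ 2 :=
    fun s t => totalDegree_sub_le_of_le (totalDegree_mul_le_add (hA _) (hB _) (by norm_num))
      (totalDegree_mul_le_add (hA _) (hB _) (by norm_num))
  rcases t with t | t | t | t
  · exact (hAB _ _).trans (by norm_num)
  · refine totalDegree_add_le_of_le (totalDegree_sub_le_of_le ?_ ?_) ?_
    · exact totalDegree_mul_le_add (hA _) (totalDegree_sub_le_of_le
        (totalDegree_mul_le_add (hB _) (hC _) le_rfl)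
        (totalDegree_mul_le_add (hB _) (hC _) le_rfl)) (by norm_num)
    · exact totalDegree_mul_le_add (hB _) (totalDegree_sub_le_of_le
        (totalDegree_mul_le_add (hA _) (hC _) le_rfl)
        (totalDegree_mul_le_add (hA _) (hC _) le_rfl)) (by norm_num)
    · exact totalDegree_mul_le_add (hC _) (hAB _ _) (by norm_num)
  · refine totalDegree_add_le_of_le (totalDegree_add_le_of_le ?_ ?_) ((hC _).trans (by norm_num))
    · exact totalDegree_mul_le_add (hA _) (hx _) (by norm_num)
    · exact totalDegree_mul_le_add (hB _) (hy _) (by norm_num)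
  · exact totalDegree_sub_le_of_le ((hx _).trans (by norm_num)) ((hx _).trans (by norm_num))

theorem sign_eval_typePolynomial (P : W → ℝ × ℝ) (t : TypeIndex W) :
    SignType.sign (eval (fun i : W × Bool => if i.2 then (P i.1).2 else (P i.1).1)
      (typePolynomial t)) = configType P t := by
  rcases t with t | t | t | t
  · simp [typePolynomial, configType, coeffA, coeffB, coordX, coordY, lineFamily,
      AffineFamily.cross]
  · simp [typePolynomial, configType, coeffA, coeffB, coeffC, coordX, coordY, lineFamily,
      AffineFamily.det]
  · simp only [typePolynomial, configType, coeffA, coeffB, coeffC, coordX, coordY, map_add,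
      map_sub, map_mul, eval_X]
    congr 1
    simp [orient]; ring
  · simp [typePolynomial, configType, coordX]

theorem ncard_configType_le [Fintype W] :
    (Set.range (configType : (W → ℝ × ℝ) → TypeIndex W → SignType)).ncard ≤
      (Fintype.card (W × Bool) * (2 + Fintype.card (TypeIndex W) * (2 * 4)) + 1) ^
        Fintype.card (W × Bool) := by
  refine le_trans (Set.ncard_le_ncard ?_ (Set.toFinite _))
    (ncard_signVectors_le (typePolynomial (W := W)) 4 totalDegree_typePolynomial_le)
  rintro _ ⟨P, rfl⟩
  exact ⟨fun i : W × Bool => if i.2 then (P i.1).2 else (P i.1).1,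
    funext fun t => sign_eval_typePolynomial P t⟩

end Count

section Decode

variable {W : Type*}

/-- The union of the segments spanned by a set of pairs. -/
def segmentUnion (P : W → ℝ × ℝ) (E : Set (W × W)) : Set (ℝ × ℝ) :=
  ⋃ e ∈ E, segment ℝ (P e.1) (P e.2)

/-- The outer component of the complement of a set of segments. -/
def outerFace (P : W → ℝ × ℝ) (o : W) (E : Set (W × W)) : Set (ℝ × ℝ) :=
  connectedComponentIn (segmentUnion P E)ᶜ (P o)

/-- `y` lies in the interior of the positively oriented triangle `o 0, o 1, o 2`. -/
def InsideFrame (P : W → ℝ × ℝ) (o : Fin 3 → W) (y : ℝ × ℝ) : Prop :=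
  0 < orient (P (o 0)) (P (o 1)) y ∧ 0 < orient (P (o 1)) (P (o 2)) y ∧
    0 < orient (P (o 2)) (P (o 0)) y

theorem sign_ne_neg_one {a : ℝ} : SignType.sign a ≠ -1 ↔ 0 ≤ a := by
  rw [Ne, sign_eq_neg_one_iff, not_lt]

/-- Sign vectors of the points covered by a set of segments. -/
def segmentSigns (P : W → ℝ × ℝ) (E : Set (W × W)) : Set (W × W → SignType) :=
  {s | ∃ e ∈ E, s e = 0 ∧ ∀ k, s (e.2, k) * SignType.sign (orient (P e.1) (P e.2) (P k)) ≠ -1 ∧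
    s (k, e.1) * SignType.sign (orient (P e.1) (P e.2) (P k)) ≠ -1}

theorem exists_orient_ne_zero {P : W → ℝ × ℝ} {o : Fin 3 → W}
    (ho : 0 < orient (P (o 0)) (P (o 1)) (P (o 2))) {u v : ℝ × ℝ} (huv : u.1 < v.1) :
    ∃ k, orient u v (P k) ≠ 0 := by
  by_contra! h
  have h0 := h (o 0)
  have h1 := h (o 1)
  have h2 := h (o 2)
  simp only [orient] at h0 h1 h2 ho
  have : (v.1 - u.1) * orient (P (o 0)) (P (o 1)) (P (o 2)) = 0 := by
    simp only [orient]
    linear_combination ((P (o 1)).1 - (P (o 0)).1) * (h2 - h0) -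
      ((P (o 2)).1 - (P (o 0)).1) * (h1 - h0)
  rcases mul_eq_zero.1 this with h | h
  · linarith
  · simp only [orient] at h; linarith

theorem mem_segment_iff_signs {P : W → ℝ × ℝ} {o : Fin 3 → W}
    (ho : 0 < orient (P (o 0)) (P (o 1)) (P (o 2))) {e : W × W}
    (he : (P e.1).1 < (P e.2).1) (y : ℝ × ℝ) :
    y ∈ segment ℝ (P e.1) (P e.2) ↔ (lineFamily P).signs y ∈ segmentSigns P {e} := by
  obtain ⟨k, hk⟩ := exists_orient_ne_zero ho he
  rw [mem_segment_iff_orient (K := Set.range P) ⟨P k, ⟨k, rfl⟩, hk⟩]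
  simp only [segmentSigns, Set.mem_singleton_iff, exists_eq_left, Set.mem_ofPred_eq,
    AffineFamily.signs, lineFamily_val, sign_eq_zero_iff, ← sign_mul, sign_ne_neg_one,
    Set.forall_mem_range]

theorem segmentSigns_eq_biUnion (P : W → ℝ × ℝ) (E : Set (W × W)) :
    segmentSigns P E = ⋃ e ∈ E, segmentSigns P {e} := by
  ext s; simp only [segmentSigns, Set.mem_ofPred_eq, Set.mem_iUnion, Set.mem_singleton_iff, exists_eq_left, exists_prop]

theorem compl_segmentUnion_eq {P : W → ℝ × ℝ} {o : Fin 3 → W}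
    (ho : 0 < orient (P (o 0)) (P (o 1)) (P (o 2))) {E : Set (W × W)}
    (hE : ∀ e ∈ E, (P e.1).1 < (P e.2).1) :
    (segmentUnion P E)ᶜ = {y | (lineFamily P).signs y ∉ segmentSigns P E} := by
  ext y
  rw [segmentSigns_eq_biUnion]
  simp only [segmentUnion, Set.mem_compl_iff, Set.mem_iUnion, Set.mem_ofPred_eq, not_exists]
  exact forall₂_congr fun e he => not_congr (mem_segment_iff_signs ho (hE e he) y)

theorem InsideFrame.segment {P : W → ℝ × ℝ} {o : Fin 3 → W} {u v y : ℝ × ℝ}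
    (hu : InsideFrame P o u) (hv : InsideFrame P o v) (hy : y ∈ segment ℝ u v) :
    InsideFrame P o y := by
  have aux : ∀ p q : ℝ × ℝ, 0 < orient p q u → 0 < orient p q v → 0 < orient p q y := by
    intro p q hu hv
    obtain ⟨a, b, ha, hb, hab, rfl⟩ := hy
    have : orient p q (a • u + b • v) = a * orient p q u + b * orient p q v := by
      obtain rfl : a = 1 - b := by linarith
      simp [orient]; ring
    rw [this]
    rcases ha.lt_or_eq with h | h
    · nlinarith [mul_pos h hu, mul_nonneg hb hv.le]
    · obtain rfl : b = 1 := by linarith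
      rw [← h]; linarith
  exact ⟨aux _ _ hu.1 hv.1, aux _ _ hu.2.1 hv.2.1, aux _ _ hu.2.2 hv.2.2⟩

theorem sign_eq_pos {a b : ℝ} (h : SignType.sign a = SignType.sign b) : 0 < a ↔ 0 < b := by
  rw [← sign_eq_one_iff, h, sign_eq_one_iff]

theorem insideFrame_iff_of_configType_eq {P P' : W → ℝ × ℝ} (h : configType P' = configType P)
    (o : Fin 3 → W) (w : W) : InsideFrame P' o (P' w) ↔ InsideFrame P o (P w) := by
  have h3 : ∀ i j k, SignType.sign (orient (P' i) (P' j) (P' k)) =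
      SignType.sign (orient (P i) (P j) (P k)) :=
    fun i j k => congrFun h (.inr (.inr (.inl (i, j, k))))
  simp only [InsideFrame, sign_eq_pos (h3 _ _ _)]

theorem fst_lt_iff_of_configType_eq {P P' : W → ℝ × ℝ} (h : configType P' = configType P)
    (u v : W) : (P' u).1 < (P' v).1 ↔ (P u).1 < (P v).1 := by
  have := sign_eq_pos (congrFun h (.inr (.inr (.inr (v, u)))))
  simpa [sub_pos] using this

/-- Whether a segment meets the outer face depends only on the type of the configuration. -/
theorem segment_inter_outerFace_nonempty_of_configType_eq [Finite W] {P P' : W → ℝ × ℝ}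
    (h : configType P' = configType P) {o : Fin 3 → W}
    (ho : 0 < orient (P (o 0)) (P (o 1)) (P (o 2))) {E : Set (W × W)}
    (hE : ∀ e ∈ E, (P e.1).1 < (P e.2).1)
    (hin : ∀ e ∈ E, InsideFrame P o (P e.1) ∧ InsideFrame P o (P e.2)) {u v : W}
    (huv : (P u).1 < (P v).1) (hu : InsideFrame P o (P u)) (hv : InsideFrame P o (P v))
    (hne : (segment ℝ (P u) (P v) ∩ outerFace P (o 0) E).Nonempty) :
    (segment ℝ (P' u) (P' v) ∩ outerFace P' (o 0) E).Nonempty := by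
  have hc : ∀ s t, SignType.sign ((lineFamily P').cross s t) =
      SignType.sign ((lineFamily P).cross s t) := fun s t => congrFun h (.inl (s, t))
  have hd : ∀ r s t, SignType.sign ((lineFamily P').det r s t) =
      SignType.sign ((lineFamily P).det r s t) :=
    fun r s t => congrFun h (.inr (.inl (r, s, t)))
  have h3 : ∀ i j k, SignType.sign (orient (P' i) (P' j) (P' k)) =
      SignType.sign (orient (P i) (P j) (P k)) :=
    fun i j k => congrFun h (.inr (.inr (.inl (i, j, k))))
  have hX := fst_lt_iff_of_configType_eq h
  have ho' : 0 < orient (P' (o 0)) (P' (o 1)) (P' (o 2)) := (sign_eq_pos (h3 _ _ _)).2 ho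
  have hE' : ∀ e ∈ E, (P' e.1).1 < (P' e.2).1 := fun e he => (hX _ _).2 (hE e he)
  have hin' : ∀ e ∈ E, InsideFrame P' o (P' e.1) ∧ InsideFrame P' o (P' e.2) := fun e he =>
    ⟨(insideFrame_iff_of_configType_eq h o _).2 (hin e he).1,
      (insideFrame_iff_of_configType_eq h o _).2 (hin e he).2⟩
  have hD : ∀ E : Set (W × W), segmentSigns P' E = segmentSigns P E := by
    intro E; ext s; simp only [segmentSigns, h3]
  have hT : (lineFamily P).IsTriangle (o 0, o 1) (o 1, o 2) (o 2, o 0) := by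
    refine ⟨by simp [lineFamily], by simp [lineFamily], ?_⟩
    have : (lineFamily P).cross (o 0, o 1) (o 1, o 2) =
        orient (P (o 0)) (P (o 1)) (P (o 2)) := by
      simp [AffineFamily.cross, lineFamily, orient]; ring
    rw [this]; exact ho.ne'
  obtain ⟨y, hys, hyo⟩ := hne
  have hyin := hu.segment hv hys
  have hyT : y ∈ (lineFamily P).triangle (o 0, o 1) (o 1, o 2) (o 2, o 0) := by
    simp only [AffineFamily.triangle, Set.mem_ofPred_eq, lineFamily_val]
    exact ⟨hyin.1.le, hyin.2.1.le, hyin.2.2.le⟩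
  obtain ⟨y', hy'⟩ := AffineFamily.transfers_of_mem_triangle hT hc hd hyT
  have hyy : (lineFamily P').signs y' = (lineFamily P).signs y := funext hy'
  refine ⟨y', ?_, ?_⟩
  · have := (mem_segment_iff_signs ho (e := (u, v)) huv y).1 hys
    rw [← hD, ← hyy] at this
    exact (mem_segment_iff_signs ho' (e := (u, v)) ((hX _ _).2 huv) y').2 this
  · rw [outerFace, compl_segmentUnion_eq ho hE] at hyo
    rw [outerFace, compl_segmentUnion_eq ho' hE', hD]
    refine AffineFamily.mem_component_of_signs_eq hT hc hd (segmentSigns P E)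
      ?_ ⟨P' (o 1), ?_⟩ ⟨P' (o 2), ?_⟩ ?_ ?_ hyo hyT hyy
    · intro z hz hzD
      rw [← hD, segmentSigns_eq_biUnion] at hzD
      simp only [Set.mem_iUnion] at hzD
      obtain ⟨e, he, hze⟩ := hzD
      have hz' := (hin' e he).1.segment (hin' e he).2
        ((mem_segment_iff_signs ho' (hE' e he) z).2 hze)
      simp only [lineFamily_val] at hz
      rcases hz with hz | hz | hz
      · exact hz.not_gt hz'.1
      · exact hz.not_gt hz'.2.1
      · exact hz.not_gt hz'.2.2
    all_goals simp only [lineFamily_val, orient]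
    · constructor <;> apply le_of_eq <;> ring
    · constructor <;> apply le_of_eq <;> ring
    · apply le_of_eq; ring
    · apply le_of_eq; ring

/-- The pairs whose segments avoid the outer face. -/
def decodedPairs (P : W → ℝ × ℝ) (o : Fin 3 → W) (E : Set (W × W)) : Set (W × W) :=
  {e | (P e.1).1 < (P e.2).1 ∧ InsideFrame P o (P e.1) ∧ InsideFrame P o (P e.2) ∧
    Disjoint (segment ℝ (P e.1) (P e.2)) (outerFace P (o 0) E)}

theorem decodedPairs_eq_of_configType_eq [Finite W] {P P' : W → ℝ × ℝ}
    (h : configType P' = configType P) {o : Fin 3 → W}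
    (ho : 0 < orient (P (o 0)) (P (o 1)) (P (o 2))) {E : Set (W × W)}
    (hE : ∀ e ∈ E, (P e.1).1 < (P e.2).1)
    (hin : ∀ e ∈ E, InsideFrame P o (P e.1) ∧ InsideFrame P o (P e.2)) :
    decodedPairs P' o E = decodedPairs P o E := by
  have h3 : SignType.sign (orient (P' (o 0)) (P' (o 1)) (P' (o 2))) =
      SignType.sign (orient (P (o 0)) (P (o 1)) (P (o 2))) :=
    congrFun h (.inr (.inr (.inl (o 0, o 1, o 2))))
  have hX := fst_lt_iff_of_configType_eq h
  have hI := insideFrame_iff_of_configType_eq h o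
  ext e
  simp only [decodedPairs, Set.mem_ofPred_eq, hX, hI, Set.disjoint_iff_inter_eq_empty,
    ← Set.not_nonempty_iff_eq_empty]
  refine and_congr_right fun h0 => and_congr_right fun h1 => and_congr_right fun h2 =>
    not_congr ⟨fun hh => ?_, fun hh => ?_⟩
  · exact segment_inter_outerFace_nonempty_of_configType_eq h.symm ((sign_eq_pos h3).2 ho)
      (fun e he => (hX _ _).2 (hE e he))
      (fun e he => ⟨(hI _).2 (hin e he).1, (hI _).2 (hin e he).2⟩) ((hX _ _).2 h0)
      ((hI _).2 h1) ((hI _).2 h2) hh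
  · exact segment_inter_outerFace_nonempty_of_configType_eq h ho hE hin h0 h1 h2 hh

end Decode

section Crossing

variable {V : Type*}

/-- Two pairs spanning properly crossing segments, each pair being ordered from left to right. -/
def ProperlyCross (P : V → ℝ × ℝ) (e f : V × V) : Prop :=
  (P e.1).1 < (P e.2).1 ∧ (P f.1).1 < (P f.2).1 ∧
  ((0 < orient (P e.1) (P e.2) (P f.1) ∧ orient (P e.1) (P e.2) (P f.2) < 0 ∧
      orient (P f.1) (P f.2) (P e.1) < 0 ∧ 0 < orient (P f.1) (P f.2) (P e.2)) ∨
    (0 < orient (P f.1) (P f.2) (P e.1) ∧ orient (P f.1) (P f.2) (P e.2) < 0 ∧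
      orient (P e.1) (P e.2) (P f.1) < 0 ∧ 0 < orient (P e.1) (P e.2) (P f.2)))

theorem orient_left (p q : ℝ × ℝ) : orient p q p = 0 := by simp [orient]

theorem orient_right (p q : ℝ × ℝ) : orient p q q = 0 := by simp [orient]; ring

theorem ProperlyCross.ne {P : V → ℝ × ℝ} {e f : V × V} (h : ProperlyCross P e f) :
    e.1 ≠ f.1 ∧ e.2 ≠ f.2 ∧ e.1 ≠ f.2 ∧ e.2 ≠ f.1 := by
  obtain ⟨-, -, h⟩ := h
  refine ⟨fun h' => ?_, fun h' => ?_, fun h' => ?_, fun h' => ?_⟩ <;>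
  · rcases h with h | h
    · obtain ⟨h1, h2, h3, h4⟩ := h
      simp_all [orient_left, orient_right]
    · obtain ⟨h1, h2, h3, h4⟩ := h
      simp_all [orient_left, orient_right]

theorem ProperlyCross.of_configType_eq {W : Type*} {P P' : W → ℝ × ℝ}
    (h : configType P' = configType P) {e f : W × W} (hc : ProperlyCross P e f) :
    ProperlyCross P' e f := by
  have h3 : ∀ i j k, SignType.sign (orient (P' i) (P' j) (P' k)) =
      SignType.sign (orient (P i) (P j) (P k)) :=
    fun i j k => congrFun h (.inr (.inr (.inl (i, j, k))))
  have hneg : ∀ i j k, orient (P' i) (P' j) (P' k) < 0 ↔ orient (P i) (P j) (P k) < 0 :=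
    fun i j k => by rw [← sign_eq_neg_one_iff, h3, sign_eq_neg_one_iff]
  have hpos : ∀ i j k, 0 < orient (P' i) (P' j) (P' k) ↔ 0 < orient (P i) (P j) (P k) :=
    fun i j k => sign_eq_pos (h3 i j k)
  simpa only [ProperlyCross, hneg, hpos, fst_lt_iff_of_configType_eq h] using hc

theorem card_filter_orient_pos {P : V → ℝ × ℝ} {M : Finset (V × V)}
    (hM : (M : Set (V × V)).Pairwise (ProperlyCross P)) {e₀ : V × V} (he₀ : e₀ ∈ M)
    (hlt : ∀ e ∈ M, e.1 ≠ e.2) :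
    ((M.image Prod.fst ∪ M.image Prod.snd).filter
      fun w => 0 < orient (P e₀.1) (P e₀.2) (P w)).card + 1 = M.card := by
  have hi1 : Set.InjOn Prod.fst (M : Set (V × V)) := fun e he f hf h => by
    by_contra hef; exact (hM he hf hef).ne.1 h
  have hi2 : Set.InjOn Prod.snd (M : Set (V × V)) := fun e he f hf h => by
    by_contra hef; exact (hM he hf hef).ne.2.1 h
  have hdis : Disjoint (M.image Prod.fst) (M.image Prod.snd) := by
    rw [Finset.disjoint_left]
    intro w h1 h2
    obtain ⟨e, he, rfl⟩ := Finset.mem_image.1 h1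
    obtain ⟨f, hf, h⟩ := Finset.mem_image.1 h2
    by_cases hef : e = f
    · subst hef; exact hlt e he h.symm
    · exact (hM he hf hef).ne.2.2.1 h.symm
  rw [Finset.card_filter, Finset.sum_union hdis, Finset.sum_image hi1, Finset.sum_image hi2,
    ← Finset.sum_add_distrib, ← Finset.add_sum_erase M _ he₀, ← Finset.card_erase_add_one he₀]
  congr 1
  rw [orient_left, orient_right, Finset.card_eq_sum_ones]
  simp only [lt_irrefl, if_false, zero_add, add_zero]
  refine Finset.sum_congr rfl fun e he => ?_
  obtain ⟨hee, heM⟩ := Finset.mem_erase.1 he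
  obtain ⟨-, -, h⟩ := hM he₀ heM (Ne.symm hee)
  rcases h with h | h
  · rw [if_pos h.1, if_neg h.2.1.not_gt]
  · rw [if_neg h.2.2.1.not_gt, if_pos h.2.2.2]

theorem orient_pos_trans {z a b c : ℝ × ℝ} (ha : z.1 < a.1) (hb : z.1 < b.1) (hc : z.1 ≤ c.1)
    (hab : 0 < orient z a b) (hbc : 0 < orient z b c) : 0 < orient z a c := by
  have : (b.1 - z.1) * orient z a c =
      (a.1 - z.1) * orient z b c + (c.1 - z.1) * orient z a b := by
    simp only [orient]; ring
  have h2 : 0 < (b.1 - z.1) * orient z a c := by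
    rw [this]
    have := mul_pos (sub_pos.2 ha) hbc
    have := mul_nonneg (sub_nonneg.2 hc) hab.le
    linarith
  exact (pos_iff_pos_of_mul_pos h2).1 (sub_pos.2 hb)

/-- A family of pairwise crossing segments is determined by its left and right endpoints. -/
theorem eq_of_pairwise_properlyCross {P : V → ℝ × ℝ}
    (hP : ∀ u v w : V, u ≠ v → u ≠ w → v ≠ w → orient (P u) (P v) (P w) ≠ 0)
    (M N : Finset (V × V)) (hM : (M : Set (V × V)).Pairwise (ProperlyCross P))
    (hN : (N : Set (V × V)).Pairwise (ProperlyCross P))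
    (h1 : M.image Prod.fst = N.image Prod.fst) (h2 : M.image Prod.snd = N.image Prod.snd) :
    M = N := by
  induction hn : M.card generalizing M N with
  | zero =>
    rw [Finset.card_eq_zero] at hn
    subst hn
    rw [Finset.image_empty, eq_comm, Finset.image_eq_empty] at h1
    exact h1.symm
  | succ n ih =>
    have hinj : ∀ M : Finset (V × V), (M : Set (V × V)).Pairwise (ProperlyCross P) →
        Set.InjOn Prod.fst (M : Set (V × V)) ∧ Set.InjOn Prod.snd (M : Set (V × V)) :=
      fun M hM => ⟨fun e he f hf h => by by_contra hef; exact (hM he hf hef).ne.1 h,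
        fun e he f hf h => by by_contra hef; exact (hM he hf hef).ne.2.1 h⟩
    have hcard : M.card = N.card := by
      rw [← Finset.card_image_of_injOn (hinj M hM).1, h1, Finset.card_image_of_injOn (hinj N hN).1]
    rcases Nat.eq_zero_or_pos n with rfl | hn0
    · obtain ⟨e, rfl⟩ := Finset.card_eq_one.1 hn
      obtain ⟨f, rfl⟩ := Finset.card_eq_one.1 (hcard ▸ hn)
      simp only [Finset.image_singleton, Finset.singleton_inj] at h1 h2
      rw [Prod.ext h1 h2]
    have hord : ∀ M : Finset (V × V), M.card = n + 1 →
        (M : Set (V × V)).Pairwise (ProperlyCross P) → ∀ e ∈ M, (P e.1).1 < (P e.2).1 := by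
      intro M hc hM e he
      obtain ⟨f, hf, hfe⟩ := Finset.exists_mem_ne (s := M) (by omega) e
      exact (hM he hf hfe.symm).1
    have hoM := hord M hn hM
    have hoN := hord N (hcard ▸ hn) hN
    have hlt : ∀ e : V × V, (P e.1).1 < (P e.2).1 → e.1 ≠ e.2 := by
      intro e h h'; rw [h'] at h; exact lt_irrefl _ h
    obtain ⟨e₀, he₀, hmin⟩ := Finset.exists_min_image M (fun e => (P e.1).1)
      (Finset.card_pos.1 (by omega))
    obtain ⟨e₁, he₁, h01⟩ := Finset.mem_image.1 (h1 ▸ Finset.mem_image_of_mem Prod.fst he₀)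
    have hleft : ∀ w ∈ M.image Prod.fst ∪ M.image Prod.snd, (P e₀.1).1 ≤ (P w).1 := by
      intro w hw
      rcases Finset.mem_union.1 hw with hw | hw
      · obtain ⟨e, he, rfl⟩ := Finset.mem_image.1 hw
        exact hmin e he
      · obtain ⟨e, he, rfl⟩ := Finset.mem_image.1 hw
        exact (hmin e he).trans (hoM e he).le
    have cM := card_filter_orient_pos hM he₀ fun e he => hlt e (hoM e he)
    have cN := card_filter_orient_pos hN he₁ fun e he => hlt e (hoN e he)
    rw [← h1, ← h2, ← hcard, ← cM, h01] at cN
    have hX0 := hoM _ he₀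
    have hX1 := hoN _ he₁
    rw [h01] at hX1
    have hstrict : ∀ a b : V, a ∈ M.image Prod.fst ∪ M.image Prod.snd →
        b ∈ M.image Prod.fst ∪ M.image Prod.snd → (P e₀.1).1 < (P a).1 →
        (P e₀.1).1 < (P b).1 → 0 < orient (P e₀.1) (P a) (P b) →
        ((M.image Prod.fst ∪ M.image Prod.snd).filter
          fun w => 0 < orient (P e₀.1) (P b) (P w)).card <
        ((M.image Prod.fst ∪ M.image Prod.snd).filter
          fun w => 0 < orient (P e₀.1) (P a) (P w)).card := by
      intro a b ha hb hXa hXb hab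
      refine Finset.card_lt_card ⟨fun w hw => ?_, fun h => ?_⟩
      · rw [Finset.mem_filter] at hw ⊢
        exact ⟨hw.1, orient_pos_trans hXa hXb (hleft _ hw.1) hab hw.2⟩
      · have := h (Finset.mem_filter.2 ⟨hb, hab⟩)
        rw [Finset.mem_filter, orient_right] at this
        exact lt_irrefl _ this.2
    have hm0 : e₀.2 ∈ M.image Prod.fst ∪ M.image Prod.snd :=
      Finset.mem_union_right _ (Finset.mem_image_of_mem _ he₀)
    have hm1 : e₁.2 ∈ M.image Prod.fst ∪ M.image Prod.snd :=
      Finset.mem_union_right _ (h2 ▸ Finset.mem_image_of_mem _ he₁)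
    have hq : e₀.2 = e₁.2 := by
      by_contra hq
      rcases lt_or_gt_of_ne (hP e₀.1 e₀.2 e₁.2 (hlt _ hX0) (fun h => by
        rw [h] at hX1; exact lt_irrefl _ hX1) hq) with h | h
      · have h' : 0 < orient (P e₀.1) (P e₁.2) (P e₀.2) := by
          have : orient (P e₀.1) (P e₁.2) (P e₀.2) = -orient (P e₀.1) (P e₀.2) (P e₁.2) := by
            simp only [orient]; ring
          linarith
        have := hstrict _ _ hm1 hm0 hX1 hX0 h'
        omega
      · have := hstrict _ _ hm0 hm1 hX0 hX1 h
        omega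
    have hee : e₁ = e₀ := Prod.ext h01 hq.symm
    subst hee
    have heq : M.erase e₁ = N.erase e₁ := by
      refine ih _ _ (hM.mono (Finset.erase_subset _ _)) (hN.mono (Finset.erase_subset _ _))
        ?_ ?_ ?_
      · have aux : ∀ M : Finset (V × V), e₁ ∈ M → Set.InjOn Prod.fst (M : Set (V × V)) →
            (M.erase e₁).image Prod.fst = (M.image Prod.fst).erase e₁.1 := by
          intro M he hi
          ext w
          simp only [Finset.mem_image, Finset.mem_erase]
          constructor
          · rintro ⟨e, ⟨hee, heM⟩, rfl⟩
            exact ⟨fun h => hee (hi heM he h), e, heM, rfl⟩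
          · rintro ⟨hw, e, heM, rfl⟩
            exact ⟨e, ⟨fun h => hw (h ▸ rfl), heM⟩, rfl⟩
        rw [aux M he₀ (hinj M hM).1, aux N he₁ (hinj N hN).1, h1]
      · have aux : ∀ M : Finset (V × V), e₁ ∈ M → Set.InjOn Prod.snd (M : Set (V × V)) →
            (M.erase e₁).image Prod.snd = (M.image Prod.snd).erase e₁.2 := by
          intro M he hi
          ext w
          simp only [Finset.mem_image, Finset.mem_erase]
          constructor
          · rintro ⟨e, ⟨hee, heM⟩, rfl⟩
            exact ⟨fun h => hee (hi heM he h), e, heM, rfl⟩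
          · rintro ⟨hw, e, heM, rfl⟩
            exact ⟨e, ⟨fun h => hw (h ▸ rfl), heM⟩, rfl⟩
        rw [aux M he₀ (hinj M hM).2, aux N he₁ (hinj N hN).2, h2]
      · rw [Finset.card_erase_of_mem he₀, hn]; rfl
    rw [← Finset.insert_erase he₀, heq, Finset.insert_erase he₁]

end Crossing

/-- The least `i` such that `x` and `y` lie in a common dyadic block of length `2 ^ i`. -/
def dyadicLevel (x y : ℕ) : ℕ := sInf {i | x / 2 ^ i = y / 2 ^ i}

theorem dyadicLevel_le_iff (x y i : ℕ) : dyadicLevel x y ≤ i ↔ x / 2 ^ i = y / 2 ^ i := by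
  have hne : {i | x / 2 ^ i = y / 2 ^ i}.Nonempty := by
    refine ⟨x + y, ?_⟩
    have h1 : x < 2 ^ (x + y) := lt_of_le_of_lt (Nat.le_add_right _ _) Nat.lt_two_pow_self
    have h2 : y < 2 ^ (x + y) := lt_of_le_of_lt (Nat.le_add_left _ _) Nat.lt_two_pow_self
    change x / 2 ^ (x + y) = y / 2 ^ (x + y)
    rw [Nat.div_eq_of_lt h1, Nat.div_eq_of_lt h2]
  constructor
  · intro h
    have h1 : x / 2 ^ (dyadicLevel x y) = y / 2 ^ (dyadicLevel x y) := Nat.sInf_mem hne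
    obtain ⟨k, rfl⟩ := Nat.exists_eq_add_of_le h
    rw [pow_add, ← Nat.div_div_eq_div_mul, ← Nat.div_div_eq_div_mul, h1]
  · intro h
    exact Nat.sInf_le h

/-- A set of ordered pairs whose endpoints receive positions `a`, each pair `e` being assigned a
cut `c e` separating its endpoints, such that pairs separated by each other's cuts are related. -/
structure IsCutSystem {V : Type*} (L : ℕ) (R : V × V → V × V → Prop) (a : V → ℕ)
    (c : V × V → ℕ) (E : Finset (V × V)) : Prop where
  inj : Function.Injective a
  lt : ∀ v, a v < 2 ^ L
  fst_lt : ∀ e ∈ E, a e.1 < c e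
  lt_snd : ∀ e ∈ E, c e < a e.2
  rel : ∀ e ∈ E, ∀ f ∈ E, e ≠ f → a e.1 < c f → c f < a e.2 → a f.1 < c e → c e < a f.2 → R e f

theorem IsCutSystem.mono {V : Type*} {L : ℕ} {R : V × V → V × V → Prop} {a : V → ℕ}
    {c : V × V → ℕ} {E F : Finset (V × V)} (h : IsCutSystem L R a c E) (hF : F ⊆ E) :
    IsCutSystem L R a c F :=
  ⟨h.inj, h.lt, fun e he => h.fst_lt e (hF he), fun e he => h.lt_snd e (hF he),
    fun e he f hf => h.rel e (hF he) f (hF hf)⟩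

theorem Finset.card_filter_prod_ge_le {T : Type*} (S : Finset T) (w : T → ℝ)
    (hw : ∀ t, 0 ≤ w t) (δ : ℝ) (hδ : 0 < δ) :
    ((S.powerset.filter fun Z => δ ≤ ∏ t ∈ Z, w t).card : ℝ) ≤
      δ⁻¹ * Real.exp (∑ t ∈ S, w t) := by
  rw [inv_mul_eq_div, le_div_iff₀ hδ]
  calc ((S.powerset.filter fun Z => δ ≤ ∏ t ∈ Z, w t).card : ℝ) * δ
      = ∑ Z ∈ S.powerset.filter (fun Z => δ ≤ ∏ t ∈ Z, w t), δ := by simp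
    _ ≤ ∑ Z ∈ S.powerset.filter (fun Z => δ ≤ ∏ t ∈ Z, w t), ∏ t ∈ Z, w t :=
        Finset.sum_le_sum fun Z hZ => (Finset.mem_filter.1 hZ).2
    _ ≤ ∑ Z ∈ S.powerset, ∏ t ∈ Z, w t :=
        Finset.sum_le_sum_of_subset_of_nonneg (Finset.filter_subset _ _)
          fun Z _ _ => Finset.prod_nonneg fun t _ => hw t
    _ = ∏ t ∈ S, (1 + w t) := by rw [Finset.prod_one_add]
    _ ≤ ∏ t ∈ S, Real.exp (w t) := Finset.prod_le_prod
        (fun t _ => by have := hw t; positivity)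
        (fun t _ => by rw [add_comm]; exact Real.add_one_le_exp _)
    _ = _ := (Real.exp_sum _ _).symm

/-- The symbols used to encode cut systems. -/
def cutSymbols (L : ℕ) : Finset (ℕ × (Σ _ : ℕ, ℕ) × ℕ) :=
  Finset.range L ×ˢ ((Finset.Icc 1 L).sigma fun d => Finset.range (2 ^ d)) ×ˢ Finset.range (2 ^ L)

theorem sum_cutSymbols_le (L : ℕ) :
    ∑ t ∈ cutSymbols L, ((1 : ℝ) / 4) ^ t.2.1.1 ≤ L * 2 ^ L := by
  rw [cutSymbols, Finset.sum_product]
  have : ∀ x ∈ Finset.range L, ∑ y ∈ ((Finset.Icc 1 L).sigma fun d => Finset.range (2 ^ d)) ×ˢ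
      Finset.range (2 ^ L), ((1 : ℝ) / 4) ^ (y.1.1) ≤ 2 ^ L := by
    intro x _
    rw [Finset.sum_product, Finset.sum_sigma]
    simp only [Finset.sum_const, Finset.card_range, nsmul_eq_mul]
    have h1 : ∀ d ∈ Finset.Icc 1 L, ((2 ^ d : ℕ) : ℝ) * (((2 ^ L : ℕ) : ℝ) * (1 / 4) ^ d) =
        2 ^ L * (1 / 2) ^ d := by
      intro d _
      push_cast
      have : (1 / 4 : ℝ) ^ d = (1 / 2) ^ d * (1 / 2) ^ d := by rw [← mul_pow]; norm_num
      rw [this]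
      have h2 : (2 : ℝ) ^ d * (1 / 2) ^ d = 1 := by rw [← mul_pow]; norm_num
      linear_combination (2 ^ L * (1 / 2) ^ d) * h2
    rw [Finset.sum_congr rfl h1, ← Finset.mul_sum]
    have h2 : ∀ L : ℕ, ∑ d ∈ Finset.Icc 1 L, (1 / 2 : ℝ) ^ d = 1 - (1 / 2) ^ L := by
      intro L
      induction L with
      | zero => simp
      | succ L ih =>
        rw [Finset.sum_Icc_succ_top (by omega), ih, pow_succ]; ring
    rw [h2]
    have h3 : (0 : ℝ) < 2 ^ L := by positivity
    have h4 : (0 : ℝ) < (1 / 2) ^ L := by positivity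
    nlinarith
  refine (Finset.sum_le_sum this).trans ?_
  simp

/-- The code of a cut system. -/
def cutCode {V : Type*} (a : V → ℕ) (c : V × V → ℕ) (E : Finset (V × V)) :
    Finset (ℕ × (Σ _ : ℕ, ℕ) × ℕ) :=
  (E ×ˢ (Finset.univ : Finset Bool)).image fun eb =>
    let e := eb.1
    let i := dyadicLevel (a e.1) (c e)
    let d := dyadicLevel (a e.1) (a e.2) - i
    (i, ⟨d, a e.1 / 2 ^ i % 2 ^ d⟩, if eb.2 then a e.1 else a e.2)

theorem mem_cutCode {V : Type*} {a : V → ℕ} {c : V × V → ℕ} {E : Finset (V × V)} {i d ρ z : ℕ} :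
    (i, (⟨d, ρ⟩ : Σ _ : ℕ, ℕ), z) ∈ cutCode a c E ↔ ∃ e ∈ E, dyadicLevel (a e.1) (c e) = i ∧
      dyadicLevel (a e.1) (a e.2) - i = d ∧ a e.1 / 2 ^ i % 2 ^ d = ρ ∧
      (a e.1 = z ∨ a e.2 = z) := by
  simp only [cutCode, Finset.mem_image, Finset.mem_product, Finset.mem_univ, and_true, Prod.exists]
  constructor
  · rintro ⟨p, q, b, he, h⟩
    simp only [Prod.mk.injEq, Sigma.mk.injEq, heq_eq_eq] at h
    obtain ⟨rfl, ⟨rfl, rfl⟩, h⟩ := h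
    refine ⟨p, q, he, rfl, rfl, rfl, ?_⟩
    cases b <;> simp at h <;> simp [h]
  · rintro ⟨p, q, he, rfl, rfl, rfl, h⟩
    rcases h with h | h
    · exact ⟨p, q, true, he, by simp [h]⟩
    · exact ⟨p, q, false, he, by simp [h]⟩

section

variable {V : Type*} {L : ℕ} {R : V × V → V × V → Prop}

theorem IsCutSystem.rel_of_div_eq {a : V → ℕ} {c : V × V → ℕ} {E : Finset (V × V)}
    (h : IsCutSystem L R a c E) {e f : V × V} (he : e ∈ E) (hf : f ∈ E) (hef : e ≠ f) (l : ℕ)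
    (hef1 : a e.1 < c f) (hfe1 : a f.1 < c e)
    (hce : c e / 2 ^ l = c f / 2 ^ l)
    (hqe : a e.2 / 2 ^ l ≠ c e / 2 ^ l) (hqf : a f.2 / 2 ^ l ≠ c f / 2 ^ l) : R e f := by
  have h1 : c e / 2 ^ l ≤ a e.2 / 2 ^ l := Nat.div_le_div_right (h.lt_snd e he).le
  have h2 : c f / 2 ^ l ≤ a f.2 / 2 ^ l := Nat.div_le_div_right (h.lt_snd f hf).le
  refine h.rel e he f hf hef hef1 ?_ hfe1 ?_
  · by_contra! h3
    have := Nat.div_le_div_right (c := 2 ^ l) h3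
    omega
  · by_contra! h3
    have := Nat.div_le_div_right (c := 2 ^ l) h3
    omega

theorem IsCutSystem.cutCode_subset {a : V → ℕ} {c : V × V → ℕ} {E : Finset (V × V)}
    (h : IsCutSystem L R a c E)
    (hE : ∀ e ∈ E, dyadicLevel (a e.1) (c e) < dyadicLevel (a e.1) (a e.2)) :
    cutCode a c E ⊆ cutSymbols L := by
  rintro ⟨i, ⟨d, ρ⟩, z⟩ ht
  obtain ⟨e, he, rfl, rfl, rfl, hz⟩ := mem_cutCode.1 ht
  have h1 := hE e he
  have h2 : dyadicLevel (a e.1) (a e.2) ≤ L := by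
    rw [dyadicLevel_le_iff, Nat.div_eq_of_lt (h.lt _), Nat.div_eq_of_lt (h.lt _)]
  simp only [cutSymbols, Finset.mem_product, Finset.mem_range, Finset.mem_sigma, Finset.mem_Icc]
  refine ⟨by omega, ⟨by omega, Nat.mod_lt _ (by positivity)⟩, ?_⟩
  rcases hz with rfl | rfl <;> exact h.lt _

theorem IsCutSystem.subset_of_cutCode_eq {a : V → ℕ} {c c' : V × V → ℕ} {E E' : Finset (V × V)}
    (h : IsCutSystem L R a c E) (h' : IsCutSystem L R a c' E')
    (hE : ∀ e ∈ E, dyadicLevel (a e.1) (c e) < dyadicLevel (a e.1) (a e.2))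
    (hE' : ∀ e ∈ E', dyadicLevel (a e.1) (c' e) < dyadicLevel (a e.1) (a e.2))
    (hU : ∀ M N : Finset (V × V), (M : Set (V × V)).Pairwise R → (N : Set (V × V)).Pairwise R →
      M.image Prod.fst = N.image Prod.fst → M.image Prod.snd = N.image Prod.snd → M = N)
    (hcode : cutCode a c E = cutCode a c' E') : E ⊆ E' := by
  intro e he
  set i := dyadicLevel (a e.1) (c e) with hi
  set d := dyadicLevel (a e.1) (a e.2) - i with hd
  set β := a e.1 / 2 ^ i with hβ
  let M : (V × V → ℕ) → Finset (V × V) → Finset (V × V) := fun c E =>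
    E.filter fun f => dyadicLevel (a f.1) (c f) = i ∧ dyadicLevel (a f.1) (a f.2) - i = d ∧
      a f.1 / 2 ^ i = β
  have hpair : ∀ (c : V × V → ℕ) (E : Finset (V × V)), IsCutSystem L R a c E →
      (∀ e ∈ E, dyadicLevel (a e.1) (c e) < dyadicLevel (a e.1) (a e.2)) →
      (M c E : Set (V × V)).Pairwise R := by
    intro c E h hE f hf g hg hfg
    simp only [M, Finset.coe_filter, Set.mem_ofPred_eq] at hf hg
    obtain ⟨hfE, hfi, hfd, hfβ⟩ := hf
    obtain ⟨hgE, hgi, hgd, hgβ⟩ := hg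
    have key : ∀ f ∈ E, dyadicLevel (a f.1) (c f) = i → a f.1 / 2 ^ i = β →
        c f / 2 ^ i = β ∧ a f.2 / 2 ^ i ≠ β ∧ 0 < i ∧
          a f.1 / 2 ^ (i - 1) = 2 * β ∧ c f / 2 ^ (i - 1) = 2 * β + 1 := by
      intro f hfE hfi hfβ
      have h1 : a f.1 / 2 ^ i = c f / 2 ^ i := (dyadicLevel_le_iff _ _ _).1 hfi.le
      have h2 : a f.1 / 2 ^ i ≠ a f.2 / 2 ^ i := fun h3 => by
        have h4 := (dyadicLevel_le_iff _ _ _).2 h3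
        have h5 := hE f hfE
        omega
      have h3 : 0 < i := by
        by_contra h0
        have h0 : i = 0 := by omega
        rw [h0] at h1
        simp at h1
        have := h.fst_lt f hfE
        omega
      have h4 : a f.1 / 2 ^ (i - 1) ≠ c f / 2 ^ (i - 1) := fun h5 => by
        have := (dyadicLevel_le_iff _ _ _).2 h5
        omega
      have h5 : a f.1 / 2 ^ (i - 1) ≤ c f / 2 ^ (i - 1) :=
        Nat.div_le_div_right (h.fst_lt f hfE).le
      have h6 : (2 : ℕ) ^ i = 2 ^ (i - 1) * 2 := by rw [← pow_succ]; congr 1; omega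
      have h7 : a f.1 / 2 ^ (i - 1) / 2 = β := by rw [Nat.div_div_eq_div_mul, ← h6, hfβ]
      have h8 : c f / 2 ^ (i - 1) / 2 = β := by rw [Nat.div_div_eq_div_mul, ← h6, ← h1, hfβ]
      refine ⟨by rw [← h1, hfβ], fun h9 => h2 (by rw [hfβ, h9]), h3, by omega, by omega⟩
    have kf := key f hfE hfi hfβ
    have kg := key g hgE hgi hgβ
    refine h.rel_of_div_eq hfE hgE hfg i ?_ ?_ (by rw [kf.1, kg.1]) (by rw [kf.1]; exact kf.2.1)
      (by rw [kg.1]; exact kg.2.1)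
    · by_contra! h3
      have := Nat.div_le_div_right (c := 2 ^ (i - 1)) h3
      omega
    · by_contra! h3
      have := Nat.div_le_div_right (c := 2 ^ (i - 1)) h3
      omega
  have hmix : ∀ (c : V × V → ℕ) (E : Finset (V × V)), IsCutSystem L R a c E →
      (∀ e ∈ E, dyadicLevel (a e.1) (c e) < dyadicLevel (a e.1) (a e.2)) →
      ∀ f ∈ E, dyadicLevel (a f.1) (c f) = i → dyadicLevel (a f.1) (a f.2) - i = d →
        a f.2 / 2 ^ (i + d) = a f.1 / 2 ^ (i + d) ∧ a f.2 / 2 ^ i ≠ a f.1 / 2 ^ i := by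
    intro c E h hE f hf hfi hfd
    have h1 := hE f hf
    refine ⟨((dyadicLevel_le_iff _ _ _).1 (by omega)).symm, fun h3 => ?_⟩
    have := (dyadicLevel_le_iff _ _ _).2 h3.symm
    omega
  have hdivs : ∀ x y : ℕ, x / 2 ^ i % 2 ^ d = y / 2 ^ i % 2 ^ d →
      x / 2 ^ (i + d) = y / 2 ^ (i + d) → x / 2 ^ i = y / 2 ^ i := by
    intro x y h1 h2
    rw [pow_add, ← Nat.div_div_eq_div_mul, ← Nat.div_div_eq_div_mul] at h2
    rw [← Nat.div_add_mod (x / 2 ^ i) (2 ^ d), ← Nat.div_add_mod (y / 2 ^ i) (2 ^ d), h1, h2]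
  have hdivs' : ∀ x y : ℕ, x / 2 ^ i = y / 2 ^ i → x / 2 ^ (i + d) = y / 2 ^ (i + d) := by
    intro x y h1
    rw [pow_add, ← Nat.div_div_eq_div_mul, ← Nat.div_div_eq_div_mul, h1]
  have hfst : ∀ (c : V × V → ℕ) (E : Finset (V × V)), IsCutSystem L R a c E →
      (∀ e ∈ E, dyadicLevel (a e.1) (c e) < dyadicLevel (a e.1) (a e.2)) → ∀ v,
      (v ∈ (M c E).image Prod.fst ↔
        (i, (⟨d, β % 2 ^ d⟩ : Σ _ : ℕ, ℕ), a v) ∈ cutCode a c E ∧ a v / 2 ^ i = β) := by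
    intro c E h hE v
    rw [mem_cutCode]
    simp only [M, Finset.mem_image, Finset.mem_filter]
    constructor
    · rintro ⟨f, ⟨hf, hfi, hfd, hfβ⟩, rfl⟩
      exact ⟨⟨f, hf, hfi, hfd, by rw [hfβ], Or.inl rfl⟩, hfβ⟩
    · rintro ⟨⟨f, hf, hfi, hfd, hfρ, hfv⟩, hv⟩
      rcases hfv with hfv | hfv
      · exact ⟨f, ⟨hf, hfi, hfd, by rw [hfv, hv]⟩, h.inj hfv⟩
      · exfalso
        obtain ⟨h1, h2⟩ := hmix c E h hE f hf hfi hfd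
        rw [← hfv] at hv
        exact h2 (hdivs _ _ (by rw [hfρ, hv]) h1)
  have hsnd : ∀ (c : V × V → ℕ) (E : Finset (V × V)), IsCutSystem L R a c E →
      (∀ e ∈ E, dyadicLevel (a e.1) (c e) < dyadicLevel (a e.1) (a e.2)) → ∀ v,
      (v ∈ (M c E).image Prod.snd ↔
        (i, (⟨d, β % 2 ^ d⟩ : Σ _ : ℕ, ℕ), a v) ∈ cutCode a c E ∧ a v / 2 ^ i ≠ β ∧
          a v / 2 ^ (i + d) = a e.1 / 2 ^ (i + d)) := by
    intro c E h hE v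
    rw [mem_cutCode]
    simp only [M, Finset.mem_image, Finset.mem_filter]
    constructor
    · rintro ⟨f, ⟨hf, hfi, hfd, hfβ⟩, rfl⟩
      obtain ⟨h1, h2⟩ := hmix c E h hE f hf hfi hfd
      refine ⟨⟨f, hf, hfi, hfd, by rw [hfβ], Or.inr rfl⟩, by rw [← hfβ]; exact h2, ?_⟩
      rw [h1]
      exact hdivs' _ _ (by rw [hfβ])
    · rintro ⟨⟨f, hf, hfi, hfd, hfρ, hfv⟩, hv, hv2⟩
      obtain ⟨h1, h2⟩ := hmix c E h hE f hf hfi hfd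
      rcases hfv with hfv | hfv
      · exfalso
        rw [← hfv] at hv hv2
        exact hv (hdivs _ _ hfρ hv2)
      · refine ⟨f, ⟨hf, hfi, hfd, ?_⟩, h.inj hfv⟩
        rw [← hfv] at hv2
        exact hdivs _ _ hfρ (by rw [← h1, hv2])
  have hMM : M c E = M c' E' := by
    refine hU _ _ (hpair c E h hE) (hpair c' E' h' hE') ?_ ?_
    · ext v; rw [hfst c E h hE, hfst c' E' h' hE', hcode]
    · ext v; rw [hsnd c E h hE, hsnd c' E' h' hE', hcode]
  have : e ∈ M c E := Finset.mem_filter.2 ⟨he, rfl, rfl, rfl⟩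
  rw [hMM] at this
  exact (Finset.mem_filter.1 this).1

variable [Fintype V]

theorem IsCutSystem.sum_level_le {a : V → ℕ} {c : V × V → ℕ} {E : Finset (V × V)}
    (h : IsCutSystem L R a c E) (hR : ∀ e f, R e f → e.1 ≠ f.1) :
    ∑ e ∈ E, (dyadicLevel (a e.1) (a e.2) - dyadicLevel (a e.1) (c e)) ≤ Fintype.card V * L := by
  have h1 : ∀ e ∈ E, dyadicLevel (a e.1) (a e.2) - dyadicLevel (a e.1) (c e) =
      ∑ l ∈ Finset.range L, if dyadicLevel (a e.1) (c e) ≤ l ∧ l < dyadicLevel (a e.1) (a e.2)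
        then 1 else 0 := by
    intro e he
    have h2 : dyadicLevel (a e.1) (a e.2) ≤ L := by
      rw [dyadicLevel_le_iff, Nat.div_eq_of_lt (h.lt _), Nat.div_eq_of_lt (h.lt _)]
    rw [← Finset.card_filter, ← Nat.card_Ico]
    congr 1
    ext l
    simp only [Finset.mem_Ico, Finset.mem_filter, Finset.mem_range]
    omega
  rw [Finset.sum_congr rfl h1, Finset.sum_comm, mul_comm, ← Finset.card_range L]
  rw [Finset.card_range, ← smul_eq_mul]
  conv_rhs => rw [← Finset.card_range L]
  refine Finset.sum_le_card_nsmul _ _ _ fun l _ => ?_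
  rw [← Finset.card_filter]
  refine (Finset.card_le_card_of_injOn Prod.fst (t := Finset.univ) (by simp) ?_)
  rintro e he f hf hef
  simp only [Finset.coe_filter, Set.mem_ofPred_eq, dyadicLevel_le_iff] at he hf
  obtain ⟨he, he1, he2⟩ := he
  obtain ⟨hf, hf1, hf2⟩ := hf
  rw [← not_le, dyadicLevel_le_iff] at he2 hf2
  by_contra hne
  refine hR e f (h.rel_of_div_eq he hf hne l ?_ ?_ ?_ ?_ ?_) hef
  · rw [hef]; exact h.fst_lt f hf
  · rw [← hef]; exact h.fst_lt e he
  · rw [← he1, ← hf1, hef]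
  · rw [← he1]; exact Ne.symm he2
  · rw [← hf1]; exact Ne.symm hf2

theorem IsCutSystem.le_prod_cutCode {a : V → ℕ} {c : V × V → ℕ} {E : Finset (V × V)}
    (h : IsCutSystem L R a c E) (hR : ∀ e f, R e f → e.1 ≠ f.1) :
    ((1 : ℝ) / 4) ^ (2 * (Fintype.card V * L)) ≤ ∏ t ∈ cutCode a c E, ((1 : ℝ) / 4) ^ t.2.1.1 := by
  rw [Finset.prod_pow_eq_pow_sum]
  refine pow_le_pow_of_le_one (by norm_num) (by norm_num) ?_
  rw [cutCode]
  refine (Finset.sum_image_le_of_nonneg (by simp)).trans ?_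
  rw [Finset.sum_product]
  simp only [Finset.sum_const, Finset.card_univ, Fintype.card_bool, smul_eq_mul]
  rw [← Finset.mul_sum]
  exact Nat.mul_le_mul_left _ (h.sum_level_le hR)

theorem ncard_cutSystem_near_le (hR : ∀ e f, R e f → e.1 ≠ f.1)
    (hU : ∀ M N : Finset (V × V), (M : Set (V × V)).Pairwise R → (N : Set (V × V)).Pairwise R →
      M.image Prod.fst = N.image Prod.fst → M.image Prod.snd = N.image Prod.snd → M = N) :
    ({E : Finset (V × V) | ∃ a c, IsCutSystem L R a c E ∧
      ∀ e ∈ E, dyadicLevel (a e.1) (c e) < dyadicLevel (a e.1) (a e.2)}.ncard : ℝ) ≤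
    (2 ^ L) ^ Fintype.card V * (4 ^ (2 * (Fintype.card V * L)) * Real.exp (L * 2 ^ L)) := by
  set 𝓔 := {E : Finset (V × V) | ∃ a c, IsCutSystem L R a c E ∧
      ∀ e ∈ E, dyadicLevel (a e.1) (c e) < dyadicLevel (a e.1) (a e.2)} with h𝓔
  have hch : ∀ E : 𝓔, ∃ a c, IsCutSystem L R a c E.1 ∧
      ∀ e ∈ E.1, dyadicLevel (a e.1) (c e) < dyadicLevel (a e.1) (a e.2) := fun E => E.2
  choose a c h hE using hch
  set T := (cutSymbols L).powerset.filter fun Z =>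
    ((1 : ℝ) / 4) ^ (2 * (Fintype.card V * L)) ≤ ∏ t ∈ Z, ((1 : ℝ) / 4) ^ t.2.1.1 with hT
  let code : 𝓔 → (V → Fin (2 ^ L)) × T := fun E =>
    (fun v => ⟨a E v, (h E).lt v⟩, ⟨cutCode (a E) (c E) E.1,
      Finset.mem_filter.2 ⟨Finset.mem_powerset.2 ((h E).cutCode_subset (hE E)),
        (h E).le_prod_cutCode hR⟩⟩)
  have hinj : Function.Injective code := by
    intro E E' heq
    have h1 : a E = a E' := by
      ext v
      exact congrArg Fin.val (congrFun (congrArg Prod.fst heq) v)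
    have h2 : cutCode (a E) (c E) E.1 = cutCode (a E') (c E') E'.1 :=
      congrArg (fun t => (Prod.snd t : T).1) heq
    rw [h1] at h2
    have hEa := h E
    have hEb := hE E
    rw [h1] at hEa hEb
    ext1
    exact Finset.Subset.antisymm
      (hEa.subset_of_cutCode_eq (h E') hEb (hE E') hU h2)
      ((h E').subset_of_cutCode_eq hEa (hE E') hEb hU h2.symm)
  have hcard := Nat.card_le_card_of_injective code hinj
  rw [Nat.card_coe_set_eq] at hcard
  rw [Nat.card_prod] at hcard
  simp only [Nat.card_eq_fintype_card, Fintype.card_fun, Fintype.card_fin, Fintype.card_coe]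
    at hcard
  have hT1 : (T.card : ℝ) ≤ 4 ^ (2 * (Fintype.card V * L)) * Real.exp (L * 2 ^ L) := by
    have h0 := Finset.card_filter_prod_ge_le (cutSymbols L) (fun t => ((1 : ℝ) / 4) ^ t.2.1.1)
      (fun t => by positivity) (((1 : ℝ) / 4) ^ (2 * (Fintype.card V * L))) (by positivity)
    refine h0.trans ?_
    rw [one_div, inv_pow, inv_inv]
    gcongr
    simpa only [one_div] using sum_cutSymbols_le L
  calc (𝓔.ncard : ℝ) ≤ (((2 ^ L) ^ Fintype.card V * T.card : ℕ) : ℝ) := by exact_mod_cast hcard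
    _ ≤ _ := by
      push_cast
      gcongr

theorem dyadicLevel_reverse {x y : ℕ} (hx : x < 2 ^ L) (hy : y < 2 ^ L) :
    dyadicLevel (2 ^ L - (x + 1)) (2 ^ L - (y + 1)) = dyadicLevel x y := by
  refine eq_of_forall_ge_iff fun i => ?_
  rw [dyadicLevel_le_iff, dyadicLevel_le_iff]
  rcases le_total i L with hi | hi
  · have hp : (2 : ℕ) ^ L = 2 ^ i * 2 ^ (L - i) := by rw [← pow_add]; congr 1; omega
    have h1 : ∀ z < 2 ^ L, (2 ^ L - (z + 1)) / 2 ^ i = 2 ^ (L - i) - (z / 2 ^ i + 1) ∧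
        z / 2 ^ i < 2 ^ (L - i) := by
      intro z hz
      rw [hp] at hz ⊢
      exact ⟨Nat.mul_sub_div _ _ _ hz, Nat.div_lt_of_lt_mul hz⟩
    have hx1 := h1 x hx
    have hy1 := h1 y hy
    rw [hx1.1, hy1.1]
    omega
  · have hp : (2 : ℕ) ^ L ≤ 2 ^ i := Nat.pow_le_pow_right (by norm_num) hi
    rw [Nat.div_eq_of_lt, Nat.div_eq_of_lt, Nat.div_eq_of_lt, Nat.div_eq_of_lt] <;> omega

theorem ncard_cutSystem_le (hR : ∀ e f, R e f → e.1 ≠ f.1 ∧ e.2 ≠ f.2)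
    (hU : ∀ M N : Finset (V × V), (M : Set (V × V)).Pairwise R → (N : Set (V × V)).Pairwise R →
      M.image Prod.fst = N.image Prod.fst → M.image Prod.snd = N.image Prod.snd → M = N) :
    ({E : Finset (V × V) | ∃ a c, IsCutSystem L R a c E}.ncard : ℝ) ≤
    ((2 ^ L) ^ Fintype.card V * (4 ^ (2 * (Fintype.card V * L)) * Real.exp (L * 2 ^ L))) ^ 2 := by
  set R' : V × V → V × V → Prop := fun e f => R e.swap f.swap with hR'
  have hsw : ∀ M : Finset (V × V), (M : Set (V × V)).Pairwise R' →
      ((M.image Prod.swap : Finset (V × V)) : Set (V × V)).Pairwise R := by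
    intro M hM e' he' f' hf' hef
    obtain ⟨e, he, rfl⟩ := Finset.mem_image.1 (Finset.mem_coe.1 he')
    obtain ⟨f, hf, rfl⟩ := Finset.mem_image.1 (Finset.mem_coe.1 hf')
    exact hM he hf fun h => hef (by rw [h])
  have hU' : ∀ M N : Finset (V × V), (M : Set (V × V)).Pairwise R' →
      (N : Set (V × V)).Pairwise R' →
      M.image Prod.fst = N.image Prod.fst → M.image Prod.snd = N.image Prod.snd → M = N := by
    intro M N hM hN h1 h2
    have := hU (M.image Prod.swap) (N.image Prod.swap) (hsw M hM)
      (hsw N hN)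
      (by simpa [Finset.image_image, Function.comp_def] using h2)
      (by simpa [Finset.image_image, Function.comp_def] using h1)
    exact Finset.image_injective Prod.swap_injective this
  have hA := ncard_cutSystem_near_le (L := L) (fun e f h => (hR e f h).1) hU
  have hB := ncard_cutSystem_near_le (L := L) (R := R') (fun e f h => (hR _ _ h).2) hU'
  set 𝓐 := {E : Finset (V × V) | ∃ a c, IsCutSystem L R a c E ∧
      ∀ e ∈ E, dyadicLevel (a e.1) (c e) < dyadicLevel (a e.1) (a e.2)}
  set 𝓑 := {E : Finset (V × V) | ∃ a c, IsCutSystem L R' a c E ∧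
      ∀ e ∈ E, dyadicLevel (a e.1) (c e) < dyadicLevel (a e.1) (a e.2)}
  have hsub : {E : Finset (V × V) | ∃ a c, IsCutSystem L R a c E} ⊆
      (fun AB : Finset (V × V) × Finset (V × V) => AB.1 ∪ AB.2.image Prod.swap) '' (𝓐 ×ˢ 𝓑) := by
    rintro E ⟨a, c, h⟩
    refine ⟨(E.filter fun e => dyadicLevel (a e.1) (c e) < dyadicLevel (a e.1) (a e.2),
      (E.filter fun e => ¬ dyadicLevel (a e.1) (c e) < dyadicLevel (a e.1) (a e.2)).image
        Prod.swap), ⟨?_, ?_⟩, ?_⟩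
    · exact ⟨a, c, h.mono (Finset.filter_subset _ _), fun e he => (Finset.mem_filter.1 he).2⟩
    · refine ⟨fun v => 2 ^ L - (a v + 1), fun e => 2 ^ L - (c e.swap + 1), ⟨?_, ?_, ?_, ?_, ?_⟩, ?_⟩
      · intro u v huv
        have h1 := h.lt u
        have h2 := h.lt v
        have h3 : 2 ^ L - (a u + 1) = 2 ^ L - (a v + 1) := huv
        exact h.inj (by omega)
      · intro v
        have h1 := h.lt v
        omega
      · rintro e' he'
        obtain ⟨e, he, rfl⟩ := Finset.mem_image.1 he'
        have he := (Finset.mem_filter.1 he).1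
        have h1 := h.lt e.2
        have h2 := h.lt_snd e he
        simp only [Prod.swap_swap, Prod.fst_swap]; omega
      · rintro e' he'
        obtain ⟨e, he, rfl⟩ := Finset.mem_image.1 he'
        have he := (Finset.mem_filter.1 he).1
        have h1 := h.lt e.2
        have h2 := h.lt_snd e he
        have h3 := h.fst_lt e he
        simp only [Prod.swap_swap, Prod.snd_swap]; omega
      · rintro e' he' f' hf'
        obtain ⟨e, he, rfl⟩ := Finset.mem_image.1 he'
        have he := (Finset.mem_filter.1 he).1
        obtain ⟨f, hf, rfl⟩ := Finset.mem_image.1 hf'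
        have hf := (Finset.mem_filter.1 hf).1
        have h1 := h.lt e.2
        have h2 := h.lt f.2
        have h3 := h.lt_snd e he
        have h4 := h.lt_snd f hf
        simp only [Prod.swap_swap, Prod.fst_swap, Prod.snd_swap, hR']
        intro hne k1 k2 k3 k4
        exact h.rel e he f hf (fun h => hne (by rw [h])) (by omega) (by omega) (by omega) (by omega)
      · rintro e' he'
        obtain ⟨e, he, rfl⟩ := Finset.mem_image.1 he'
        obtain ⟨he, hlev⟩ := Finset.mem_filter.1 he
        have h1 := h.lt e.2
        have h2 := h.lt_snd e he
        have h3 := h.fst_lt e he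
        have h0 := h.lt e.1
        simp only [Prod.swap_swap, Prod.fst_swap, Prod.snd_swap]
        rw [dyadicLevel_reverse h1 (by omega), dyadicLevel_reverse h1 h0]
        set j := dyadicLevel (a e.1) (a e.2) with hj
        have hj0 : 0 < j := by
          by_contra hj0
          have : a e.1 / 2 ^ j = a e.2 / 2 ^ j := (dyadicLevel_le_iff _ _ _).1 le_rfl
          have hj0 : j = 0 := by omega
          rw [hj0] at this
          simp at this
          omega
        have h6 : (2 : ℕ) ^ j = 2 ^ (j - 1) * 2 := by rw [← pow_succ]; congr 1; omega
        have k1 : a e.1 / 2 ^ j = a e.2 / 2 ^ j := (dyadicLevel_le_iff _ _ _).1 le_rfl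
        have k2 : a e.1 / 2 ^ (j - 1) ≠ a e.2 / 2 ^ (j - 1) := fun h => by
          have := (dyadicLevel_le_iff _ _ _).2 h
          omega
        have k3 : a e.1 / 2 ^ (j - 1) ≠ c e / 2 ^ (j - 1) := fun h => by
          have := (dyadicLevel_le_iff _ _ _).2 h
          omega
        have k4 : dyadicLevel (a e.2) (a e.1) = j := by
          refine eq_of_forall_ge_iff fun i => ?_
          rw [hj, dyadicLevel_le_iff, dyadicLevel_le_iff, eq_comm]
        rw [k4]
        have k5 : a e.1 / 2 ^ (j - 1) ≤ c e / 2 ^ (j - 1) := Nat.div_le_div_right h3.le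
        have k6 : c e / 2 ^ (j - 1) ≤ a e.2 / 2 ^ (j - 1) := Nat.div_le_div_right h2.le
        rw [h6, ← Nat.div_div_eq_div_mul, ← Nat.div_div_eq_div_mul] at k1
        have k7 : dyadicLevel (a e.2) (c e) ≤ j - 1 := by
          rw [dyadicLevel_le_iff]; omega
        omega
    · simp only [Finset.image_image, Prod.swap_swap_eq, Finset.image_id]
      exact Finset.filter_union_filter_not_eq _ _
  have hfin : (𝓐 ×ˢ 𝓑).Finite := Set.toFinite _
  have h1 := (Set.ncard_le_ncard hsub (hfin.image _)).trans (Set.ncard_image_le hfin)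
  rw [Set.ncard_prod] at h1
  calc ({E : Finset (V × V) | ∃ a c, IsCutSystem L R a c E}.ncard : ℝ)
      ≤ ((𝓐.ncard * 𝓑.ncard : ℕ) : ℝ) := by exact_mod_cast h1
    _ ≤ _ := by
      push_cast
      rw [pow_two]
      gcongr

end

/-- A rooted forest: every node has at most one parent, and `depth` increases away from roots. -/
structure RootedForest (N : Type*) where
  up : N → N → Prop
  depth : N → ℕ
  depth_up : ∀ {w u}, up w u → depth w = depth u + 1
  up_unique : ∀ {w u u'}, up w u → up w u' → u = u'

namespace RootedForest

variable {N K : Type*} (G : RootedForest N) (key : N → K)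

/-- `G.Sub u w` means that `u` lies in the subtree rooted at `w`. -/
def Sub (u w : N) : Prop := Relation.ReflTransGen G.up u w

/-- Two nodes with the same parent, or two roots. -/
def Sibling (c d : N) : Prop := ∀ a, (G.up c a ↔ G.up d a)

/-- The keys on the path from the root to a node. -/
def addr (w : N) : List (WithTop K) :=
  if h : ∃ u, G.up w u then
    have : G.depth h.choose < G.depth w := by rw [G.depth_up h.choose_spec]; omega
    addr h.choose ++ [(key w : WithTop K)]
  else [(key w : WithTop K)]
termination_by G.depth w

/-- Position in the postorder traversal. -/
def pos (w : N) : List (WithTop K) := G.addr key w ++ [⊤]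

variable {G key}

theorem addr_of_up {w u : N} (h : G.up w u) :
    G.addr key w = G.addr key u ++ [(key w : WithTop K)] := by
  have hex : ∃ u, G.up w u := ⟨u, h⟩
  rw [addr, dif_pos hex]
  simp only [G.up_unique hex.choose_spec h]

theorem addr_of_root {w : N} (h : ¬ ∃ u, G.up w u) : G.addr key w = [(key w : WithTop K)] := by
  rw [addr, dif_neg h]

theorem Sub.depth_le {u w : N} (h : G.Sub u w) : G.depth w ≤ G.depth u := by
  induction h with
  | refl => exact le_rfl
  | tail _ h ih => have := G.depth_up h; omega

theorem Sub.eq_or_up {u w : N} (h : G.Sub u w) : u = w ∨ ∃ x, G.up u x ∧ G.Sub x w :=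
  Relation.ReflTransGen.cases_head h

theorem Sub.total {u w w' : N} (h : G.Sub u w) (h' : G.Sub u w') : G.Sub w w' ∨ G.Sub w' w := by
  induction h with
  | refl => exact Or.inl h'
  | tail _ h ih =>
    rcases ih with ih | ih
    · rcases ih.eq_or_up with rfl | ⟨x, hx, hxw⟩
      · exact Or.inr (Relation.ReflTransGen.single h)
      · rw [G.up_unique h hx]; exact Or.inl hxw
    · exact Or.inr (ih.tail h)

theorem Sub.exists_addr {u w : N} (h : G.Sub u w) :
    ∃ l : List K, G.addr key u = G.addr key w ++ l.map (↑) := by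
  induction h using Relation.ReflTransGen.head_induction_on with
  | refl => exact ⟨[], by simp⟩
  | @head a _ h _ ih =>
    obtain ⟨l, hl⟩ := ih
    exact ⟨l ++ [key a], by rw [addr_of_up h, hl]; simp⟩

variable [LinearOrder K]

theorem Sub.pos_le {u w : N} (h : G.Sub u w) : G.pos key u ≤ G.pos key w := by
  obtain ⟨l, hl⟩ := h.exists_addr (key := key)
  rw [pos, pos, hl, List.append_assoc]
  rcases l with _ | ⟨a, l⟩
  · simp
  · refine le_of_lt (List.append_left_lt ?_)
    exact List.cons_lt_cons_iff.2 (Or.inl (WithTop.coe_lt_top a))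

theorem Sibling.pos_lt {c c' u w : N} (h : G.Sibling c c') (hlt : key c < key c')
    (hu : G.Sub u c) (hw : G.Sub w c') : G.pos key u < G.pos key w := by
  obtain ⟨l, hl⟩ := hu.exists_addr (key := key)
  obtain ⟨l', hl'⟩ := hw.exists_addr (key := key)
  have : ∃ r, G.addr key c = r ++ [(key c : WithTop K)] ∧
      G.addr key c' = r ++ [(key c' : WithTop K)] := by
    by_cases hc : ∃ a, G.up c a
    · obtain ⟨a, ha⟩ := hc
      exact ⟨_, addr_of_up ha, addr_of_up ((h a).1 ha)⟩
    · have hc' : ¬ ∃ a, G.up c' a := fun ⟨a, ha⟩ => hc ⟨a, (h a).2 ha⟩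
      exact ⟨[], addr_of_root hc, addr_of_root hc'⟩
  obtain ⟨r, h1, h2⟩ := this
  rw [pos, pos, hl, hl', h1, h2]
  simp only [List.append_assoc, List.singleton_append]
  exact List.append_left_lt (List.cons_lt_cons_iff.2 (Or.inl (WithTop.coe_lt_coe.2 hlt)))

theorem exists_sibling {u w : N} (h1 : ¬ G.Sub u w) (h2 : ¬ G.Sub w u) :
    ∃ c c', c ≠ c' ∧ G.Sibling c c' ∧ G.Sub u c ∧ G.Sub w c' := by
  induction hn : G.depth u + G.depth w using Nat.strong_induction_on generalizing u w with
  | _ n ih =>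
  have hne : u ≠ w := by rintro rfl; exact h1 Relation.ReflTransGen.refl
  have step : ∀ u w : N, ¬ G.Sub u w → ¬ G.Sub w u → G.depth u + G.depth w = n →
      G.depth w ≤ G.depth u → ∃ c c', c ≠ c' ∧ G.Sibling c c' ∧ G.Sub u c ∧ G.Sub w c' := by
    intro u w h1 h2 hn hd
    have hne : u ≠ w := by rintro rfl; exact h1 Relation.ReflTransGen.refl
    by_cases hu : ∃ a, G.up u a
    · obtain ⟨a, ha⟩ := hu
      have hda := G.depth_up ha
      by_cases hwa : G.Sub w a
      · rcases hwa.eq_or_up with rfl | ⟨x, hx, hxa⟩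
        · exact absurd (Relation.ReflTransGen.single ha) h1
        · have h3 := G.depth_up hx
          have h4 := hxa.depth_le
          rcases hxa.eq_or_up with rfl | ⟨y, hy, hya⟩
          · exact ⟨u, w, hne, fun b => ⟨fun hb => by rwa [G.up_unique hb ha],
              fun hb => by rwa [G.up_unique hb hx]⟩, .refl, .refl⟩
          · have h5 := G.depth_up hy
            have h6 := hya.depth_le
            omega
      · obtain ⟨c, c', hcc, hs, hc, hc'⟩ := ih _ (by omega)
          (fun h => h1 (h.head ha)) hwa rfl
        exact ⟨c, c', hcc, hs, hc.head ha, hc'⟩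
    · by_cases hwa : ∃ a, G.up w a
      · obtain ⟨a, ha⟩ := hwa
        have hda := G.depth_up ha
        by_cases hua : G.Sub u a
        · rcases hua.eq_or_up with rfl | ⟨x, hx, _⟩
          · exact absurd (Relation.ReflTransGen.single ha) h2
          · exact absurd ⟨x, hx⟩ hu
        · obtain ⟨c, c', hcc, hs, hc, hc'⟩ := ih _ (by omega) hua (fun h => h2 (h.head ha)) rfl
          exact ⟨c, c', hcc, hs, hc, hc'.head ha⟩
      · exact ⟨u, w, hne, fun b => ⟨fun hb => absurd ⟨b, hb⟩ hu,
          fun hb => absurd ⟨b, hb⟩ hwa⟩, .refl, .refl⟩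
  rcases le_total (G.depth w) (G.depth u) with hd | hd
  · exact step u w h1 h2 hn hd
  · obtain ⟨c, c', hcc, hs, hc, hc'⟩ := step w u h2 h1 (by omega) hd
    exact ⟨c', c, hcc.symm, fun a => (hs a).symm, hc', hc⟩

theorem Sibling.not_sub {c c' : N} (h : G.Sibling c c') (hne : c ≠ c') : ¬ G.Sub c c' := by
  intro hs
  rcases hs.eq_or_up with rfl | ⟨x, hx, hxc⟩
  · exact hne rfl
  · have := G.depth_up ((h x).1 hx)
    have := hxc.depth_le
    omega

theorem exists_sibling_lt_of_pos_lt (hkey : Function.Injective key) {u w : N}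
    (h1 : ¬ G.Sub u w) (h2 : ¬ G.Sub w u) (hlt : G.pos key u < G.pos key w) :
    ∃ c c', key c < key c' ∧ G.Sibling c c' ∧ G.Sub u c ∧ G.Sub w c' := by
  obtain ⟨c, c', hcc, hs, hc, hc'⟩ := exists_sibling h1 h2
  refine ⟨c, c', lt_of_not_ge fun h => ?_, hs, hc, hc'⟩
  have := Sibling.pos_lt (fun a => (hs a).symm) (lt_of_le_of_ne h (hkey.ne hcc.symm)) hc' hc
  exact lt_asymm this hlt

theorem pos_injective (hkey : Function.Injective key) : Function.Injective (G.pos key) := by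
  intro u w h
  by_contra hne
  have hsub : ∀ u w : N, u ≠ w → G.pos key u = G.pos key w → ¬ G.Sub u w := by
    intro u w hne h hs
    rcases hs.eq_or_up with rfl | ⟨x, hx, hxw⟩
    · exact hne rfl
    · obtain ⟨l, hl⟩ := hxw.exists_addr (key := key)
      have := congrArg List.length h
      simp [pos, addr_of_up hx, hl] at this
  by_cases hlt : G.pos key u < G.pos key w
  · exact hlt.ne h
  · obtain ⟨c, c', hcc, hs, hc, hc'⟩ := exists_sibling (hsub u w hne h) (hsub w u (Ne.symm hne) h.symm)
    rcases lt_or_gt_of_ne (hkey.ne hcc) with h3 | h3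
    · exact (Sibling.pos_lt hs h3 hc hc').ne h
    · exact (Sibling.pos_lt (fun a => (hs a).symm) h3 hc' hc).ne h.symm

end RootedForest

/-- A rooted forest with integer levels, together with a family of paths that are monotone in
the level, each path having a height at each of its levels. -/
structure LayeredPaths (N K ι : Type*) [LinearOrder K] extends RootedForest N where
  key : N → K
  key_injective : Function.Injective key
  lev : N → ℤ
  key_lt_of_lev_lt : ∀ {u w}, lev u < lev w → key u < key w
  node : ℤ → ι → N
  lev_node : ∀ k e, lev (node k e) = k
  lo : ι → ℤ
  hi : ι → ℤ
  up_or_up : ∀ e k, lo e ≤ k → k < hi e →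
    up (node k e) (node (k + 1) e) ∨ up (node (k + 1) e) (node k e)
  height : ℤ → ι → ℝ
  height_lt : ∀ k e f, lo e ≤ k → k ≤ hi e → lo f ≤ k → k ≤ hi f →
    key (node k e) < key (node k f) → height k f < height k e

namespace LayeredPaths

open RootedForest

variable {N K ι : Type*} [LinearOrder K] (L : LayeredPaths N K ι)

abbrev Sub (u w : N) : Prop := L.toRootedForest.Sub u w

abbrev pos (w : N) : List (WithTop K) := L.toRootedForest.pos L.key w

/-- The path `e` is the lowest one through its node at level `k`, and the step before is
towards the root. -/
structure Exposed (e : ι) (k : ℤ) : Prop where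
  lo_lt : L.lo e < k
  le_hi : k ≤ L.hi e
  up : L.up (L.node (k - 1) e) (L.node k e)
  lowest : ∀ f, f ≠ e → L.lo f ≤ k → k ≤ L.hi f → L.node k f = L.node k e →
    L.height k e < L.height k f

/-- The relative heights of two paths are opposite at two different levels. -/
def Swap (e f : ι) : Prop :=
  ∃ k₁ k₂, k₁ < k₂ ∧ L.lo e ≤ k₁ ∧ L.lo f ≤ k₁ ∧ k₂ ≤ L.hi e ∧ k₂ ≤ L.hi f ∧
    L.height k₁ e < L.height k₁ f ∧ L.height k₂ f < L.height k₂ e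

variable {L}

theorem node_ne {j k : ℤ} (h : j ≠ k) (e f : ι) : L.node j e ≠ L.node k f := fun h' =>
  h (by rw [← L.lev_node j e, h', L.lev_node])

theorem Exposed.up_of_lt {e : ι} {k : ℤ} (h : L.Exposed e k) {i : ℤ} (hi : L.lo e ≤ i)
    (hik : i < k) : L.up (L.node i e) (L.node (i + 1) e) := by
  obtain ⟨m, rfl⟩ : ∃ m : ℕ, i = k - 1 - m := ⟨(k - 1 - i).toNat, by omega⟩
  induction m with
  | zero =>
    have := h.up
    simpa using this
  | succ m ih =>
    have h1 := ih (by push_cast at hi; omega) (by omega)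
    rcases L.up_or_up e _ hi (by have := h.le_hi; omega) with h2 | h2
    · exact h2
    · have e1 : k - 1 - ((m + 1 : ℕ) : ℤ) + 1 = k - 1 - m := by push_cast; ring
      rw [e1] at h2
      exact absurd (L.up_unique h1 h2) (node_ne (by push_cast; omega) _ _)

theorem Exposed.sub {e : ι} {k : ℤ} (h : L.Exposed e k) {i j : ℤ} (hi : L.lo e ≤ i)
    (hij : i ≤ j) (hjk : j ≤ k) : L.Sub (L.node i e) (L.node j e) := by
  induction j, hij using Int.leInduction with
  | base => exact .refl
  | succ j hj ih => exact (ih (by omega)).tail (h.up_of_lt (by omega) (by omega))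

theorem Exposed.pos_lt {e : ι} {k : ℤ} (h : L.Exposed e k) {j : ℤ} (hkj : k ≤ j)
    (hj : j ≤ L.hi e) : L.pos (L.node (k - 1) e) < L.pos (L.node j e) := by
  have key : (L.Sub (L.node (k - 1) e) (L.node (j - 1) e) ∧
      L.up (L.node (j - 1) e) (L.node j e)) ∨
      ∃ c c', L.lev c < L.lev c' ∧ Sibling L.toRootedForest c c' ∧
        L.Sub (L.node (k - 1) e) c ∧ L.Sub (L.node j e) c' ∧
        L.up (L.node j e) (L.node (j - 1) e) := by
    induction j, hkj using Int.leInduction with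
    | base => exact Or.inl ⟨.refl, h.up⟩
    | succ j hkj ih =>
      have hu := L.up_or_up e j (by have := h.lo_lt; omega) (by omega)
      rw [add_sub_cancel_right]
      rcases ih (by omega) with ⟨h1, h2⟩ | ⟨c, c', hl, hs, h1, h2, h3⟩
      · rcases hu with hu | hu
        · exact Or.inl ⟨h1.tail h2, hu⟩
        · refine Or.inr ⟨L.node (j - 1) e, L.node (j + 1) e, ?_, fun a => ⟨fun ha => ?_,
            fun ha => ?_⟩, h1, .refl, hu⟩
          · rw [L.lev_node, L.lev_node]; omega
          · rwa [L.up_unique ha h2]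
          · rwa [L.up_unique ha hu]
      · rcases hu with hu | hu
        · exact absurd (L.up_unique hu h3) (node_ne (by omega) _ _)
        · exact Or.inr ⟨c, c', hl, hs, h1, h2.head hu, hu⟩
  rcases key with ⟨h1, h2⟩ | ⟨c, c', hl, hs, h1, h2, -⟩
  · refine lt_of_le_of_ne (Sub.pos_le (h1.tail h2)) fun heq => ?_
    exact node_ne (by omega) _ _ (pos_injective L.key_injective heq)
  · exact hs.pos_lt (L.key_lt_of_lev_lt hl) h1 h2

theorem Exposed.pos_le {e : ι} {k : ℤ} (h : L.Exposed e k) :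
    L.pos (L.node (L.lo e) e) ≤ L.pos (L.node (k - 1) e) :=
  (h.sub le_rfl (by have := h.lo_lt; omega) (by omega)).pos_le

/-- A path leaving a subtree passes through its root. -/
theorem exists_leave {e : ι} {t : N} {i : ℤ} (hi : L.lo e ≤ i) (hih : i ≤ L.hi e)
    (h1 : L.Sub (L.node i e) t) (h2 : ¬ L.Sub (L.node (L.hi e) e) t) :
    ∃ j, i ≤ j ∧ j < L.hi e ∧ L.node j e = t ∧ L.up (L.node j e) (L.node (j + 1) e) := by
  by_contra! hcon
  have key : ∀ j, i ≤ j → j ≤ L.hi e → L.Sub (L.node j e) t := by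
    intro j hij
    induction j, hij using Int.leInduction with
    | base => exact fun _ => h1
    | succ j hij ih =>
      intro hj
      have h3 := ih (by omega)
      rcases L.up_or_up e j (by omega) (by omega) with hu | hu
      · rcases h3.eq_or_up with h4 | ⟨x, hx, hxt⟩
        · exact absurd hu (hcon j hij (by omega) h4)
        · rwa [L.up_unique hu hx]
      · exact h3.head hu
  exact h2 (key _ hih le_rfl)

theorem not_sub_of_pos_lt {u w : N} (h : L.pos w < L.pos u) : ¬ L.Sub u w :=
  fun hs => h.not_ge hs.pos_le

theorem Exposed.swap_of_sub {e f : ι} {k l : ℤ} (he : L.Exposed e k) (hf : L.Exposed f l)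
    (hef : e ≠ f)
    (h2 : L.pos (L.node (L.lo f) f) ≤ L.pos (L.node (k - 1) e))
    (h3 : L.pos (L.node (l - 1) f) < L.pos (L.node (L.hi e) e))
    (h4 : L.pos (L.node (k - 1) e) < L.pos (L.node (L.hi f) f))
    (hsub : L.Sub (L.node (k - 1) e) (L.node (l - 1) f)) : L.Swap e f ∨ L.Swap f e := by
  have hek := he.lo_lt
  have hek' := he.le_hi
  have hfl := hf.lo_lt
  have hfl' := hf.le_hi
  obtain ⟨j, hj, hj', hjn, hju⟩ := exists_leave (by omega) (by omega) hsub (not_sub_of_pos_lt h3)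
  obtain rfl : j = l - 1 := by rw [← L.lev_node j e, hjn, L.lev_node]
  rw [sub_add_cancel] at hju
  have hs : L.node l e = L.node l f := L.up_unique hju (hjn ▸ hf.up)
  have hlow := hf.lowest e hef (by omega) (by omega) hs
  by_cases hp : L.Sub (L.node (L.lo f) f) (L.node (k - 1) e)
  · obtain ⟨i, hi, hi', hin, hiu⟩ := exists_leave le_rfl (by omega) hp (not_sub_of_pos_lt h4)
    obtain rfl : i = k - 1 := by rw [← L.lev_node i f, hin, L.lev_node]
    rw [sub_add_cancel] at hiu
    have hs' : L.node k f = L.node k e := L.up_unique hiu (hin ▸ he.up)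
    have hlow' := he.lowest f hef.symm (by omega) (by omega) hs'
    have hkl : k ≠ l := by
      rintro rfl
      exact lt_asymm hlow hlow'
    exact Or.inl ⟨k, l, by omega, by omega, by omega, by omega, by omega, hlow', hlow⟩
  · have hp' : ¬ L.Sub (L.node (k - 1) e) (L.node (L.lo f) f) := fun h => by
      have := pos_injective L.key_injective (le_antisymm h2 h.pos_le)
      rw [this] at hp
      exact hp .refl
    have hlt : L.pos (L.node (L.lo f) f) < L.pos (L.node (k - 1) e) :=
      lt_of_le_of_ne h2 fun h => hp (by rw [pos_injective L.key_injective h]; exact .refl)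
    obtain ⟨c, c', hcc, hsib, hc, hc'⟩ := exists_sibling_lt_of_pos_lt L.key_injective hp hp' hlt
    have hne : c ≠ c' := by rintro rfl; exact lt_irrefl _ hcc
    have hpf : L.Sub (L.node (L.lo f) f) (L.node (l - 1) f) :=
      hf.sub le_rfl (by omega) (by omega)
    have hnot : ¬ L.Sub (L.node (l - 1) f) c := fun h => by
      rcases Sub.total (hsub.trans h) hc' with h | h
      · exact hsib.not_sub hne h
      · exact Sibling.not_sub (fun a => (hsib a).symm) hne.symm h
    have hcv : L.Sub c (L.node (l - 1) f) := (Sub.total hc hpf).resolve_right hnot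
    obtain ⟨a, hca, hav⟩ : ∃ a, L.up c a ∧ L.Sub a (L.node (l - 1) f) := by
      rcases hcv.eq_or_up with h | h
      · exact absurd (h ▸ .refl) hnot
      · exact h
    have hca' := (hsib a).1 hca
    have hqf : L.pos (L.node (l - 1) f) < L.pos (L.node (L.hi f) f) := hf.pos_lt hfl' le_rfl
    obtain ⟨i, hi, hi', hin, hiu⟩ := exists_leave le_rfl (by omega) hc
      fun h => not_sub_of_pos_lt hqf (h.trans hcv)
    obtain ⟨i', hi1, hi1', hin', hiu'⟩ := exists_leave (by omega) (by omega) hc'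
      fun h => not_sub_of_pos_lt h3 (h.trans (hav.head hca'))
    have e1 : L.node (i + 1) f = a := L.up_unique hiu (hin ▸ hca)
    have e2 : L.node (i' + 1) e = a := L.up_unique hiu' (hin' ▸ hca')
    obtain rfl : i = i' := by
      have := L.lev_node (i + 1) f
      rw [e1, ← e2, L.lev_node] at this
      omega
    have hil : i < l := by
      by_contra! h
      exact not_sub_of_pos_lt (hf.pos_lt h (by omega)) (hin ▸ hcv)
    refine Or.inl ⟨i, l, hil, by omega, by omega, by omega, by omega, ?_, hlow⟩
    exact L.height_lt i f e (by omega) (by omega) (by omega) (by omega) (by rwa [hin, hin'])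

/-- Exposed paths whose cuts are interleaved with all four endpoints swap heights. -/
theorem Exposed.swap {e f : ι} {k l : ℤ} (he : L.Exposed e k) (hf : L.Exposed f l) (hef : e ≠ f)
    (h1 : L.pos (L.node (L.lo e) e) ≤ L.pos (L.node (l - 1) f))
    (h2 : L.pos (L.node (L.lo f) f) ≤ L.pos (L.node (k - 1) e))
    (h3 : L.pos (L.node (l - 1) f) < L.pos (L.node (L.hi e) e))
    (h4 : L.pos (L.node (k - 1) e) < L.pos (L.node (L.hi f) f)) : L.Swap e f ∨ L.Swap f e := by
  have hek := he.lo_lt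
  have hfl := hf.lo_lt
  by_cases hs1 : L.Sub (L.node (k - 1) e) (L.node (l - 1) f)
  · exact he.swap_of_sub hf hef h2 h3 h4 hs1
  by_cases hs2 : L.Sub (L.node (l - 1) f) (L.node (k - 1) e)
  · exact (hf.swap_of_sub he hef.symm h1 h4 h3 hs2).symm
  exfalso
  have aux : ∀ {e f : ι} {k l : ℤ}, L.Exposed f l →
      ¬ L.Sub (L.node (k - 1) e) (L.node (l - 1) f) →
      ¬ L.Sub (L.node (l - 1) f) (L.node (k - 1) e) →
      L.pos (L.node (L.lo f) f) ≤ L.pos (L.node (k - 1) e) →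
      ¬ L.pos (L.node (k - 1) e) < L.pos (L.node (l - 1) f) := by
    intro e f k l hf h1 h2 h3 hlt
    obtain ⟨c, c', hcc, hsib, hc, hc'⟩ := exists_sibling_lt_of_pos_lt L.key_injective h1 h2 hlt
    have := hf.lo_lt
    have hpf : L.Sub (L.node (L.lo f) f) (L.node (l - 1) f) :=
      hf.sub le_rfl (by omega) (by omega)
    exact h3.not_gt (hsib.pos_lt hcc hc (hpf.trans hc'))
  rcases lt_trichotomy (L.pos (L.node (k - 1) e)) (L.pos (L.node (l - 1) f)) with h | h | h
  · exact aux hf hs1 hs2 h2 h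
  · rw [pos_injective L.key_injective h] at hs1
    exact hs1 .refl
  · exact aux he hs2 hs1 h1 h

end LayeredPaths

/-- Finitely many non-vertical segments, a connected set `F` avoiding them that is saturated
under segments avoiding them, and a discretisation `ξ` of the horizontal axis such that all
endpoints and crossings have even index. -/
structure Sweep (ι : Type*) where
  m : ι → ℝ
  b : ι → ℝ
  F : Set (ℝ × ℝ)
  ξ : ℤ → ℝ
  strictMono : StrictMono ξ
  exists_le : ∀ x, ∃ k, ξ k ≤ x
  exists_lt : ∀ x, ∃ k, x < ξ k
  lo : ι → ℤ
  hi : ι → ℤ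
  even_lo : ∀ e, Even (lo e)
  even_hi : ∀ e, Even (hi e)
  cross : ∀ e f x, e ≠ f → m e * x + b e = m f * x + b f → ∃ k, Even k ∧ x = ξ k
  notMem : ∀ e x, ξ (lo e) ≤ x → x ≤ ξ (hi e) → (x, m e * x + b e) ∉ F
  preconnected : IsPreconnected F
  mem_of_segment : ∀ p ∈ F, ∀ q, (∀ e, ∀ r ∈ segment ℝ p q, ξ (lo e) ≤ r.1 → r.1 ≤ ξ (hi e) →
    r.2 ≠ m e * r.1 + b e) → q ∈ F
  far : ∃ R : ℝ, ∀ p : ℝ × ℝ, R < |p.1| ∨ R < |p.2| → p ∈ F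

namespace Sweep

variable {ι : Type*} (S : Sweep ι)

def hgt (e : ι) (x : ℝ) : ℝ := S.m e * x + S.b e

def Covers (e : ι) (k : ℤ) : Prop := S.lo e ≤ k ∧ k ≤ S.hi e

/-- The top of the gap of `F` above a point. -/
def top (x y : ℝ) : ℝ := sSup {t | y ≤ t ∧ ∀ z, y ≤ z → z ≤ t → (x, z) ∉ S.F}

theorem bddAbove_top (x y : ℝ) :
    BddAbove {t | y ≤ t ∧ ∀ z, y ≤ z → z ≤ t → (x, z) ∉ S.F} := by
  obtain ⟨R, hR⟩ := S.far
  refine ⟨max y (R + 1), fun t ht => ?_⟩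
  by_contra h
  push Not at h
  exact ht.2 t ht.1 le_rfl (hR _ (Or.inr
    (by have := le_abs_self t; have := le_max_right y (R + 1); simp only; linarith)))

variable {S}

theorem le_top {x y : ℝ} (hy : (x, y) ∉ S.F) : y ≤ S.top x y :=
  le_csSup (S.bddAbove_top x y) ⟨le_rfl, fun _ h1 h2 => le_antisymm h1 h2 ▸ hy⟩

theorem top_le {x y z : ℝ} (hy : (x, y) ∉ S.F) (hz : (x, z) ∈ S.F) (h : y ≤ z) :
    S.top x y ≤ z :=
  csSup_le ⟨y, le_rfl, fun z h1 h2 => le_antisymm h1 h2 ▸ hy⟩ fun t ht => by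
    by_contra h'
    exact ht.2 z h (not_le.1 h').le hz

theorem lt_top_iff {x y z : ℝ} (hy : (x, y) ∉ S.F) (hz : (x, z) ∈ S.F) :
    z < S.top x y ↔ z < y := by
  constructor
  · intro h
    by_contra h'
    exact absurd (top_le hy hz (not_lt.1 h')) (not_le.2 h)
  · exact fun h => h.trans_le (le_top hy)

theorem top_eq {x y y' : ℝ} (hyy : y ≤ y') (h : ∀ z, y ≤ z → z ≤ y' → (x, z) ∉ S.F) :
    S.top x y = S.top x y' := by
  have hy : (x, y) ∉ S.F := h _ le_rfl hyy
  have hy' : (x, y') ∉ S.F := h _ hyy le_rfl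
  apply le_antisymm
  · refine csSup_le ⟨y, le_rfl, fun z h1 h2 => le_antisymm h1 h2 ▸ hy⟩ fun t ht => ?_
    rcases le_total t y' with h1 | h1
    · exact h1.trans (le_top hy')
    · exact le_csSup (S.bddAbove_top _ _) ⟨h1, fun z hz => ht.2 z (hyy.trans hz)⟩
  · refine csSup_le ⟨y', le_rfl, fun z h1 h2 => le_antisymm h1 h2 ▸ hy'⟩ fun t ht => ?_
    refine le_csSup (S.bddAbove_top _ _) ⟨hyy.trans ht.1, fun z hz hzt => ?_⟩
    rcases le_total z y' with h1 | h1
    · exact h z hz h1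
    · exact ht.2 z h1 hzt

theorem notMem_of_top_eq {x y y' z : ℝ} (hy : (x, y) ∉ S.F) (hy' : (x, y') ∉ S.F)
    (h : S.top x y = S.top x y') (h1 : y ≤ z) (h2 : z ≤ y') : (x, z) ∉ S.F := fun hz => by
  have h3 := top_le hy hz h1
  rcases h2.eq_or_lt with rfl | h2
  · exact hy' hz
  · exact absurd ((lt_top_iff hy' hz).2 h2) (not_lt.2 (h ▸ h3))

theorem lt_of_top_lt {x y y' : ℝ} (hy : (x, y) ∉ S.F) (hy' : (x, y') ∉ S.F)
    (h : S.top x y < S.top x y') : y < y' := by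
  by_contra h'
  push Not at h'
  by_cases hj : ∀ z, y' ≤ z → z ≤ y → (x, z) ∉ S.F
  · exact h.ne (top_eq h' hj).symm
  · push Not at hj
    obtain ⟨z, h1, h2, hz⟩ := hj
    linarith [top_le hy' hz h1, le_top hy]

theorem Covers.notMem {e : ι} {k : ℤ} (h : S.Covers e k) : (S.ξ k, S.hgt e (S.ξ k)) ∉ S.F :=
  S.notMem e _ (S.strictMono.monotone h.1) (S.strictMono.monotone h.2)

theorem Covers.lt {e : ι} {k : ℤ} (h : S.Covers e k) (hk : ¬ Even k) :
    S.lo e < k ∧ k < S.hi e := by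
  refine ⟨lt_of_le_of_ne h.1 fun h' => hk (h' ▸ S.even_lo e),
    lt_of_le_of_ne h.2 fun h' => hk (h' ▸ S.even_hi e)⟩

theorem hgt_continuous (e : ι) : Continuous (S.hgt e) := by
  unfold hgt; fun_prop

/-- Edges keep their order across the two strips adjacent to an odd level. -/
theorem hgt_lt_of_hgt_lt {k : ℤ} (hk : ¬ Even k) {x : ℝ} (h1 : S.ξ (k - 1) ≤ x)
    (h2 : x ≤ S.ξ (k + 1)) {e f : ι} (h : S.hgt e x < S.hgt f x) :
    S.hgt e (S.ξ k) < S.hgt f (S.ξ k) := by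
  by_contra h'
  push Not at h'
  have hne : e ≠ f := by rintro rfl; exact lt_irrefl _ h
  have hc : ContinuousOn (fun t => S.hgt e t - S.hgt f t) (Set.uIcc x (S.ξ k)) :=
    ((hgt_continuous e).sub (hgt_continuous f)).continuousOn
  obtain ⟨z, hz, hz0⟩ := intermediate_value_uIcc hc
    (show (0 : ℝ) ∈ _ from Set.mem_uIcc.2 (Or.inl ⟨by linarith, by linarith⟩))
  have hz0' : S.hgt e z = S.hgt f z := by simpa [sub_eq_zero] using hz0
  obtain ⟨j, hj, rfl⟩ := S.cross e f z hne hz0'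
  have hxz : S.ξ j ≠ x := by rintro rfl; exact h.ne hz0'
  have k1 := S.strictMono (show k - 1 < k by omega)
  have k2 := S.strictMono (show k < k + 1 by omega)
  have : j = k := by
    rcases Set.mem_uIcc.1 hz with ⟨h3, h4⟩ | ⟨h3, h4⟩
    · have a1 := S.strictMono.lt_iff_lt.1 (h1.trans_lt (lt_of_le_of_ne h3 hxz.symm))
      have a2 := S.strictMono.le_iff_le.1 h4
      omega
    · have a1 := S.strictMono.lt_iff_lt.1 ((lt_of_le_of_ne h4 hxz).trans_le h2)
      have a2 := S.strictMono.le_iff_le.1 h3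
      omega
  exact hk (this ▸ hj)

/-- A point of `F` next to an odd level can be moved onto that level inside `F`, keeping its
position relative to all edges. -/
theorem slide [Finite ι] {k : ℤ} (hk : ¬ Even k) {x y : ℝ} (h1 : S.ξ (k - 1) ≤ x)
    (h2 : x ≤ S.ξ (k + 1)) (h : (x, y) ∈ S.F) :
    ∃ y', (S.ξ k, y') ∈ S.F ∧ ∀ e, S.Covers e k → (S.hgt e x < y → S.hgt e (S.ξ k) < y') ∧
      (y < S.hgt e x → y' < S.hgt e (S.ξ k)) := by
  have := Fintype.ofFinite ι
  have hne : ∀ e, S.Covers e k → S.hgt e x ≠ y := fun e he h' => by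
    have := he.lt hk
    subst h'
    exact S.notMem e x ((S.strictMono.monotone (by omega)).trans h1)
      (h2.trans (S.strictMono.monotone (by omega))) h
  obtain ⟨y', hA, hB⟩ := Order.exists_between_finsets
    ((Finset.univ.filter fun e => S.Covers e k ∧ S.hgt e x < y).image fun e => S.hgt e (S.ξ k))
    ((Finset.univ.filter fun e => S.Covers e k ∧ y < S.hgt e x).image fun e => S.hgt e (S.ξ k))
    (by
      simp only [Finset.mem_image, Finset.mem_filter, Finset.mem_univ, true_and]
      rintro _ ⟨e, ⟨_, he⟩, rfl⟩ _ ⟨f, ⟨_, hf⟩, rfl⟩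
      exact hgt_lt_of_hgt_lt hk h1 h2 (he.trans hf))
  simp only [Finset.mem_image, Finset.mem_filter, Finset.mem_univ, true_and,
    forall_exists_index, and_imp] at hA hB
  have hAB : ∀ e, S.Covers e k → (S.hgt e x < y → S.hgt e (S.ξ k) < y') ∧
      (y < S.hgt e x → y' < S.hgt e (S.ξ k)) :=
    fun e he => ⟨fun h => hA _ e he h rfl, fun h => hB _ e he h rfl⟩
  refine ⟨y', S.mem_of_segment _ h _ fun e r hr hlo hhi heq => ?_, hAB⟩
  obtain ⟨s, t, hs, ht, hst, rfl⟩ := hr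
  obtain rfl : s = 1 - t := by linarith
  simp only [Prod.smul_mk, Prod.mk_add_mk, smul_eq_mul] at hlo hhi heq
  have k1 := S.strictMono (show k - 1 < k by omega)
  have k2 := S.strictMono (show k < k + 1 by omega)
  by_cases he : S.Covers e k
  · rcases lt_or_gt_of_ne (hne e he) with h3 | h3
    · have h4 := (hAB e he).1 h3
      simp only [hgt] at h3 h4
      have : 0 < (1 - t) * (y - (S.m e * x + S.b e)) +
          t * (y' - (S.m e * S.ξ k + S.b e)) := by
        rcases ht.eq_or_lt with rfl | ht
        · linarith
        · have := mul_pos ht (sub_pos.2 h4)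
          have := mul_nonneg hs (sub_pos.2 h3).le
          linarith
      nlinarith
    · have h4 := (hAB e he).2 h3
      simp only [hgt] at h3 h4
      have : 0 < (1 - t) * ((S.m e * x + S.b e) - y) +
          t * ((S.m e * S.ξ k + S.b e) - y') := by
        rcases ht.eq_or_lt with rfl | ht
        · linarith
        · have := mul_pos ht (sub_pos.2 h4)
          have := mul_nonneg hs (sub_pos.2 h3).le
          linarith
      nlinarith
  · have h0 : t = 0 := by
      rcases lt_or_ge k (S.lo e) with hl | hl
      · have := S.strictMono.monotone (show k + 1 ≤ S.lo e by omega)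
        by_contra h0
        have := mul_pos (lt_of_le_of_ne ht (Ne.symm h0)) (sub_pos.2 k2)
        have := mul_nonneg hs (sub_nonneg.2 h2)
        nlinarith
      · have hl : S.hi e < k := by by_contra h'; exact he ⟨hl, not_lt.1 h'⟩
        have := S.strictMono.monotone (show S.hi e ≤ k - 1 by omega)
        by_contra h0
        have := mul_pos (lt_of_le_of_ne ht (Ne.symm h0)) (sub_pos.2 k1)
        have := mul_nonneg hs (sub_nonneg.2 h1)
        nlinarith
    subst h0
    simp only [sub_zero, one_mul, zero_mul, add_zero] at hlo hhi heq
    exact S.notMem e x hlo hhi (heq ▸ h)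

variable (S) in
/-- The class of edges containing `e` at level `k`. -/
def node (k : ℤ) (e : ι) : ℤ × ℝ := (k, S.top (S.ξ k) (S.hgt e (S.ξ k)))

theorem hgt_lt_of_node_lt {k : ℤ} {e f : ι} (he : S.Covers e k) (hf : S.Covers f k)
    (h : (S.node k e).2 < (S.node k f).2) : S.hgt e (S.ξ k) < S.hgt f (S.ξ k) :=
  lt_of_top_lt he.notMem hf.notMem h

theorem lt_node_iff {k : ℤ} {e : ι} (he : S.Covers e k) {y : ℝ} (hy : (S.ξ k, y) ∈ S.F) :
    y < (S.node k e).2 ↔ y < S.hgt e (S.ξ k) :=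
  lt_top_iff he.notMem hy

/-- At odd levels, the class of an edge determines its neighbouring classes. -/
theorem node_eq_of_node_eq [Finite ι] {k j : ℤ} (hk : ¬ Even k) {e f : ι} (he : S.Covers e k)
    (hf : S.Covers f k) (h : S.node k e = S.node k f) (h1 : k - 1 ≤ j) (h2 : j ≤ k + 1) :
    S.node j e = S.node j f := by
  wlog hef : S.hgt e (S.ξ j) ≤ S.hgt f (S.ξ j) generalizing e f
  · exact (this hf he h.symm (not_le.1 hef).le).symm
  refine Prod.ext rfl (top_eq hef fun z hz1 hz2 hz => ?_)
  have he' := he.lt hk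
  have hf' := hf.lt hk
  obtain ⟨y', hy', hs⟩ := slide hk (S.strictMono.monotone h1) (S.strictMono.monotone h2) hz
  have e1 : S.hgt e (S.ξ j) < z := lt_of_le_of_ne hz1 fun h' => by
    subst h'
    exact (show S.Covers e j from ⟨by omega, by omega⟩).notMem hz
  have e2 : z < S.hgt f (S.ξ j) := lt_of_le_of_ne hz2 fun h' => by
    subst h'
    exact (show S.Covers f j from ⟨by omega, by omega⟩).notMem hz
  exact notMem_of_top_eq he.notMem hf.notMem (congrArg Prod.snd h) ((hs e he).1 e1).le
    ((hs f hf).2 e2).le hy'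

end Sweep

namespace Sweep

variable {ι : Type*} {S : Sweep ι}

theorem exists_index (S : Sweep ι) (x : ℝ) : ∃ k, S.ξ k ≤ x ∧ x < S.ξ (k + 1) := by
  obtain ⟨k₁, h₁⟩ := S.exists_lt x
  obtain ⟨k, hk, hmax⟩ := Int.exists_greatest_of_bdd (P := fun k => S.ξ k ≤ x)
    ⟨k₁, fun z hz => by
      by_contra h
      exact absurd (S.strictMono (not_le.1 h)) (not_lt.2 (hz.trans h₁.le))⟩ (S.exists_le x)
  exact ⟨k, hk, lt_of_not_ge fun h => by have := hmax _ h; omega⟩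

theorem exists_mem_below [Finite ι] {k : ℤ} {e : ι} (he : S.Covers e k) :
    ∃ y, (S.ξ k, y) ∈ S.F ∧ y < (S.node k e).2 ∧
      ∀ f, S.Covers f k → (S.node k f).2 < (S.node k e).2 → (S.node k f).2 ≤ y := by
  have := Fintype.ofFinite ι
  have key : ∀ f, S.Covers f k → (S.node k f).2 < (S.node k e).2 →
      ∃ z, (S.ξ k, z) ∈ S.F ∧ S.hgt f (S.ξ k) ≤ z ∧ z ≤ S.hgt e (S.ξ k) := by
    intro f hf hlt
    by_contra h
    push Not at h
    exact hlt.ne (top_eq (hgt_lt_of_node_lt hf he hlt).le fun z h1 h2 h3 =>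
      absurd (h z h3 h1) (not_lt.2 h2))
  rcases (Finset.univ.filter fun f => S.Covers f k ∧
    (S.node k f).2 < (S.node k e).2).eq_empty_or_nonempty with h0 | h0
  · obtain ⟨R, hR⟩ := S.far
    refine ⟨-(|R| + 1 + |S.hgt e (S.ξ k)|), hR _ (Or.inr ?_), ?_, fun f hf hlt => ?_⟩
    · have := le_abs_self R
      have := abs_nonneg (S.hgt e (S.ξ k))
      simp only [abs_neg]
      rw [abs_of_nonneg (by positivity)]
      linarith
    · refine lt_of_lt_of_le ?_ (le_top he.notMem)
      have := neg_abs_le (S.hgt e (S.ξ k))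
      have := abs_nonneg R
      linarith
    · exact absurd (h0 ▸ Finset.mem_filter.2 ⟨Finset.mem_univ f, hf, hlt⟩ : f ∈ (∅ : Finset ι)) (by simp)
  · obtain ⟨f, hf, hmax⟩ := Finset.exists_max_image _ (fun f => S.hgt f (S.ξ k)) h0
    simp only [Finset.mem_filter, Finset.mem_univ, true_and] at hf hmax
    obtain ⟨z, hz, h1, h2⟩ := key f hf.1 hf.2
    refine ⟨z, hz, (lt_node_iff he hz).2 (lt_of_le_of_ne h2 fun h => he.notMem (h ▸ hz)),
      fun g hg hlt => top_le hg.notMem hz ((hmax g ⟨hg, hlt⟩).trans h1)⟩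

section Parity

variable (S) in
/-- The number of links of `D` across strip `k` passing above a point. -/
def crossCount (D : Finset ((ℤ × ℝ) × ℤ × ℝ)) (k : ℤ) (p : ℝ × ℝ) : ℕ :=
  (D.filter fun d => ∃ e, S.lo e ≤ k ∧ k < S.hi e ∧ d = (S.node k e, S.node (k + 1) e) ∧
    p.2 < S.hgt e p.1).card

variable {D : Finset ((ℤ × ℝ) × ℤ × ℝ)}

theorem crossCount_eventually_eq [Finite ι] {k : ℤ} {p : ℝ × ℝ} (hp : p ∈ S.F)
    (h1 : S.ξ k ≤ p.1) (h2 : p.1 ≤ S.ξ (k + 1)) :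
    ∀ᶠ q in nhds p, S.crossCount D k q = S.crossCount D k p := by
  have : ∀ᶠ q : ℝ × ℝ in nhds p, ∀ e, S.lo e ≤ k → k < S.hi e →
      (q.2 < S.hgt e q.1 ↔ p.2 < S.hgt e p.1) := by
    rw [Filter.eventually_all]
    intro e
    by_cases hlo : S.lo e ≤ k
    swap
    · exact Filter.Eventually.of_forall fun q h => absurd h hlo
    by_cases hhi : k < S.hi e
    swap
    · exact Filter.Eventually.of_forall fun q _ h => absurd h hhi
    have hc : Continuous fun q : ℝ × ℝ => S.hgt e q.1 := (hgt_continuous e).comp continuous_fst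
    have hne : p.2 ≠ S.hgt e p.1 := fun h => S.notMem e p.1
      ((S.strictMono.monotone hlo).trans h1)
      (h2.trans (S.strictMono.monotone (by omega))) (by
        have : p = (p.1, S.m e * p.1 + S.b e) := Prod.ext rfl h
        rwa [← this])
    rcases lt_or_gt_of_ne hne with h | h
    · filter_upwards [continuous_snd.continuousAt.eventually_lt hc.continuousAt h] with q hq
      exact fun _ _ => ⟨fun _ => h, fun _ => hq⟩
    · filter_upwards [hc.continuousAt.eventually_lt continuous_snd.continuousAt h] with q hq
      exact fun _ _ => ⟨fun h' => absurd h' hq.le.not_gt, fun h' => absurd h' h.le.not_gt⟩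
  filter_upwards [this] with q hq
  unfold crossCount
  congr 1
  refine Finset.filter_congr fun d _ => ⟨?_, ?_⟩
  · rintro ⟨e, h1, h2, h3, h4⟩
    exact ⟨e, h1, h2, h3, (hq e h1 h2).1 h4⟩
  · rintro ⟨e, h1, h2, h3, h4⟩
    exact ⟨e, h1, h2, h3, (hq e h1 h2).2 h4⟩

/-- Every element of `D` joins the classes of an edge at two consecutive levels. -/
def IsLinks (S : Sweep ι) (D : Finset ((ℤ × ℝ) × ℤ × ℝ)) : Prop :=
  ∀ d ∈ D, ∃ e k, S.lo e ≤ k ∧ k < S.hi e ∧ d = (S.node k e, S.node (k + 1) e)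

theorem crossCount_left (hD : S.IsLinks D) {k : ℤ} {y : ℝ} (hy : (S.ξ k, y) ∈ S.F) :
    S.crossCount D k (S.ξ k, y) = (D.filter fun d => d.1.1 = k ∧ y < d.1.2).card := by
  unfold crossCount
  congr 1
  refine Finset.filter_congr fun d hd => ⟨?_, ?_⟩
  · rintro ⟨e, h1, h2, rfl, h3⟩
    exact ⟨rfl, (lt_node_iff ⟨h1, h2.le⟩ hy).2 h3⟩
  · rintro ⟨h1, h2⟩
    obtain ⟨e, j, h3, h4, rfl⟩ := hD d hd
    obtain rfl : j = k := h1
    exact ⟨e, h3, h4, rfl, (lt_node_iff ⟨h3, h4.le⟩ hy).1 h2⟩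

theorem crossCount_right (hD : S.IsLinks D) {k : ℤ} {y : ℝ} (hy : (S.ξ k, y) ∈ S.F) :
    S.crossCount D (k - 1) (S.ξ k, y) = (D.filter fun d => d.2.1 = k ∧ y < d.2.2).card := by
  obtain ⟨k, rfl⟩ : ∃ j, k = j + 1 := ⟨k - 1, by ring⟩
  rw [add_sub_cancel_right]
  unfold crossCount
  congr 1
  refine Finset.filter_congr fun d hd => ⟨?_, ?_⟩
  · rintro ⟨e, h1, h2, rfl, h3⟩
    exact ⟨rfl, (lt_node_iff ⟨by omega, by omega⟩ hy).2 h3⟩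
  · rintro ⟨h1, h2⟩
    obtain ⟨e, j, h3, h4, rfl⟩ := hD d hd
    obtain rfl : j = k := by simpa [node] using h1
    exact ⟨e, h3, h4, rfl, (lt_node_iff ⟨by omega, by omega⟩ hy).1 h2⟩

theorem even_card_above
    (hE : ∀ v, Even ((D.filter fun d => d.1 = v).card + (D.filter fun d => d.2 = v).card))
    (k : ℤ) (y : ℝ) : Even ((D.filter fun d => d.1.1 = k ∧ y < d.1.2).card +
      (D.filter fun d => d.2.1 = k ∧ y < d.2.2).card) := by
  set A := (D.image Prod.fst ∪ D.image Prod.snd).filter fun v => v.1 = k ∧ y < v.2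
  have h1 : (D.filter fun d => d.1.1 = k ∧ y < d.1.2).card =
      ∑ v ∈ A, (D.filter fun d => d.1 = v).card := by
    rw [Finset.card_eq_sum_card_fiberwise (f := Prod.fst) (t := A)]
    · refine Finset.sum_congr rfl fun v hv => ?_
      congr 1
      ext d
      simp only [A, Finset.mem_filter] at hv ⊢
      constructor
      · rintro ⟨⟨h, -⟩, h'⟩; exact ⟨h, h'⟩
      · rintro ⟨h, rfl⟩; exact ⟨⟨h, hv.2⟩, rfl⟩
    · intro d hd
      simp only [A, Finset.mem_filter, Finset.mem_coe] at hd ⊢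
      exact ⟨Finset.mem_union_left _ (Finset.mem_image_of_mem _ hd.1), hd.2⟩
  have h2 : (D.filter fun d => d.2.1 = k ∧ y < d.2.2).card =
      ∑ v ∈ A, (D.filter fun d => d.2 = v).card := by
    rw [Finset.card_eq_sum_card_fiberwise (f := Prod.snd) (t := A)]
    · refine Finset.sum_congr rfl fun v hv => ?_
      congr 1
      ext d
      simp only [A, Finset.mem_filter] at hv ⊢
      constructor
      · rintro ⟨⟨h, -⟩, h'⟩; exact ⟨h, h'⟩
      · rintro ⟨h, rfl⟩; exact ⟨⟨h, hv.2⟩, rfl⟩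
    · intro d hd
      simp only [A, Finset.mem_filter, Finset.mem_coe] at hd ⊢
      exact ⟨Finset.mem_union_right _ (Finset.mem_image_of_mem _ hd.1), hd.2⟩
  rw [h1, h2, ← Finset.sum_add_distrib]
  exact Finset.even_sum _ fun v _ => hE v

theorem even_crossCount_iff [Finite ι] (hD : S.IsLinks D)
    (hE : ∀ v, Even ((D.filter fun d => d.1 = v).card + (D.filter fun d => d.2 = v).card))
    {p q : ℝ × ℝ} (hp : p ∈ S.F) (hq : q ∈ S.F) {k j : ℤ} (hk1 : S.ξ k ≤ p.1)
    (hk2 : p.1 < S.ξ (k + 1)) (hj1 : S.ξ j ≤ q.1) (hj2 : q.1 < S.ξ (j + 1)) :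
    Even (S.crossCount D k p) ↔ Even (S.crossCount D j q) := by
  choose idx h1 h2 using S.exists_index
  have huniq : ∀ x k, S.ξ k ≤ x → x < S.ξ (k + 1) → idx x = k := by
    intro x k h3 h4
    have := S.strictMono.lt_iff_lt.1 ((h1 x).trans_lt h4)
    have := S.strictMono.lt_iff_lt.1 (h3.trans_lt (h2 x))
    omega
  have hc : ContinuousOn (fun p : ℝ × ℝ => decide (Even (S.crossCount D (idx p.1) p))) S.F := by
    intro p hp
    refine ContinuousAt.continuousWithinAt ?_
    refine (continuousAt_const (y := decide (Even (S.crossCount D (idx p.1) p)))).congr ?_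
    have hlt : ∀ᶠ q : ℝ × ℝ in nhds p, q.1 < S.ξ (idx p.1 + 1) :=
      continuous_fst.continuousAt.eventually_lt continuousAt_const (h2 _)
    have hcc := crossCount_eventually_eq (D := D) hp (h1 _) (h2 _).le
    rcases (h1 p.1).lt_or_eq with h | h
    · have hgt : ∀ᶠ q : ℝ × ℝ in nhds p, S.ξ (idx p.1) < q.1 :=
        continuousAt_const.eventually_lt continuous_fst.continuousAt h
      filter_upwards [hlt, hgt, hcc] with q h3 h4 h5
      rw [huniq q.1 _ h4.le h3, h5]
    · have hgt : ∀ᶠ q : ℝ × ℝ in nhds p, S.ξ (idx p.1 - 1) < q.1 :=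
        continuousAt_const.eventually_lt continuous_fst.continuousAt
          (lt_of_lt_of_le (S.strictMono (by omega)) h.le)
      have hcc' := crossCount_eventually_eq (D := D) (k := idx p.1 - 1) hp
        ((S.strictMono.monotone (by omega)).trans h.le) (by rw [sub_add_cancel]; exact h.ge)
      have hpe : p = (S.ξ (idx p.1), p.2) := Prod.ext h.symm rfl
      have hpar : Even (S.crossCount D (idx p.1) p) ↔ Even (S.crossCount D (idx p.1 - 1) p) := by
        have hp' := hp
        rw [hpe] at hp'
        have e1 := crossCount_left hD hp'
        have e2 := crossCount_right hD hp'
        rw [← hpe] at e1 e2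
        have := even_card_above hE (idx p.1) p.2
        rw [← e1, ← e2] at this
        exact Nat.even_add.1 this
      filter_upwards [hlt, hgt, hcc, hcc'] with q h3 h4 h5 h6
      rcases lt_or_ge q.1 (S.ξ (idx p.1)) with h7 | h7
      · rw [huniq q.1 (idx p.1 - 1) h4.le (by rwa [sub_add_cancel]), h6]
        exact decide_eq_decide.2 hpar
      · rw [huniq q.1 _ h7 h3, h5]
  have := S.preconnected.constant hc hp hq
  simp only [huniq _ _ hk1 hk2, huniq _ _ hj1 hj2, decide_eq_decide] at this
  exact this

theorem eq_empty_of_even [Finite ι] (hD : S.IsLinks D)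
    (hE : ∀ v, Even ((D.filter fun d => d.1 = v).card + (D.filter fun d => d.2 = v).card)) :
    D = ∅ := by
  have hfst : ∀ k y, (S.ξ k, y) ∈ S.F →
      Even (D.filter fun d => d.1.1 = k ∧ y < d.1.2).card := by
    intro k y hy
    obtain ⟨R, hR⟩ := S.far
    obtain ⟨M, hM⟩ := (D.image fun d => d.1.2).bddAbove
    have hY : (S.ξ k, max M (|R| + 1)) ∈ S.F := hR _ (Or.inr (by
      have := le_abs_self (max M (|R| + 1))
      have := le_max_right M (|R| + 1)
      have := le_abs_self R
      simp only
      linarith))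
    have hlt := S.strictMono (show k < k + 1 by omega)
    have := even_crossCount_iff hD hE hy hY (k := k) (j := k) le_rfl hlt le_rfl hlt
    rw [crossCount_left hD hy, crossCount_left hD hY] at this
    rw [this, Finset.filter_eq_empty_iff.2]
    · simp
    · rintro d hd ⟨-, h⟩
      exact absurd (hM (Finset.mem_coe.2 (Finset.mem_image_of_mem _ hd)))
        (not_le.2 ((le_max_left _ _).trans_lt h))
  have hsnd : ∀ k y, (S.ξ k, y) ∈ S.F →
      Even (D.filter fun d => d.2.1 = k ∧ y < d.2.2).card := fun k y hy =>
    (Nat.even_add.1 (even_card_above hE k y)).1 (hfst k y hy)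
  by_contra hne
  obtain ⟨d₀, hd₀⟩ := Finset.nonempty_iff_ne_empty.2 hne
  obtain ⟨k, hk, hA⟩ : ∃ k, ¬ Even k ∧
      ((D.image Prod.fst ∪ D.image Prod.snd).filter fun v : ℤ × ℝ => v.1 = k).Nonempty := by
    obtain ⟨e, k, -, -, rfl⟩ := hD d₀ hd₀
    by_cases hk : Even k
    · exact ⟨k + 1, by rwa [Int.even_add_one, not_not], S.node (k + 1) e, Finset.mem_filter.2
        ⟨Finset.mem_union_right _ (Finset.mem_image_of_mem Prod.snd hd₀), rfl⟩⟩
    · exact ⟨k, hk, S.node k e, Finset.mem_filter.2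
        ⟨Finset.mem_union_left _ (Finset.mem_image_of_mem Prod.fst hd₀), rfl⟩⟩
  obtain ⟨v, hv, hmax⟩ := Finset.exists_max_image _ (fun v : ℤ × ℝ => v.2) hA
  have hcov : ∀ u ∈ (D.image Prod.fst ∪ D.image Prod.snd).filter (fun v : ℤ × ℝ => v.1 = k),
      ∃ e, S.Covers e k ∧ u = S.node k e := by
    intro u hu
    simp only [Finset.mem_filter, Finset.mem_union, Finset.mem_image] at hu
    obtain ⟨⟨d, hd, rfl⟩ | ⟨d, hd, rfl⟩, rfl⟩ := hu
    · obtain ⟨e, j, h1, h2, rfl⟩ := hD d hd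
      exact ⟨e, ⟨h1, h2.le⟩, rfl⟩
    · obtain ⟨e, j, h1, h2, rfl⟩ := hD d hd
      exact ⟨e, ⟨h1.trans (Int.le_add_one le_rfl), h2⟩, rfl⟩
  obtain ⟨e, he, rfl⟩ := hcov v hv
  obtain ⟨y, hy, hlt, hbelow⟩ := exists_mem_below he
  have hunique : ∀ u ∈ (D.image Prod.fst ∪ D.image Prod.snd).filter (fun v : ℤ × ℝ => v.1 = k),
      y < u.2 → u = S.node k e := by
    intro u hu hyu
    have hle := hmax u hu
    obtain ⟨f, hf, rfl⟩ := hcov u hu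
    rcases hle.lt_or_eq with h | h
    · exact absurd (hbelow f hf h) (not_le.2 hyu)
    · exact Prod.ext rfl h
  have h1 : (D.filter fun d => d.1.1 = k ∧ y < d.1.2) = ∅ := by
    have hcard : (D.filter fun d => d.1.1 = k ∧ y < d.1.2).card ≤ 1 := by
      refine Finset.card_le_one.2 fun d hd d' hd' => ?_
      have key : ∀ d ∈ D.filter (fun d => d.1.1 = k ∧ y < d.1.2),
          d = (S.node k e, S.node (k + 1) e) := by
        intro d hd
        rw [Finset.mem_filter] at hd
        have := hunique d.1 (Finset.mem_filter.2
          ⟨Finset.mem_union_left _ (Finset.mem_image_of_mem Prod.fst hd.1), hd.2.1⟩) hd.2.2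
        obtain ⟨f, j, h1, h2, rfl⟩ := hD d hd.1
        obtain rfl : j = k := hd.2.1
        exact Prod.ext this (node_eq_of_node_eq hk ⟨h1, h2.le⟩ he this (by omega) le_rfl)
      rw [key d hd, key d' hd']
    have := hfst k y hy
    rw [← Finset.card_eq_zero]
    rcases this with ⟨r, hr⟩
    omega
  have h2 : (D.filter fun d => d.2.1 = k ∧ y < d.2.2) = ∅ := by
    have hcard : (D.filter fun d => d.2.1 = k ∧ y < d.2.2).card ≤ 1 := by
      refine Finset.card_le_one.2 fun d hd d' hd' => ?_
      have key : ∀ d ∈ D.filter (fun d => d.2.1 = k ∧ y < d.2.2),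
          d = (S.node (k - 1) e, S.node k e) := by
        intro d hd
        rw [Finset.mem_filter] at hd
        have := hunique d.2 (Finset.mem_filter.2
          ⟨Finset.mem_union_right _ (Finset.mem_image_of_mem Prod.snd hd.1), hd.2.1⟩) hd.2.2
        obtain ⟨f, j, h1, h2, rfl⟩ := hD d hd.1
        obtain rfl : j + 1 = k := hd.2.1
        have hj := node_eq_of_node_eq hk (j := j) ⟨by omega, by omega⟩ he this (by omega)
          (by omega)
        rw [add_sub_cancel_right]
        exact Prod.ext hj this
      rw [key d hd, key d' hd']
    have := hsnd k y hy
    rw [← Finset.card_eq_zero]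
    rcases this with ⟨r, hr⟩
    omega
  simp only [Finset.mem_filter, Finset.mem_union, Finset.mem_image] at hv
  obtain ⟨⟨d, hd, hde⟩ | ⟨d, hd, hde⟩, -⟩ := hv
  · exact Finset.filter_eq_empty_iff.1 h1 hd (by rw [hde]; exact ⟨rfl, hlt⟩)
  · exact Finset.filter_eq_empty_iff.1 h2 hd (by rw [hde]; exact ⟨rfl, hlt⟩)

end Parity

end Sweep

namespace SimpleGraph

variable {N : Type*} {G : SimpleGraph N}

/-- An acyclic graph, each component being rooted at an arbitrary vertex. -/
def IsAcyclic.rootedForest (hG : G.IsAcyclic) : RootedForest N where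
  up w u := G.Adj w u ∧ G.dist (G.connectedComponentMk w).out w =
    G.dist (G.connectedComponentMk u).out u + 1
  depth w := G.dist (G.connectedComponentMk w).out w
  depth_up h := h.2
  up_unique := by
    intro w u u' h h'
    have hr : ∀ u, G.Adj w u → (G.connectedComponentMk u).out = (G.connectedComponentMk w).out :=
      fun u h => by rw [ConnectedComponent.connectedComponentMk_eq_of_adj h]
    set r := (G.connectedComponentMk w).out
    have hrw : G.Reachable r w := ConnectedComponent.exact (Quot.out_eq _)
    have key : ∀ u, G.Adj w u → G.dist r w = G.dist r u + 1 →
        ∃ p : G.Walk r w, p.IsPath ∧ p.penultimate = u := by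
      intro u h hd
      obtain ⟨p, hp, hlen⟩ := (hrw.trans h.reachable).exists_path_of_dist
      refine ⟨p.concat h.symm, hp.concat ?_ h.symm, Walk.penultimate_concat _ _⟩
      intro hmem
      have := (dist_le (p.takeUntil w hmem)).trans (p.length_takeUntil_le_length hmem)
      omega
    obtain ⟨p, hp, rfl⟩ := key u h.1 (by rw [h.2, hr u h.1])
    obtain ⟨q, hq, rfl⟩ := key u' h'.1 (by rw [h'.2, hr u' h'.1])
    have := (hG.subsingleton_path r w).elim ⟨p, hp⟩ ⟨q, hq⟩
    rw [Subtype.mk.injEq] at this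
    rw [this]

theorem IsAcyclic.rootedForest_up_or_up (hG : G.IsAcyclic) {u w : N} (h : G.Adj u w) :
    hG.rootedForest.up u w ∨ hG.rootedForest.up w u := by
  have hr : (G.connectedComponentMk u).out = (G.connectedComponentMk w).out := by
    rw [ConnectedComponent.connectedComponentMk_eq_of_adj h]
  have hru : G.Reachable (G.connectedComponentMk u).out u :=
    ConnectedComponent.exact (Quot.out_eq _)
  rcases hG.dist_eq_dist_add_one_of_adj_of_reachable _ h hru with h1 | h1
  · exact Or.inl ⟨h, by rw [h1, hr]⟩
  · exact Or.inr ⟨h.symm, by rw [← hr, h1]⟩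

end SimpleGraph

namespace Sweep

variable {ι : Type*} (S : Sweep ι)

/-- The graph joining the classes of each edge at consecutive levels. -/
def graph : SimpleGraph (ℤ × ℝ) where
  Adj a b := ∃ e k, S.lo e ≤ k ∧ k < S.hi e ∧
    ((a = S.node k e ∧ b = S.node (k + 1) e) ∨ (b = S.node k e ∧ a = S.node (k + 1) e))
  symm := ⟨fun _ _ ⟨e, k, h1, h2, h⟩ => ⟨e, k, h1, h2, h.symm⟩⟩
  loopless := ⟨fun a ⟨e, k, _, _, h⟩ => by
    obtain ⟨h1, h2⟩ | ⟨h1, h2⟩ := h <;>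
    · have := congrArg Prod.fst (h1.symm.trans h2)
      simp [node] at this⟩

theorem graph_isAcyclic [Finite ι] : S.graph.IsAcyclic := by
  intro v c hc
  set D := (c.support.toFinset ×ˢ c.support.toFinset).filter
    fun d : (ℤ × ℝ) × ℤ × ℝ => d.1.1 + 1 = d.2.1 ∧ s(d.1, d.2) ∈ c.edges with hDdef
  have hmem : ∀ d, d ∈ D ↔ d.1.1 + 1 = d.2.1 ∧ s(d.1, d.2) ∈ c.edges := by
    intro d
    simp only [hDdef, Finset.mem_filter, Finset.mem_product, List.mem_toFinset,
      and_iff_right_iff_imp]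
    exact fun h => ⟨c.fst_mem_support_of_mem_edges h.2, c.snd_mem_support_of_mem_edges h.2⟩
  have hD : S.IsLinks D := by
    intro d hd
    obtain ⟨h1, h2⟩ := (hmem d).1 hd
    obtain ⟨e, k, hlo, hhi, h | h⟩ := c.adj_of_mem_edges h2
    · exact ⟨e, k, hlo, hhi, Prod.ext h.1 h.2⟩
    · rw [h.1, h.2] at h1
      simp only [node] at h1
      omega
  have hE : ∀ v, Even ((D.filter fun d => d.1 = v).card + (D.filter fun d => d.2 = v).card) := by
    intro x
    have heven := (hc.isTrail.even_countP_edges_iff x).2 (fun h => absurd rfl h)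
    have hdisj : Disjoint (D.filter fun d => d.1 = x) (D.filter fun d => d.2 = x) := by
      refine Finset.disjoint_left.2 fun d h1 h2 => ?_
      rw [Finset.mem_filter] at h1 h2
      have := ((hmem d).1 h1.1).1
      rw [h1.2, h2.2] at this
      omega
    rw [← Finset.card_union_of_disjoint hdisj, ← Finset.filter_or]
    have hcount : c.edges.countP (fun e => x ∈ e) =
        (c.edges.toFinset.filter fun e => x ∈ e).card := by
      rw [List.countP_eq_length_filter,
        ← List.toFinset_card_of_nodup (hc.isTrail.edges_nodup.filter _)]
      congr 1
      ext γ
      simp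
    rw [hcount] at heven
    convert heven using 1
    refine Finset.card_bij (fun d _ => s(d.1, d.2)) ?_ ?_ ?_
    · intro d hd
      rw [Finset.mem_filter, hmem] at hd
      simp only [Finset.mem_filter, List.mem_toFinset, Sym2.mem_iff]
      exact ⟨hd.1.2, hd.2.imp Eq.symm Eq.symm⟩
    · intro d hd d' hd' h
      rw [Finset.mem_filter, hmem] at hd hd'
      rcases Sym2.eq_iff.1 h with h | h
      · exact Prod.ext h.1 h.2
      · have h1 := hd.1.1
        have h2 := hd'.1.1
        rw [h.1, h.2] at h1
        omega
    · intro γ hγ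
      simp only [Finset.mem_filter, List.mem_toFinset] at hγ
      induction γ with
      | _ a b =>
      have h2 := hγ.2
      rw [Sym2.mem_iff] at h2
      obtain ⟨e, k, -, -, h | h⟩ := c.adj_of_mem_edges hγ.1
      · refine ⟨(a, b), Finset.mem_filter.2 ⟨(hmem _).2 ⟨?_, hγ.1⟩, ?_⟩, rfl⟩
        · rw [h.1, h.2]; rfl
        · exact h2.imp Eq.symm Eq.symm
      · refine ⟨(b, a), Finset.mem_filter.2 ⟨(hmem _).2 ⟨?_, ?_⟩, ?_⟩, Sym2.eq_swap⟩
        · rw [h.1, h.2]; rfl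
        · rw [Sym2.eq_swap]; exact hγ.1
        · exact h2.symm.imp Eq.symm Eq.symm
  have h0 := eq_empty_of_even hD hE
  obtain ⟨γ, hγ⟩ := List.exists_mem_of_ne_nil c.edges (by
    rw [Ne, SimpleGraph.Walk.edges_eq_nil]
    exact hc.not_nil)
  induction γ with
  | _ a b =>
  obtain ⟨e, k, -, -, h | h⟩ := c.adj_of_mem_edges hγ
  · have : (a, b) ∈ D := (hmem _).2 ⟨by rw [h.1, h.2]; rfl, hγ⟩
    simp [h0] at this
  · have : (b, a) ∈ D := (hmem _).2 ⟨by rw [h.1, h.2]; rfl, by rw [Sym2.eq_swap]; exact hγ⟩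
    simp [h0] at this

/-- The level structure of a sweep, read from left to right. -/
def layeredPaths [Finite ι] : LayeredPaths (ℤ × ℝ) (ℤ ×ₗ ℝ) ι where
  toRootedForest := S.graph_isAcyclic.rootedForest
  key w := toLex (w.1, -w.2)
  key_injective u w h := by
    have := toLex.injective h
    simpa [Prod.ext_iff] using this
  lev := Prod.fst
  key_lt_of_lev_lt h := Prod.Lex.toLex_lt_toLex.2 (Or.inl h)
  node := S.node
  lev_node _ _ := rfl
  lo := S.lo
  hi := S.hi
  up_or_up e k h1 h2 :=
    S.graph_isAcyclic.rootedForest_up_or_up ⟨e, k, h1, h2, Or.inl ⟨rfl, rfl⟩⟩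
  height k e := S.hgt e (S.ξ k)
  height_lt k e f h1 h2 h3 h4 h := by
    rcases Prod.Lex.toLex_lt_toLex.1 h with h | h
    · exact absurd h (lt_irrefl _)
    · exact hgt_lt_of_node_lt ⟨h3, h4⟩ ⟨h1, h2⟩ (neg_lt_neg_iff.1 h.2)

/-- The level structure of a sweep, read from right to left. -/
def layeredPathsRev [Finite ι] : LayeredPaths (ℤ × ℝ) (ℤ ×ₗ ℝ) ι where
  toRootedForest := S.graph_isAcyclic.rootedForest
  key w := toLex (-w.1, -w.2)
  key_injective u w h := by
    have := toLex.injective h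
    simpa [Prod.ext_iff] using this
  lev w := -w.1
  key_lt_of_lev_lt h := Prod.Lex.toLex_lt_toLex.2 (Or.inl h)
  node k := S.node (-k)
  lev_node k _ := neg_neg k
  lo e := -S.hi e
  hi e := -S.lo e
  up_or_up e k h1 h2 := S.graph_isAcyclic.rootedForest_up_or_up
    ⟨e, -(k + 1), by omega, by omega, Or.inr ⟨rfl, by rw [neg_add, neg_add_cancel_right]⟩⟩
  height k e := S.hgt e (S.ξ (-k))
  height_lt k e f h1 h2 h3 h4 h := by
    rcases Prod.Lex.toLex_lt_toLex.1 h with h | h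
    · exact absurd h (lt_irrefl _)
    · exact hgt_lt_of_node_lt ⟨by omega, by omega⟩ ⟨by omega, by omega⟩ (neg_lt_neg_iff.1 h.2)

/-- `e` is the lowest edge in its class at some odd level. -/
def Lowest (e : ι) : Prop :=
  ∃ k, ¬ Even k ∧ S.Covers e k ∧ ∀ f, f ≠ e → S.Covers f k → S.node k f = S.node k e →
    S.hgt e (S.ξ k) < S.hgt f (S.ξ k)

variable {S}

theorem Lowest.exposed [Finite ι] {e : ι} (h : S.Lowest e) :
    (∃ k, S.layeredPaths.Exposed e k) ∨ ∃ k, S.layeredPathsRev.Exposed e k := by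
  obtain ⟨k, hk, hcov, hlow⟩ := h
  obtain ⟨h1, h2⟩ := hcov.lt hk
  have hup := S.layeredPaths.up_or_up e (k - 1) (by change S.lo e ≤ _; omega)
    (by change _ < S.hi e; omega)
  have hup' := S.layeredPaths.up_or_up e k hcov.1 h2
  rw [sub_add_cancel] at hup
  rcases hup with h | h
  · exact Or.inl ⟨k, h1, hcov.2, h, fun f hf h3 h4 h5 => hlow f hf ⟨h3, h4⟩ h5⟩
  rcases hup' with h' | h'
  · have := congrArg Prod.fst (S.layeredPaths.up_unique h h')
    change k - 1 = k + 1 at this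
    omega
  · refine Or.inr ⟨-k, ?_, ?_, ?_, ?_⟩
    · change -S.hi e < -k; omega
    · change -k ≤ -S.lo e; omega
    · change S.graph_isAcyclic.rootedForest.up (S.node (-(-k - 1)) e) (S.node (- -k) e)
      rw [neg_sub, sub_neg_eq_add, neg_neg, add_comm]
      exact h'
    · intro f hf h3 h4 h5
      change S.hgt e (S.ξ (- -k)) < S.hgt f (S.ξ (- -k))
      change S.node (- -k) f = S.node (- -k) e at h5
      change -S.hi f ≤ -k at h3
      change -k ≤ -S.lo f at h4
      rw [neg_neg] at h5 ⊢
      exact hlow f hf ⟨by omega, by omega⟩ h5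

/-- An edge that is visible from below from `F` is lowest in some class. -/
theorem lowest_of_mem [Finite ι] {g : ι} {x y : ℝ} (hF : (x, y) ∈ S.F)
    (h1 : S.ξ (S.lo g) ≤ x) (h2 : x < S.ξ (S.hi g)) (hy : y < S.hgt g x)
    (hclear : ∀ f, f ≠ g → S.ξ (S.lo f) ≤ x → x ≤ S.ξ (S.hi f) →
      S.hgt f x < y ∨ S.hgt g x < S.hgt f x) : S.Lowest g := by
  obtain ⟨j, hj1, hj2⟩ := S.exists_index x
  have g1 := S.strictMono.lt_iff_lt.1 (h1.trans_lt hj2)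
  have g2 := S.strictMono.lt_iff_lt.1 (hj1.trans_lt h2)
  obtain ⟨k, hk, k1, k2⟩ : ∃ k, ¬ Even k ∧ k - 1 ≤ j ∧ j ≤ k ∧ k ≤ j + 1 := by
    by_cases h : Even j
    · exact ⟨j + 1, by rwa [Int.even_add_one, not_not], by omega, by omega, le_rfl⟩
    · exact ⟨j, h, by omega, le_rfl, by omega⟩
  have hx1 : S.ξ (k - 1) ≤ x := (S.strictMono.monotone k1).trans hj1
  have hx2 : x ≤ S.ξ (k + 1) := hj2.le.trans (S.strictMono.monotone (by omega))
  have hcov : S.Covers g k := ⟨by omega, by omega⟩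
  obtain ⟨y', hy', hs⟩ := slide hk hx1 hx2 hF
  refine ⟨k, hk, hcov, fun f hf hfk hnode => ?_⟩
  have hfk' := hfk.lt hk
  rcases hclear f hf ((S.strictMono.monotone (by omega)).trans hx1)
    (hx2.trans (S.strictMono.monotone (by omega))) with h | h
  · exact absurd hy' (notMem_of_top_eq hfk.notMem hcov.notMem (congrArg Prod.snd hnode)
      ((hs f hfk).1 h).le ((hs g hcov).2 hy).le)
  · exact hgt_lt_of_hgt_lt hk hx1 hx2 h

end Sweep

theorem exists_isCutSystem {V Λ : Type*} [Fintype V] [LinearOrder Λ] {L : ℕ}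
    {R : V × V → V × V → Prop} (pos : V → Λ) (hpos : Function.Injective pos)
    (B : V × V → Set V) (E : Finset (V × V))
    (hB : ∀ e ∈ E, ∀ p q, pos p ≤ pos q → q ∈ B e → p ∈ B e)
    (h1 : ∀ e ∈ E, e.1 ∈ B e) (h2 : ∀ e ∈ E, e.2 ∉ B e)
    (hR : ∀ e ∈ E, ∀ f ∈ E, e ≠ f → e.1 ∈ B f → e.2 ∉ B f → f.1 ∈ B e → f.2 ∉ B e → R e f)
    (hL : 2 * Fintype.card V ≤ 2 ^ L) : ∃ a c, IsCutSystem L R a c E := by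
  set rank : V → ℕ := fun p => (Finset.univ.filter fun q => pos q < pos p).card
  set size : V × V → ℕ := fun e => (Finset.univ.filter fun q => q ∈ B e).card
  have hlt : ∀ e ∈ E, ∀ p, p ∈ B e → rank p < size e := by
    intro e he p hp
    refine Finset.card_lt_card ⟨fun q hq => ?_, fun h => ?_⟩
    · simp only [Finset.mem_filter, Finset.mem_univ, true_and] at hq ⊢
      exact hB e he q p hq.le hp
    · have := h (Finset.mem_filter.2 ⟨Finset.mem_univ p, hp⟩)
      simp at this
  have hge : ∀ e ∈ E, ∀ p, p ∉ B e → size e ≤ rank p := by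
    intro e he p hp
    refine Finset.card_le_card fun q hq => ?_
    simp only [Finset.mem_filter, Finset.mem_univ, true_and] at hq ⊢
    by_contra h
    exact hp (hB e he p q (not_lt.1 h) hq)
  have hpos' : ∀ e ∈ E, 0 < size e := fun e he => (Nat.zero_le _).trans_lt (hlt e he _ (h1 e he))
  have i1 : ∀ e ∈ E, ∀ p, 2 * rank p < 2 * size e - 1 ↔ p ∈ B e := by
    intro e he p
    have := hpos' e he
    by_cases hp : p ∈ B e
    · have := hlt e he p hp
      simp only [hp, iff_true]; omega
    · have := hge e he p hp
      simp only [hp, iff_false]; omega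
  have i2 : ∀ e ∈ E, ∀ p, 2 * size e - 1 < 2 * rank p ↔ p ∉ B e := by
    intro e he p
    have := hpos' e he
    by_cases hp : p ∈ B e
    · have := hlt e he p hp
      simp only [hp, not_true, iff_false]; omega
    · have := hge e he p hp
      simp only [hp, not_false_iff, iff_true]; omega
  have hrank : ∀ p q, pos p < pos q → rank p < rank q := by
    intro p q hpq
    refine Finset.card_lt_card ⟨fun r hr => ?_, fun h => ?_⟩
    · simp only [Finset.mem_filter, Finset.mem_univ, true_and] at hr ⊢
      exact hr.trans hpq
    · have := h (Finset.mem_filter.2 ⟨Finset.mem_univ p, hpq⟩)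
      simp at this
  refine ⟨fun p => 2 * rank p, fun e => 2 * size e - 1, ⟨?_, ?_, ?_, ?_, ?_⟩⟩
  · intro p q h
    by_contra hne
    rcases lt_or_gt_of_ne (hpos.ne hne) with h' | h' <;>
    · have := hrank _ _ h'
      simp only at h
      omega
  · intro p
    have : rank p < Fintype.card V :=
      Finset.card_lt_univ_of_notMem (x := p) (by simp)
    omega
  · exact fun e he => (i1 e he _).2 (h1 e he)
  · exact fun e he => (i2 e he _).2 (h2 e he)
  · exact fun e he f hf hef a1 a2 a3 a4 => hR e he f hf hef ((i1 f hf _).1 a1) ((i2 f hf _).1 a2)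
      ((i1 e he _).1 a3) ((i2 e he _).1 a4)

namespace LayeredPaths

variable {V N K : Type*} [Fintype V] [LinearOrder K] {H : Finset (V × V)}

theorem exists_isCutSystem (P : LayeredPaths N K H) {l : ℕ} {R : V × V → V × V → Prop}
    (nodeV : V → N) (hinj : Function.Injective nodeV)
    (h1 : ∀ e : H, nodeV e.1.1 = P.node (P.lo e) e) (h2 : ∀ e : H, nodeV e.1.2 = P.node (P.hi e) e)
    (hR : ∀ e f : H, P.Swap e f ∨ P.Swap f e → R e f) (hl : 2 * Fintype.card V ≤ 2 ^ l) :
    ∃ a c, IsCutSystem l R a c (H.filter fun e => ∃ h, ∃ k, P.Exposed ⟨e, h⟩ k) := by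
  choose! lev hlev using fun (e : H) (h : ∃ k, P.Exposed e k) => h
  refine _root_.exists_isCutSystem (fun p => P.pos (nodeV p))
    ((RootedForest.pos_injective P.key_injective).comp hinj)
    (fun e => {p | ∃ h : e ∈ H, P.pos (nodeV p) ≤ P.pos (P.node (lev ⟨e, h⟩ - 1) ⟨e, h⟩)}) _
    ?_ ?_ ?_ ?_ hl
  · rintro e - p q hpq ⟨h, hq⟩
    exact ⟨h, hpq.trans hq⟩
  · intro e he
    obtain ⟨heH, h, he⟩ := Finset.mem_filter.1 he
    exact ⟨heH, (h1 ⟨e, heH⟩) ▸ (hlev _ he).pos_le⟩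
  · rintro e he ⟨_, h'⟩
    obtain ⟨heH, h, he⟩ := Finset.mem_filter.1 he
    rw [h2 ⟨e, heH⟩] at h'
    exact absurd ((hlev _ he).pos_lt (hlev _ he).le_hi le_rfl) (not_lt.2 h')
  · rintro e he f hf hef ⟨_, a1⟩ a2 ⟨_, a3⟩ a4
    obtain ⟨heH, h, he⟩ := Finset.mem_filter.1 he
    obtain ⟨hfH, h', hf⟩ := Finset.mem_filter.1 hf
    rw [h1 ⟨e, heH⟩] at a1
    rw [h1 ⟨f, hfH⟩] at a3
    have a2' := lt_of_not_ge fun h => a2 ⟨hfH, h⟩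
    have a4' := lt_of_not_ge fun h => a4 ⟨heH, h⟩
    rw [h2 ⟨e, heH⟩] at a2'
    rw [h2 ⟨f, hfH⟩] at a4'
    exact hR ⟨e, heH⟩ ⟨f, hfH⟩ ((hlev _ he).swap (hlev _ hf)
      (fun h => hef (congrArg Subtype.val h)) a1 a3 a2' a4')

theorem exists_isCutSystem_rev (P : LayeredPaths N K H) {l : ℕ} {R : V × V → V × V → Prop}
    (nodeV : V → N) (hinj : Function.Injective nodeV)
    (h1 : ∀ e : H, nodeV e.1.2 = P.node (P.lo e) e) (h2 : ∀ e : H, nodeV e.1.1 = P.node (P.hi e) e)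
    (hR : ∀ e f : H, P.Swap e f ∨ P.Swap f e → R e f) (hl : 2 * Fintype.card V ≤ 2 ^ l) :
    ∃ a c, IsCutSystem l R a c (H.filter fun e => ∃ h, ∃ k, P.Exposed ⟨e, h⟩ k) := by
  choose! lev hlev using fun (e : H) (h : ∃ k, P.Exposed e k) => h
  refine _root_.exists_isCutSystem (fun p => OrderDual.toDual (P.pos (nodeV p)))
    (OrderDual.toDual.injective.comp
      ((RootedForest.pos_injective P.key_injective).comp hinj))
    (fun e => {p | ∃ h : e ∈ H, P.pos (P.node (lev ⟨e, h⟩ - 1) ⟨e, h⟩) < P.pos (nodeV p)}) _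
    ?_ ?_ ?_ ?_ hl
  · rintro e - p q hpq ⟨h, hq⟩
    exact ⟨h, hq.trans_le hpq⟩
  · intro e he
    obtain ⟨heH, h, he⟩ := Finset.mem_filter.1 he
    exact ⟨heH, (h2 ⟨e, heH⟩) ▸ (hlev _ he).pos_lt (hlev _ he).le_hi le_rfl⟩
  · rintro e he ⟨_, h'⟩
    obtain ⟨heH, h, he⟩ := Finset.mem_filter.1 he
    rw [h1 ⟨e, heH⟩] at h'
    exact absurd (hlev _ he).pos_le (not_le.2 h')
  · rintro e he f hf hef ⟨_, a1⟩ a2 ⟨_, a3⟩ a4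
    obtain ⟨heH, h, he⟩ := Finset.mem_filter.1 he
    obtain ⟨hfH, h', hf⟩ := Finset.mem_filter.1 hf
    rw [h2 ⟨e, heH⟩] at a1
    rw [h2 ⟨f, hfH⟩] at a3
    have a2' := le_of_not_gt fun h => a2 ⟨hfH, h⟩
    have a4' := le_of_not_gt fun h => a4 ⟨heH, h⟩
    rw [h1 ⟨e, heH⟩] at a2'
    rw [h1 ⟨f, hfH⟩] at a4'
    exact hR ⟨e, heH⟩ ⟨f, hfH⟩ ((hlev _ he).swap (hlev _ hf)
      (fun h => hef (congrArg Subtype.val h)) a2' a4' a1 a3)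

end LayeredPaths

theorem ProperlyCross.symm {V : Type*} {P : V → ℝ × ℝ} {e f : V × V} (h : ProperlyCross P e f) :
    ProperlyCross P f e := by
  obtain ⟨h1, h2, h3⟩ := h
  refine ⟨h2, h1, ?_⟩
  rcases h3 with ⟨a, b, c, d⟩ | ⟨a, b, c, d⟩
  · exact Or.inr ⟨a, b, c, d⟩
  · exact Or.inl ⟨a, b, c, d⟩

theorem orient_of_line {p q y : ℝ × ℝ} {m b : ℝ} (hp : p.2 = m * p.1 + b)
    (hq : q.2 = m * q.1 + b) : orient p q y = (q.1 - p.1) * (y.2 - (m * y.1 + b)) := by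
  rw [orient, hp, hq]; ring

namespace Sweep

variable {V : Type*} {H : Finset (V × V)} {S : Sweep H} {P : V → ℝ × ℝ}

theorem properlyCross_of_swap {e f : H} (he1 : (P e.1.1).1 = S.ξ (S.lo e))
    (he2 : (P e.1.2).1 = S.ξ (S.hi e)) (hf1 : (P f.1.1).1 = S.ξ (S.lo f))
    (hf2 : (P f.1.2).1 = S.ξ (S.hi f))
    (he1' : (P e.1.1).2 = S.m e * (P e.1.1).1 + S.b e)
    (he2' : (P e.1.2).2 = S.m e * (P e.1.2).1 + S.b e)
    (hf1' : (P f.1.1).2 = S.m f * (P f.1.1).1 + S.b f)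
    (hf2' : (P f.1.2).2 = S.m f * (P f.1.2).1 + S.b f)
    (h : ∃ k₁ k₂, k₁ < k₂ ∧ S.lo e ≤ k₁ ∧ S.lo f ≤ k₁ ∧ k₂ ≤ S.hi e ∧ k₂ ≤ S.hi f ∧
      S.hgt e (S.ξ k₁) < S.hgt f (S.ξ k₁) ∧ S.hgt f (S.ξ k₂) < S.hgt e (S.ξ k₂)) :
    ProperlyCross P e.1 f.1 := by
  obtain ⟨k₁, k₂, hk, h1, h2, h3, h4, h5, h6⟩ := h
  have hξ := S.strictMono hk
  have hE : (P e.1.1).1 < (P e.1.2).1 := by rw [he1, he2]; exact S.strictMono (by omega)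
  have hF : (P f.1.1).1 < (P f.1.2).1 := by rw [hf1, hf2]; exact S.strictMono (by omega)
  unfold hgt at h5 h6
  have hm : 0 < S.m e - S.m f := by
    by_contra h
    nlinarith
  have hl : ∀ x, x ≤ S.ξ k₁ → S.m e * x + S.b e < S.m f * x + S.b f := fun x hx => by nlinarith
  have hr : ∀ x, S.ξ k₂ ≤ x → S.m f * x + S.b f < S.m e * x + S.b e := fun x hx => by nlinarith
  refine ⟨hE, hF, Or.inl ⟨?_, ?_, ?_, ?_⟩⟩
  · rw [orient_of_line he1' he2']
    refine mul_pos (sub_pos.2 hE) (sub_pos.2 ?_)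
    rw [hf1']; exact hl _ (hf1 ▸ S.strictMono.monotone h2)
  · rw [orient_of_line he1' he2']
    refine mul_neg_of_pos_of_neg (sub_pos.2 hE) (sub_neg.2 ?_)
    rw [hf2']; exact hr _ (hf2 ▸ S.strictMono.monotone h4)
  · rw [orient_of_line hf1' hf2']
    refine mul_neg_of_pos_of_neg (sub_pos.2 hF) (sub_neg.2 ?_)
    rw [he1']; exact hl _ (he1 ▸ S.strictMono.monotone h1)
  · rw [orient_of_line hf1' hf2']
    refine mul_pos (sub_pos.2 hF) (sub_pos.2 ?_)
    rw [he2']; exact hr _ (he2 ▸ S.strictMono.monotone h3)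

theorem exists_isCutSystem_lowest [Fintype V] (κ : V → ℤ) (hκ : Function.Injective κ)
    (hξ : ∀ p, (P p).1 = S.ξ (κ p)) (hlo : ∀ e : H, S.lo e = κ e.1.1)
    (hhi : ∀ e : H, S.hi e = κ e.1.2)
    (h1 : ∀ e : H, (P e.1.1).2 = S.m e * (P e.1.1).1 + S.b e)
    (h2 : ∀ e : H, (P e.1.2).2 = S.m e * (P e.1.2).1 + S.b e) {l : ℕ}
    (hl : 2 * Fintype.card V ≤ 2 ^ l) :
    ∃ E₁ E₂ : Finset (V × V), E₁ ⊆ H ∧ E₂ ⊆ H ∧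
      (∃ a c, IsCutSystem l (ProperlyCross P) a c E₁) ∧
      (∃ a c, IsCutSystem l (ProperlyCross P) a c E₂) ∧
      ∀ e : H, S.Lowest e → e.1 ∈ E₁ ∪ E₂ := by
  set nodeV : V → ℤ × ℝ := fun p => (κ p, S.top (P p).1 (P p).2)
  have hinj : Function.Injective nodeV := fun p q h => hκ (congrArg Prod.fst h)
  have n1 : ∀ e : H, nodeV e.1.1 = S.node (S.lo e) e := fun e => by
    simp only [nodeV, node, hlo, hgt, ← hξ, ← h1]
  have n2 : ∀ e : H, nodeV e.1.2 = S.node (S.hi e) e := fun e => by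
    simp only [nodeV, node, hhi, hgt, ← hξ, ← h2]
  have hc : ∀ e f : H, (∃ k₁ k₂, k₁ < k₂ ∧ S.lo e ≤ k₁ ∧ S.lo f ≤ k₁ ∧ k₂ ≤ S.hi e ∧ k₂ ≤ S.hi f ∧
      S.hgt e (S.ξ k₁) < S.hgt f (S.ξ k₁) ∧ S.hgt f (S.ξ k₂) < S.hgt e (S.ξ k₂)) →
      ProperlyCross P e.1 f.1 := fun e f => properlyCross_of_swap (by rw [hlo, hξ])
    (by rw [hhi, hξ]) (by rw [hlo, hξ]) (by rw [hhi, hξ]) (h1 e) (h2 e) (h1 f) (h2 f)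
  refine ⟨_, _, Finset.filter_subset _ _, Finset.filter_subset _ _,
    S.layeredPaths.exists_isCutSystem nodeV hinj n1 n2 ?_ hl,
    S.layeredPathsRev.exists_isCutSystem_rev nodeV hinj ?_ ?_ ?_ hl, ?_⟩
  · rintro e f (h | h)
    · exact hc e f h
    · exact (hc f e h).symm
  · intro e
    change _ = S.node (- -S.hi e) e
    rw [neg_neg, n2]
  · intro e
    change _ = S.node (- -S.lo e) e
    rw [neg_neg, n1]
  · have hc' : ∀ e f : H, S.layeredPathsRev.Swap e f → ProperlyCross P f.1 e.1 := by
      rintro e f ⟨k₁, k₂, hk, a1, a2, a3, a4, a5, a6⟩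
      change -S.hi e ≤ k₁ at a1
      change -S.hi f ≤ k₁ at a2
      change k₂ ≤ -S.lo e at a3
      change k₂ ≤ -S.lo f at a4
      exact hc f e ⟨-k₂, -k₁, by omega, by omega, by omega, by omega, by omega, a6, a5⟩
    rintro e f (h | h)
    · exact (hc' e f h).symm
    · exact hc' f e h
  · intro e he
    rcases he.exposed with h | h
    · exact Finset.mem_union_left _ (Finset.mem_filter.2 ⟨e.2, e.2, h⟩)
    · exact Finset.mem_union_right _ (Finset.mem_filter.2 ⟨e.2, e.2, h⟩)

end Sweep

theorem exists_strictMono_int_superset (C : Finset ℝ) : ∃ g : ℤ → ℝ, StrictMono g ∧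
    (∀ x, ∃ k, g k ≤ x) ∧ (∀ x, ∃ k, x < g k) ∧ ∀ c ∈ C, ∃ k, g k = c := by
  induction C using Finset.induction_on with
  | empty => exact ⟨fun k => k, Int.cast_strictMono, fun x => ⟨⌊x⌋, Int.floor_le x⟩,
      fun x => ⟨⌊x⌋ + 1, by push_cast; exact Int.lt_floor_add_one x⟩, by simp⟩
  | insert c C hc ih =>
    obtain ⟨g, hg, h1, h2, h3⟩ := ih
    by_cases hmem : ∃ k, g k = c
    · refine ⟨g, hg, h1, h2, fun d hd => ?_⟩
      rcases Finset.mem_insert.1 hd with rfl | hd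
      · exact hmem
      · exact h3 d hd
    · obtain ⟨k₁, hk₁⟩ := h2 c
      obtain ⟨k, hk, hmax⟩ := Int.exists_greatest_of_bdd (P := fun k => g k ≤ c)
        ⟨k₁, fun z hz => by
          by_contra h
          exact absurd (hg (not_le.1 h)) (not_lt.2 (hz.trans hk₁.le))⟩ (h1 c)
      have hk' : g k < c := lt_of_le_of_ne hk fun h => hmem ⟨k, h⟩
      have hk1 : c < g (k + 1) := lt_of_not_ge fun h => by have := hmax _ h; omega
      set g' : ℤ → ℝ := fun i => if i ≤ k then g i else if i = k + 1 then c else g (i - 1) with hg'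
      have e1 : ∀ i, i ≤ k → g' i = g i := fun i hi => if_pos hi
      have e2 : g' (k + 1) = c := by simp [hg']
      have e3 : ∀ i, k < i → g' (i + 1) = g i := fun i hi => by
        simp only [hg']
        rw [if_neg (by omega), if_neg (by omega), add_sub_cancel_right]
      refine ⟨g', strictMono_int_of_lt_succ fun i => ?_, fun x => ?_, fun x => ?_, fun d hd => ?_⟩
      · rcases lt_trichotomy i k with h | rfl | h
        · rw [e1 i h.le, e1 _ (by omega)]; exact hg (by omega)
        · rw [e1 i le_rfl, e2]; exact hk'
        · rcases (show k + 1 ≤ i from h).eq_or_lt with rfl | h'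
          · rw [e2, e3 _ (by omega)]; exact hk1
          · obtain ⟨j, rfl⟩ : ∃ j, i = j + 1 := ⟨i - 1, by ring⟩
            rw [e3 j (by omega), e3 _ h]; exact hg (by omega)
      · obtain ⟨j, hj⟩ := h1 x
        exact ⟨min j k, by
          rw [e1 _ (min_le_right _ _)]; exact (hg.monotone (min_le_left _ _)).trans hj⟩
      · obtain ⟨j, hj⟩ := h2 x
        exact ⟨max j (k + 1) + 1, by
          rw [e3 _ (by omega)]; exact hj.trans_le (hg.monotone (le_max_left _ _))⟩
      · rcases Finset.mem_insert.1 hd with rfl | hd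
        · exact ⟨k + 1, e2⟩
        · obtain ⟨j, rfl⟩ := h3 d hd
          rcases le_or_gt j k with h | h
          · exact ⟨j, e1 j h⟩
          · exact ⟨j + 1, e3 j h⟩

theorem exists_discretisation (C : Finset ℝ) : ∃ ξ : ℤ → ℝ, StrictMono ξ ∧
    (∀ x, ∃ k, ξ k ≤ x) ∧ (∀ x, ∃ k, x < ξ k) ∧ ∀ c ∈ C, ∃ k, Even k ∧ c = ξ k := by
  obtain ⟨g, hg, h1, h2, h3⟩ := exists_strictMono_int_superset C
  set ξ : ℤ → ℝ := fun k => (g (k / 2) + g ((k + 1) / 2)) / 2 with hξ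
  have heven : ∀ i, ξ (i + i) = g i := fun i => by
    simp only [hξ]
    rw [show (i + i) / 2 = i by omega, show (i + i + 1) / 2 = i by omega]
    ring
  refine ⟨ξ, strictMono_int_of_lt_succ fun k => ?_, fun x => ?_, fun x => ?_, fun c hc => ?_⟩
  · have := hg (show k / 2 < (k + 1 + 1) / 2 by omega)
    simp only [hξ]
    linarith
  · obtain ⟨i, hi⟩ := h1 x
    exact ⟨i + i, (heven i).trans_le hi⟩
  · obtain ⟨i, hi⟩ := h2 x
    exact ⟨i + i, hi.trans_eq (heven i).symm⟩
  · obtain ⟨i, rfl⟩ := h3 c hc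
    exact ⟨i + i, ⟨i, rfl⟩, (heven i).symm⟩

theorem mem_segment_iff_of_fst_lt {p q r : ℝ × ℝ} (h : p.1 < q.1) :
    r ∈ segment ℝ p q ↔ p.1 ≤ r.1 ∧ r.1 ≤ q.1 ∧ orient p q r = 0 := by
  have h' : 0 < q.1 - p.1 := sub_pos.2 h
  constructor
  · rintro ⟨s, t, hs, ht, hst, rfl⟩
    obtain rfl : s = 1 - t := by linarith
    refine ⟨?_, ?_, ?_⟩
    · simp only [Prod.fst_add, Prod.smul_fst, smul_eq_mul]; nlinarith
    · simp only [Prod.fst_add, Prod.smul_fst, smul_eq_mul]; nlinarith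
    · simp only [orient, Prod.fst_add, Prod.smul_fst, Prod.snd_add, Prod.smul_snd, smul_eq_mul]
      ring
  · rintro ⟨h1, h2, h3⟩
    rw [orient] at h3
    refine ⟨(q.1 - r.1) / (q.1 - p.1), (r.1 - p.1) / (q.1 - p.1),
      div_nonneg (sub_nonneg.2 h2) h'.le, div_nonneg (sub_nonneg.2 h1) h'.le, ?_, ?_⟩
    · field_simp; ring
    · ext
      · simp only [Prod.fst_add, Prod.smul_fst, smul_eq_mul]; field_simp; ring
      · simp only [Prod.snd_add, Prod.smul_snd, smul_eq_mul]
        field_simp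
        linear_combination -h3

/-- The edges of `H` visible from `F` from below are covered by two cut systems. -/
theorem exists_cutSystems_of_visible_below {V : Type*} [Fintype V] {P : V → ℝ × ℝ}
    (hX : Function.Injective fun v => (P v).1)
    (hP : ∀ u v w, u ≠ v → u ≠ w → v ≠ w → orient (P u) (P v) (P w) ≠ 0)
    {H : Finset (V × V)} (hH : ∀ e ∈ H, (P e.1).1 < (P e.2).1) {F : Set (ℝ × ℝ)}
    (hdisj : ∀ e ∈ H, Disjoint (segment ℝ (P e.1) (P e.2)) F) (hconn : IsPreconnected F)
    (hseg : ∀ p ∈ F, ∀ q,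
      (∀ e ∈ H, Disjoint (segment ℝ p q) (segment ℝ (P e.1) (P e.2))) → q ∈ F)
    (hfar : ∃ R : ℝ, ∀ p : ℝ × ℝ, R < |p.1| ∨ R < |p.2| → p ∈ F) {l : ℕ}
    (hl : 2 * Fintype.card V ≤ 2 ^ l) :
    ∃ E₁ E₂ : Finset (V × V), E₁ ⊆ H ∧ E₂ ⊆ H ∧
      (∃ a c, IsCutSystem l (ProperlyCross P) a c E₁) ∧
      (∃ a c, IsCutSystem l (ProperlyCross P) a c E₂) ∧
      ∀ e ∈ H, (∃ z ∈ F, (P e.1).1 ≤ z.1 ∧ z.1 < (P e.2).1 ∧ orient (P e.1) (P e.2) z < 0 ∧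
        ∀ f ∈ H, f ≠ e → ∀ y, (z.1, y) ∈ segment ℝ (P f.1) (P f.2) →
          y < z.2 ∨ 0 < orient (P e.1) (P e.2) (z.1, y)) → e ∈ E₁ ∪ E₂ := by
  set m : H → ℝ := fun e => ((P e.1.2).2 - (P e.1.1).2) / ((P e.1.2).1 - (P e.1.1).1) with hm
  set b : H → ℝ := fun e => (P e.1.1).2 - m e * (P e.1.1).1 with hb
  have hpos : ∀ e : H, 0 < (P e.1.2).1 - (P e.1.1).1 := fun e => sub_pos.2 (hH e.1 e.2)
  have l1 : ∀ e : H, (P e.1.1).2 = m e * (P e.1.1).1 + b e := fun e => by simp [hb]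
  have l2 : ∀ e : H, (P e.1.2).2 = m e * (P e.1.2).1 + b e := fun e => by
    have := hpos e
    simp only [hb, hm]
    field_simp
    ring
  have hmem : ∀ (e : H) (r : ℝ × ℝ), r ∈ segment ℝ (P e.1.1) (P e.1.2) ↔
      (P e.1.1).1 ≤ r.1 ∧ r.1 ≤ (P e.1.2).1 ∧ r.2 = m e * r.1 + b e := fun e r => by
    rw [mem_segment_iff_of_fst_lt (hH e.1 e.2), orient_of_line (l1 e) (l2 e), mul_eq_zero,
      or_iff_right (hpos e).ne', sub_eq_zero]
  obtain ⟨ξ, hξ, hle, hlt, hC⟩ := exists_discretisation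
    (Finset.univ.image (fun v => (P v).1) ∪
      Finset.univ.image fun q : H × H => (b q.2 - b q.1) / (m q.1 - m q.2))
  choose κ hκe hκ using fun v => hC (P v).1
    (Finset.mem_union_left _ (Finset.mem_image_of_mem _ (Finset.mem_univ v)))
  let S : Sweep H :=
    { m, b, F, ξ
      strictMono := hξ
      exists_le := hle
      exists_lt := hlt
      lo := fun e => κ e.1.1
      hi := fun e => κ e.1.2
      even_lo := fun e => hκe _
      even_hi := fun e => hκe _
      cross := by
        intro e f x hef h
        by_cases hmm : m e = m f
        · exfalso
          have hbb : b e = b f := by rw [hmm] at h; linarith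
          have hef' : e.1 ≠ f.1 := fun h => hef (Subtype.ext h)
          have he := hH e.1 e.2
          have hf := hH f.1 f.2
          have key : ∀ w, (P w).2 = m f * (P w).1 + b f → w = e.1.1 ∨ w = e.1.2 := by
            intro w hw
            by_contra hne
            push Not at hne
            refine hP e.1.1 e.1.2 w (fun h => he.ne (by rw [h])) hne.1.symm hne.2.symm ?_
            rw [orient_of_line (l1 e) (l2 e), hw, hmm, hbb, sub_self, mul_zero]
          rcases key _ (l1 f) with h1 | h1 <;> rcases key _ (l2 f) with h2 | h2 <;>
            rw [h1, h2] at hf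
          · exact lt_irrefl _ hf
          · exact hef' (Prod.ext h1.symm h2.symm)
          · exact lt_asymm he hf
          · exact lt_irrefl _ hf
        · refine hC x (Finset.mem_union_right _ (Finset.mem_image.2 ⟨(e, f), Finset.mem_univ _, ?_⟩))
          rw [div_eq_iff (sub_ne_zero.2 hmm)]
          simp only
          linarith
      notMem := fun e x h1 h2 h => Set.disjoint_left.1 (hdisj e.1 e.2)
        ((hmem e _).2 ⟨(hκ _).trans_le h1, h2.trans_eq (hκ _).symm, rfl⟩) h
      preconnected := hconn
      mem_of_segment := fun p hp q h => hseg p hp q fun e he => by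
        refine Set.disjoint_left.2 fun r hr hr' => ?_
        obtain ⟨h1, h2, h3⟩ := (hmem ⟨e, he⟩ r).1 hr'
        exact h ⟨e, he⟩ r hr ((hκ _).symm.trans_le h1) (h2.trans_eq (hκ _)) h3
      far := hfar }
  have hκi : Function.Injective κ := fun u v h => hX (by simp only [hκ, h])
  obtain ⟨E₁, E₂, h1, h2, h3, h4, h5⟩ := Sweep.exists_isCutSystem_lowest (S := S) (P := P) κ hκi hκ
    (fun _ => rfl) (fun _ => rfl) l1 l2 hl
  refine ⟨E₁, E₂, h1, h2, h3, h4, ?_⟩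
  rintro e he ⟨⟨x, y⟩, hz, hx1, hx2, hy, hclear⟩
  have ho : ∀ y', orient (P e.1) (P e.2) (x, y') =
      ((P e.2).1 - (P e.1).1) * (y' - (m ⟨e, he⟩ * x + b ⟨e, he⟩)) := fun y' =>
    orient_of_line (l1 ⟨e, he⟩) (l2 ⟨e, he⟩)
  have hpe : 0 < (P e.2).1 - (P e.1).1 := hpos ⟨e, he⟩
  refine h5 ⟨e, he⟩ (Sweep.lowest_of_mem (S := S) hz ((hκ _).symm.trans_le hx1)
    (hx2.trans_eq (hκ _)) ?_ ?_)
  · rw [ho] at hy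
    exact sub_neg.1 ((pos_iff_neg_of_mul_neg hy).1 hpe)
  · intro f hf hf1 hf2
    rcases hclear f.1 f.2 (fun h => hf (Subtype.ext h)) (m f * x + b f)
      ((hmem f _).2 ⟨(hκ _).trans_le hf1, hf2.trans_eq (hκ _).symm, rfl⟩) with h | h
    · exact Or.inl h
    · rw [ho] at h
      exact Or.inr (sub_pos.1 ((pos_iff_pos_of_mul_pos h).1 hpe))

section Reflect

/-- Reflection of the plane in the horizontal axis. -/
def reflectY (p : ℝ × ℝ) : ℝ × ℝ := (p.1, -p.2)

theorem reflectY_reflectY (p : ℝ × ℝ) : reflectY (reflectY p) = p := by simp [reflectY]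

theorem orient_reflectY (p q y : ℝ × ℝ) :
    orient (reflectY p) (reflectY q) (reflectY y) = -orient p q y := by
  simp only [orient, reflectY]; ring

theorem reflectY_mem_segment {p q y : ℝ × ℝ} (h : y ∈ segment ℝ p q) :
    reflectY y ∈ segment ℝ (reflectY p) (reflectY q) := by
  obtain ⟨a, b, ha, hb, hab, rfl⟩ := h
  refine ⟨a, b, ha, hb, hab, ?_⟩
  ext <;> simp [reflectY]
  ring

theorem reflectY_mem_segment_iff {p q y : ℝ × ℝ} :
    reflectY y ∈ segment ℝ (reflectY p) (reflectY q) ↔ y ∈ segment ℝ p q :=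
  ⟨fun h => by simpa only [reflectY_reflectY] using reflectY_mem_segment h, reflectY_mem_segment⟩

theorem ProperlyCross.of_reflectY {V : Type*} {P : V → ℝ × ℝ} {e f : V × V}
    (h : ProperlyCross (fun v => reflectY (P v)) e f) : ProperlyCross P e f := by
  obtain ⟨h1, h2, h⟩ := h
  simp only [orient_reflectY, Left.neg_pos_iff, Left.neg_neg_iff] at h
  refine ⟨h1, h2, ?_⟩
  tauto

theorem IsCutSystem.mono_rel {V : Type*} {L : ℕ} {R R' : V × V → V × V → Prop} {a : V → ℕ}
    {c : V × V → ℕ} {E : Finset (V × V)} (h : IsCutSystem L R a c E)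
    (hR : ∀ e f, R e f → R' e f) : IsCutSystem L R' a c E :=
  ⟨h.inj, h.lt, h.fst_lt, h.lt_snd, fun e he f hf hef h1 h2 h3 h4 =>
    hR _ _ (h.rel e he f hf hef h1 h2 h3 h4)⟩

theorem exists_cutSystems_of_visible_above {V : Type*} [Fintype V] {P : V → ℝ × ℝ}
    (hX : Function.Injective fun v => (P v).1)
    (hP : ∀ u v w, u ≠ v → u ≠ w → v ≠ w → orient (P u) (P v) (P w) ≠ 0)
    {H : Finset (V × V)} (hH : ∀ e ∈ H, (P e.1).1 < (P e.2).1) {F : Set (ℝ × ℝ)}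
    (hdisj : ∀ e ∈ H, Disjoint (segment ℝ (P e.1) (P e.2)) F) (hconn : IsPreconnected F)
    (hseg : ∀ p ∈ F, ∀ q, (∀ e ∈ H, Disjoint (segment ℝ p q) (segment ℝ (P e.1) (P e.2))) → q ∈ F)
    (hfar : ∃ R : ℝ, ∀ p : ℝ × ℝ, R < |p.1| ∨ R < |p.2| → p ∈ F) {l : ℕ}
    (hl : 2 * Fintype.card V ≤ 2 ^ l) :
    ∃ E₁ E₂ : Finset (V × V), E₁ ⊆ H ∧ E₂ ⊆ H ∧ (∃ a c, IsCutSystem l (ProperlyCross P) a c E₁) ∧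
      (∃ a c, IsCutSystem l (ProperlyCross P) a c E₂) ∧
      ∀ e ∈ H, (∃ z ∈ F, (P e.1).1 ≤ z.1 ∧ z.1 < (P e.2).1 ∧ 0 < orient (P e.1) (P e.2) z ∧
        ∀ f ∈ H, f ≠ e → ∀ y, (z.1, y) ∈ segment ℝ (P f.1) (P f.2) →
          z.2 < y ∨ orient (P e.1) (P e.2) (z.1, y) < 0) → e ∈ E₁ ∪ E₂ := by
  obtain ⟨E₁, E₂, h1, h2, ⟨a₁, c₁, h3⟩, ⟨a₂, c₂, h4⟩, h5⟩ :=
    exists_cutSystems_of_visible_below (P := fun v => reflectY (P v)) (H := H)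
      (F := reflectY ⁻¹' F) hX
      (fun u v w huv huw hvw => by
        rw [orient_reflectY]; exact neg_ne_zero.2 (hP u v w huv huw hvw)) hH
      (fun e he => Set.disjoint_left.2 fun y hy hyF => Set.disjoint_left.1 (hdisj e he)
        (by rw [← reflectY_reflectY y] at hy; exact reflectY_mem_segment_iff.1 hy) hyF)
      (by
        have : reflectY ⁻¹' F = reflectY '' F := by
          ext y
          exact ⟨fun h => ⟨_, h, reflectY_reflectY y⟩, by
            rintro ⟨z, hz, rfl⟩; simpa only [Set.mem_preimage, reflectY_reflectY] using hz⟩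
        rw [this]
        exact hconn.image _ (by unfold reflectY; fun_prop))
      (fun p hp q h => hseg _ hp _ fun e he => Set.disjoint_left.2 fun y hy hy' =>
        Set.disjoint_left.1 (h e he)
          (by simpa only [reflectY_reflectY] using reflectY_mem_segment hy)
          (reflectY_mem_segment hy'))
      (by
        obtain ⟨R, hR⟩ := hfar
        refine ⟨R, fun p hp => hR _ ?_⟩
        simpa [reflectY] using hp) hl
  refine ⟨E₁, E₂, h1, h2, ⟨a₁, c₁, h3.mono_rel fun _ _ => .of_reflectY⟩,
    ⟨a₂, c₂, h4.mono_rel fun _ _ => .of_reflectY⟩, ?_⟩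
  rintro e he ⟨z, hz, hz1, hz2, hz3, hz4⟩
  refine h5 e he ⟨reflectY z, ?_, hz1, hz2, ?_, ?_⟩
  · simpa only [Set.mem_preimage, reflectY_reflectY] using hz
  · rw [orient_reflectY]; linarith
  · intro f hf hfe y hy
    have hy' : (z.1, -y) ∈ segment ℝ (P f.1) (P f.2) := by
      simpa [reflectY_reflectY, reflectY] using reflectY_mem_segment hy
    rcases hz4 f hf hfe _ hy' with h | h
    · left; simp only [reflectY]; linarith
    · right
      have h6 := orient_reflectY (P e.1) (P e.2) (z.1, -y)
      simp only [reflectY, neg_neg] at h6 ⊢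
      rw [h6]; linarith

end Reflect

section Visibility

theorem orient_combo (p q u v : ℝ × ℝ) {a b : ℝ} (hab : a + b = 1) :
    orient p q (a • u + b • v) = a * orient p q u + b * orient p q v := by
  obtain rfl : a = 1 - b := by linarith
  simp [orient]; ring

theorem convex_orient_pos (p q : ℝ × ℝ) : Convex ℝ {y | 0 < orient p q y} := by
  intro u hu v hv a b ha hb hab
  simp only [Set.mem_ofPred_eq] at *
  rw [orient_combo p q u v hab]
  rcases ha.lt_or_eq with h | h
  · nlinarith [mul_pos h hu, mul_nonneg hb hv.le]
  · obtain rfl : b = 1 := by linarith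
    rw [← h]; linarith

theorem convex_orient_neg (p q : ℝ × ℝ) : Convex ℝ {y | orient p q y < 0} := by
  have : {y | orient p q y < 0} = {y | 0 < orient q p y} := by
    ext y; simp only [Set.mem_ofPred_eq, orient]; constructor <;> intro h <;> linarith
  rw [this]; exact convex_orient_pos q p

theorem orient_eq_zero_of_mem_segment {p q y : ℝ × ℝ} (h : y ∈ segment ℝ p q) :
    orient p q y = 0 := by
  obtain ⟨a, b, ha, hb, hab, rfl⟩ := h
  rw [orient_combo p q p q hab, orient_left, orient_right]; simp

theorem isClosed_segment_real (p q : ℝ × ℝ) : IsClosed (segment ℝ p q) := by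
  rw [← convexHull_pair]
  exact (Set.toFinite {p, q}).isClosed_convexHull ℝ

theorem isClosed_segmentUnion {W : Type*} (P : W → ℝ × ℝ) {H : Set (W × W)} (hH : H.Finite) :
    IsClosed (segmentUnion P H) :=
  hH.isClosed_biUnion fun _ _ => isClosed_segment_real _ _

theorem isOpen_outerFace {W : Type*} (P : W → ℝ × ℝ) (o : W) {H : Set (W × W)} (hH : H.Finite) :
    IsOpen (outerFace P o H) :=
  (isClosed_segmentUnion P hH).isOpen_compl.connectedComponentIn

theorem mem_outerFace_of_isPreconnected {W : Type*} {P : W → ℝ × ℝ} {o : W} {H : Set (W × W)}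
    {S : Set (ℝ × ℝ)} (hS : IsPreconnected S) (hd : Disjoint S (segmentUnion P H)) {p q : ℝ × ℝ}
    (hp : p ∈ S) (hpF : p ∈ outerFace P o H) (hq : q ∈ S) : q ∈ outerFace P o H := by
  have := hS.subset_connectedComponentIn hp hd.subset_compl_right hq
  rwa [← connectedComponentIn_eq hpF] at this

theorem disjoint_segmentUnion {W : Type*} {P : W → ℝ × ℝ} {H : Set (W × W)} {S : Set (ℝ × ℝ)} :
    Disjoint S (segmentUnion P H) ↔ ∀ e ∈ H, Disjoint S (segment ℝ (P e.1) (P e.2)) := by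
  simp [segmentUnion, Set.disjoint_iUnion_right]

theorem outerFace_mono {W : Type*} {P : W → ℝ × ℝ} {o : W} {E H : Set (W × W)} (h : E ⊆ H) :
    outerFace P o H ⊆ outerFace P o E :=
  connectedComponentIn_mono _ (Set.compl_subset_compl.2 (Set.biUnion_subset_biUnion_left h))

theorem exists_mem_segment_near {p q z : ℝ × ℝ} (h : p.1 < q.1) (hz : z ∈ segment ℝ p q) {δ : ℝ}
    (hδ : 0 < δ) : ∃ z' ∈ segment ℝ p q, dist z' z < δ ∧ z'.1 ≠ z.1 ∧ z'.1 < q.1 := by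
  have key : ∀ r ∈ segment ℝ p q, r.1 ≠ z.1 → (r.1 < q.1 ∨ z.1 < q.1) → r.1 ≤ q.1 → z.1 ≤ q.1 →
      ∃ z' ∈ segment ℝ p q, dist z' z < δ ∧ z'.1 ≠ z.1 ∧ z'.1 < q.1 := by
    intro r hr hrz hq hrq hzq
    have hcont : Filter.Tendsto (fun t : ℝ => (1 - t) • z + t • r) (nhdsWithin 0 (Set.Ioi 0))
        (nhds z) := by
      have : Continuous fun t : ℝ => (1 - t) • z + t • r := by fun_prop
      have := this.tendsto 0
      simp only [sub_zero, one_smul, zero_smul, add_zero] at this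
      exact this.mono_left nhdsWithin_le_nhds
    have h1 := hcont.eventually (Metric.ball_mem_nhds z hδ)
    have h2 : ∀ᶠ t : ℝ in nhdsWithin 0 (Set.Ioi 0), t ∈ Set.Ioo (0 : ℝ) 1 :=
      Ioo_mem_nhdsGT one_pos
    obtain ⟨t, ht1, ht2, ht3⟩ := (h1.and h2).exists
    refine ⟨_, (convex_segment p q) hz hr (by linarith) ht2.le (by ring), ht1, ?_, ?_⟩
    · simp only [Prod.fst_add, Prod.smul_fst, smul_eq_mul]
      intro h'
      have : t * (r.1 - z.1) = 0 := by linarith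
      rcases mul_eq_zero.1 this with h | h
      · exact ht2.ne' h
      · exact hrz (by linarith)
    · simp only [Prod.fst_add, Prod.smul_fst, smul_eq_mul]
      rcases hq with h' | h'
      · nlinarith [mul_pos ht2 (sub_pos.2 h'), mul_nonneg (sub_nonneg.2 ht3.le) (sub_nonneg.2 hzq)]
      · nlinarith [mul_pos (sub_pos.2 ht3) (sub_pos.2 h'), mul_nonneg ht2.le (sub_nonneg.2 hrq)]
  obtain ⟨h1, h2, -⟩ := (mem_segment_iff_of_fst_lt h).1 hz
  by_cases hzp : z.1 = p.1
  · exact key q (right_mem_segment ℝ p q) (by rw [hzp]; exact h.ne') (Or.inr (by rw [hzp]; exact h))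
      le_rfl h2
  · exact key p (left_mem_segment ℝ p q) (Ne.symm hzp) (Or.inl h) h.le h2

theorem exists_mem_orient_ne_zero {p q : ℝ × ℝ} (h : p.1 < q.1) {S : Set (ℝ × ℝ)} (hS : IsOpen S)
    {w : ℝ × ℝ} (hw : w ∈ S) : ∃ w' ∈ S, orient p q w' ≠ 0 := by
  by_contra! hcon
  have hcont : Filter.Tendsto (fun t : ℝ => (w.1, w.2 + t)) (nhdsWithin 0 (Set.Ioi 0))
      (nhds w) := by
    have : Continuous fun t : ℝ => (w.1, w.2 + t) := by fun_prop
    have := this.tendsto 0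
    simp only [add_zero] at this
    exact this.mono_left nhdsWithin_le_nhds
  obtain ⟨t, ht, ht0⟩ := ((hcont.eventually (hS.mem_nhds hw)).and self_mem_nhdsWithin).exists
  have h1 := hcon _ ht
  have : orient p q (w.1, w.2 + t) = orient p q w + (q.1 - p.1) * t := by
    simp only [orient]; ring
  rw [this, hcon _ hw, zero_add] at h1
  exact mul_ne_zero (sub_ne_zero.2 h.ne') (ne_of_gt ht0) h1

/-- A point of `closure F \ F` in a neighbourhood meeting only one of the segments witnesses that
this segment is visible from `F`. -/
theorem exists_visible_of_ball {W : Type*} {P : W → ℝ × ℝ} {o : W} {H : Set (W × W)}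
    (hfin : H.Finite) {g : W × W} (hg : (P g.1).1 < (P g.2).1) {z : ℝ × ℝ}
    (hz : z ∈ segment ℝ (P g.1) (P g.2)) (hzF : z ∈ closure (outerFace P o H)) {δ : ℝ}
    (hδ : 0 < δ) (hB : ∀ f ∈ H, f ≠ g → Disjoint (Metric.ball z δ) (segment ℝ (P f.1) (P f.2))) :
    ∃ z ∈ outerFace P o H, (P g.1).1 ≤ z.1 ∧ z.1 < (P g.2).1 ∧
      ((orient (P g.1) (P g.2) z < 0 ∧ ∀ f ∈ H, f ≠ g →
          ∀ y, (z.1, y) ∈ segment ℝ (P f.1) (P f.2) →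
          y < z.2 ∨ 0 < orient (P g.1) (P g.2) (z.1, y)) ∨
        (0 < orient (P g.1) (P g.2) z ∧ ∀ f ∈ H, f ≠ g →
          ∀ y, (z.1, y) ∈ segment ℝ (P f.1) (P f.2) →
          z.2 < y ∨ orient (P g.1) (P g.2) (z.1, y) < 0)) := by
  obtain ⟨z', hz', hd, -, hlt⟩ := exists_mem_segment_near hg hz hδ
  obtain ⟨hge, -, h0⟩ := (mem_segment_iff_of_fst_lt hg).1 hz'
  have hw : ∃ w ∈ outerFace P o H, w ∈ Metric.ball z δ ∧ orient (P g.1) (P g.2) w ≠ 0 := by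
    have hopen : IsOpen (outerFace P o H ∩ Metric.ball z δ) :=
      (isOpen_outerFace P o hfin).inter Metric.isOpen_ball
    obtain ⟨w, hw1, hw2⟩ := mem_closure_iff.1 hzF _ Metric.isOpen_ball (Metric.mem_ball_self hδ)
    obtain ⟨w', ⟨h1, h2⟩, h3⟩ := exists_mem_orient_ne_zero hg hopen ⟨hw2, hw1⟩
    exact ⟨w', h1, h2, h3⟩
  obtain ⟨w, hwF, hwB, hwo⟩ := hw
  set η := (δ - dist z' z) / 2 with hη
  have hη0 : 0 < η := by rw [hη]; linarith
  have hz2 : ∀ t : ℝ, |t| ≤ η → (z'.1, z'.2 + t) ∈ Metric.ball z δ := by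
    intro t ht
    rw [Metric.mem_ball]
    have : dist (z'.1, z'.2 + t) z' ≤ η := by
      rw [Prod.dist_eq, dist_self, Real.dist_eq, add_sub_cancel_left]
      exact max_le hη0.le ht
    linarith [dist_triangle (z'.1, z'.2 + t) z' z]
  have hor : ∀ t : ℝ, orient (P g.1) (P g.2) (z'.1, z'.2 + t) = ((P g.2).1 - (P g.1).1) * t := by
    intro t
    have : orient (P g.1) (P g.2) (z'.1, z'.2 + t) = orient (P g.1) (P g.2) z' +
        ((P g.2).1 - (P g.1).1) * t := by simp only [orient]; ring
    rw [this, h0, zero_add]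
  have hpos := sub_pos.2 hg
  have hnear : ∀ t : ℝ, |t| ≤ η → ∀ f ∈ H, f ≠ g → (z'.1, z'.2 + t) ∉ segment ℝ (P f.1) (P f.2) :=
    fun t ht f hf hfg => Set.disjoint_left.1 (hB f hf hfg) (hz2 t ht)
  have hmove : ∀ S : Set (ℝ × ℝ), Convex ℝ S → Disjoint S (segment ℝ (P g.1) (P g.2)) → w ∈ S →
      ∀ q ∈ S, q ∈ Metric.ball z δ → q ∈ outerFace P o H := by
    intro S hS hSd hwS q hq hqB
    refine mem_outerFace_of_isPreconnected (S := S ∩ Metric.ball z δ)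
      (hS.inter (convex_ball z δ)).isPreconnected ?_ ⟨hwS, hwB⟩ hwF ⟨hq, hqB⟩
    rw [disjoint_segmentUnion]
    intro f hf
    by_cases hfg : f = g
    · subst hfg; exact hSd.mono_left Set.inter_subset_left
    · exact (hB f hf hfg).mono_left Set.inter_subset_right
  rcases lt_or_gt_of_ne hwo with hneg | hpo
  · have ht : |(-η)| ≤ η := by rw [abs_neg, abs_of_pos hη0]
    refine ⟨(z'.1, z'.2 + -η), hmove _ (convex_orient_neg (P g.1) (P g.2)) ?_ hneg _ ?_
      (hz2 _ ht), hge, hlt, Or.inl ⟨?_, ?_⟩⟩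
    · exact Set.disjoint_left.2 fun y hy hy' => ne_of_lt hy (orient_eq_zero_of_mem_segment hy')
    · change orient _ _ _ < 0
      rw [hor]; nlinarith
    · rw [hor]; nlinarith
    · intro f hf hfg y hy
      by_contra! hcon
      obtain ⟨hc1, hc2⟩ := hcon
      have hy' : y = z'.2 + (y - z'.2) := by ring
      simp only at hc1 hc2 hy
      rw [hy', hor] at hc2
      have hle : y - z'.2 ≤ 0 := by
        by_contra! hlt'
        exact absurd (mul_pos hpos hlt') (not_lt.2 hc2)
      rw [hy'] at hy
      exact hnear (y - z'.2) (abs_le.2 ⟨by linarith, by linarith⟩) f hf hfg hy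
  · have ht : |η| ≤ η := by rw [abs_of_pos hη0]
    refine ⟨(z'.1, z'.2 + η), hmove _ (convex_orient_pos (P g.1) (P g.2)) ?_ hpo _ ?_
      (hz2 _ ht), hge, hlt, Or.inr ⟨?_, ?_⟩⟩
    · exact Set.disjoint_left.2 fun y hy hy' => ne_of_gt hy (orient_eq_zero_of_mem_segment hy')
    · change 0 < orient _ _ _
      rw [hor]; nlinarith
    · rw [hor]; nlinarith
    · intro f hf hfg y hy
      by_contra! hcon
      obtain ⟨hc1, hc2⟩ := hcon
      have hy' : y = z'.2 + (y - z'.2) := by ring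
      simp only at hc1 hc2 hy
      rw [hy', hor] at hc2
      have hle : 0 ≤ y - z'.2 := by
        by_contra! hlt'
        exact absurd (mul_neg_of_pos_of_neg hpos hlt') (not_lt.2 hc2)
      rw [hy'] at hy
      exact hnear (y - z'.2) (abs_le.2 ⟨by linarith, by linarith⟩) f hf hfg hy

theorem exists_mem_closure_diff {X : Type*} [TopologicalSpace X] {S F : Set X}
    (hS : IsPreconnected S) (hF : IsOpen F) {p q : X} (hp : p ∈ S) (hpF : p ∈ F) (hq : q ∈ S)
    (hqF : q ∉ F) : ∃ z ∈ S, z ∈ closure F ∧ z ∉ F := by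
  by_contra! h
  obtain ⟨x, hxS, hx1, hx2⟩ := hS F (closure F)ᶜ hF isClosed_closure.isOpen_compl
    (fun z hz => by
      by_cases hzc : z ∈ closure F
      · exact Or.inl (h z hz hzc)
      · exact Or.inr hzc) ⟨p, hp, hpF⟩ ⟨q, hq, fun hqc => hqF (h q hq hqc)⟩
  exact hx2 (subset_closure hx1)

theorem exists_ball_disjoint {W : Type*} (P : W → ℝ × ℝ) {H : Set (W × W)} (hfin : H.Finite)
    {z : ℝ × ℝ} (hz : z ∉ segmentUnion P H) :
    ∃ δ > 0, ∀ f ∈ H, Disjoint (Metric.ball z δ) (segment ℝ (P f.1) (P f.2)) := by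
  obtain ⟨δ, hδ, h⟩ := Metric.isOpen_iff.1 (isClosed_segmentUnion P hfin).isOpen_compl z hz
  exact ⟨δ, hδ, disjoint_segmentUnion.1 (Set.disjoint_left.2 fun x hx => h hx)⟩

theorem mem_segmentUnion_of_mem_closure {W : Type*} {P : W → ℝ × ℝ} {o : W} {H : Set (W × W)}
    (hfin : H.Finite) {z : ℝ × ℝ} (hz : z ∈ closure (outerFace P o H))
    (hz' : z ∉ outerFace P o H) : z ∈ segmentUnion P H := by
  by_contra hzH
  obtain ⟨δ, hδ, h⟩ := exists_ball_disjoint P hfin hzH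
  obtain ⟨w, hw1, hw2⟩ := mem_closure_iff.1 hz _ Metric.isOpen_ball (Metric.mem_ball_self hδ)
  exact hz' (mem_outerFace_of_isPreconnected (convex_ball z δ).isPreconnected
    (disjoint_segmentUnion.2 h) hw1 hw2 (Metric.mem_ball_self hδ))

/-- If `E` contains every segment of `H` visible from the outer face, then the outer face
of `E` avoids all of `H`. -/
theorem disjoint_outerFace_of_visible_mem {W : Type*} {P : W → ℝ × ℝ} {o : W} {H E : Set (W × W)}
    (hfin : H.Finite) (hH : ∀ e ∈ H, (P e.1).1 < (P e.2).1)
    (hline : ∀ e ∈ H, ∀ f ∈ H, e ≠ f →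
      (segment ℝ (P e.1) (P e.2) ∩ segment ℝ (P f.1) (P f.2)).Subsingleton)
    (hEH : E ⊆ H) (ho : P o ∉ segmentUnion P H)
    (hE : ∀ g ∈ H, (∃ z ∈ outerFace P o H, (P g.1).1 ≤ z.1 ∧ z.1 < (P g.2).1 ∧
      ((orient (P g.1) (P g.2) z < 0 ∧ ∀ f ∈ H, f ≠ g →
          ∀ y, (z.1, y) ∈ segment ℝ (P f.1) (P f.2) →
          y < z.2 ∨ 0 < orient (P g.1) (P g.2) (z.1, y)) ∨
        (0 < orient (P g.1) (P g.2) z ∧ ∀ f ∈ H, f ≠ g →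
          ∀ y, (z.1, y) ∈ segment ℝ (P f.1) (P f.2) →
          z.2 < y ∨ orient (P g.1) (P g.2) (z.1, y) < 0))) → g ∈ E) :
    ∀ g ∈ H, Disjoint (segment ℝ (P g.1) (P g.2)) (outerFace P o E) := by
  intro g' hg'
  by_contra hnd
  obtain ⟨y, hy1, hy2⟩ := Set.not_disjoint_iff.1 hnd
  have hnot : ∀ f ∈ H, ∀ x ∈ segment ℝ (P f.1) (P f.2), x ∉ outerFace P o H := fun f hf x hx hxF =>
    connectedComponentIn_subset _ _ hxF (Set.mem_biUnion hf hx)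
  have hoF : P o ∈ outerFace P o H := mem_connectedComponentIn ho
  obtain ⟨z, hzE, hzc, hzF⟩ := exists_mem_closure_diff isPreconnected_connectedComponentIn
    (isOpen_outerFace P o hfin) (outerFace_mono hEH hoF) hoF hy2 (hnot g' hg' y hy1)
  have hzE' : z ∉ segmentUnion P E := fun h => connectedComponentIn_subset _ _ hzE h
  have hzH := mem_segmentUnion_of_mem_closure hfin hzc hzF
  simp only [segmentUnion, Set.mem_iUnion] at hzH
  obtain ⟨g, hg, hzg⟩ := hzH
  obtain ⟨δ, hδ, hB⟩ := exists_ball_disjoint P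
    (H := {f ∈ H | z ∉ segment ℝ (P f.1) (P f.2)}) (hfin.subset (Set.sep_subset _ _))
    (z := z) (by
      simp only [segmentUnion, Set.mem_iUnion, not_exists]
      rintro f ⟨-, hf⟩; exact hf)
  have hBz : ∀ f ∈ H, ∀ x ∈ Metric.ball z δ, x ∈ segment ℝ (P f.1) (P f.2) →
      z ∈ segment ℝ (P f.1) (P f.2) := by
    intro f hf x hx hxf
    by_contra hcon
    exact Set.disjoint_left.1 (hB f ⟨hf, hcon⟩) hx hxf
  have hEz : ∀ f ∈ E, z ∉ segment ℝ (P f.1) (P f.2) := fun f hf h =>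
    hzE' (Set.mem_biUnion hf h)
  obtain ⟨z', hz'g, hz'B, hz'z, -⟩ := exists_mem_segment_near (hH g hg) hzg hδ
  obtain ⟨w, hwF, hwB, hwo⟩ : ∃ w ∈ outerFace P o H, w ∈ Metric.ball z δ ∧
      orient (P g.1) (P g.2) w ≠ 0 := by
    have hopen : IsOpen (outerFace P o H ∩ Metric.ball z δ) :=
      (isOpen_outerFace P o hfin).inter Metric.isOpen_ball
    obtain ⟨w, hw1, hw2⟩ := mem_closure_iff.1 hzc _ Metric.isOpen_ball (Metric.mem_ball_self hδ)
    obtain ⟨w', ⟨h1, h2⟩, h3⟩ := exists_mem_orient_ne_zero (hH g hg) hopen ⟨hw2, hw1⟩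
    exact ⟨w', h1, h2, h3⟩
  obtain ⟨z₁, hz₁S, hz₁c, hz₁F⟩ := exists_mem_closure_diff
    (convex_segment (𝕜 := ℝ) w z').isPreconnected (isOpen_outerFace P o hfin)
    (left_mem_segment ℝ w z') hwF (right_mem_segment ℝ w z') (hnot g hg z' hz'g)
  have hz₁B : z₁ ∈ Metric.ball z δ := (convex_ball z δ).segment_subset hwB hz'B hz₁S
  have hz₁z : z₁ ≠ z := by
    rintro rfl
    obtain ⟨a, b, ha, hb, hab, hz₁⟩ := hz₁S
    have h1 : orient (P g.1) (P g.2) z₁ = 0 := orient_eq_zero_of_mem_segment hzg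
    rw [← hz₁, orient_combo _ _ _ _ hab, orient_eq_zero_of_mem_segment hz'g, mul_zero,
      add_zero] at h1
    have ha0 : a = 0 := (mul_eq_zero.1 h1).resolve_right hwo
    have hb1 : b = 1 := by linarith
    rw [ha0, hb1, zero_smul, one_smul, zero_add] at hz₁
    exact hz'z (by rw [hz₁])
  have hz₁H := mem_segmentUnion_of_mem_closure hfin hz₁c hz₁F
  simp only [segmentUnion, Set.mem_iUnion] at hz₁H
  obtain ⟨g₁, hg₁, hz₁g⟩ := hz₁H
  have huniq : ∀ f ∈ H, f ≠ g₁ → z₁ ∉ segment ℝ (P f.1) (P f.2) := fun f hf hfg hz₁f =>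
    hz₁z (hline f hf g₁ hg₁ hfg ⟨hz₁f, hz₁g⟩
      ⟨hBz f hf _ hz₁B hz₁f, hBz g₁ hg₁ _ hz₁B hz₁g⟩)
  obtain ⟨δ₁, hδ₁, hB₁⟩ := exists_ball_disjoint P
    (H := {f ∈ H | f ≠ g₁}) (hfin.subset (Set.sep_subset _ _)) (z := z₁) (by
      simp only [segmentUnion, Set.mem_iUnion, not_exists]
      rintro f ⟨hf, hfg⟩; exact huniq f hf hfg)
  exact hEz g₁ (hE g₁ hg₁ (exists_visible_of_ball hfin (hH g₁ hg₁) hz₁g hz₁c hδ₁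
    fun f hf hfg => hB₁ f ⟨hf, hfg⟩)) (hBz g₁ hg₁ _ hz₁B hz₁g)

end Visibility

section Tethered

variable {V : Type*}

theorem subsingleton_segment_inter {P : V → ℝ × ℝ}
    (hP : ∀ u v w, u ≠ v → u ≠ w → v ≠ w → orient (P u) (P v) (P w) ≠ 0) {e f : V × V}
    (he : (P e.1).1 < (P e.2).1) (hf : (P f.1).1 < (P f.2).1) (hef : e ≠ f) :
    (segment ℝ (P e.1) (P e.2) ∩ segment ℝ (P f.1) (P f.2)).Subsingleton := by
  rintro a ⟨hae, haf⟩ b ⟨hbe, hbf⟩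
  by_contra hab
  have h1 := orient_eq_zero_of_mem_segment hae
  have h2 := orient_eq_zero_of_mem_segment hbe
  have h3 := orient_eq_zero_of_mem_segment haf
  have h4 := orient_eq_zero_of_mem_segment hbf
  have hx : a.1 ≠ b.1 := by
    intro hx
    refine hab (Prod.ext hx ?_)
    simp only [orient] at h1 h2
    rw [hx] at h1
    have : ((P e.2).1 - (P e.1).1) * (a.2 - b.2) = 0 := by linear_combination h1 - h2
    exact sub_eq_zero.1 ((mul_eq_zero.1 this).resolve_left (sub_ne_zero.2 he.ne'))
  have key : ∀ w, orient (P f.1) (P f.2) (P w) = 0 → orient (P e.1) (P e.2) (P w) = 0 := by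
    intro w hw
    have : (b.1 - a.1) * ((P f.2).1 - (P f.1).1) * orient (P e.1) (P e.2) (P w) = 0 := by
      simp only [orient] at h1 h2 h3 h4 hw ⊢
      linear_combination (b.1 - a.1) * ((P e.2).1 - (P e.1).1) * hw +
        ((P f.2).1 - (P f.1).1) * ((b.1 - (P w).1) * h1 + ((P w).1 - a.1) * h2) -
        ((P e.2).1 - (P e.1).1) * ((b.1 - (P w).1) * h3 + ((P w).1 - a.1) * h4)
    refine (mul_eq_zero.1 this).resolve_left (mul_ne_zero (sub_ne_zero.2 hx.symm) ?_)
    exact sub_ne_zero.2 hf.ne'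
  have key2 : ∀ w, orient (P f.1) (P f.2) (P w) = 0 → w = e.1 ∨ w = e.2 := by
    intro w hw
    by_contra! hcon
    exact hP e.1 e.2 w (fun h => he.ne (by rw [h])) hcon.1.symm hcon.2.symm (key w hw)
  rcases key2 f.1 (orient_left _ _) with k1 | k1 <;>
    rcases key2 f.2 (orient_right _ _) with k2 | k2
  · rw [k1, k2] at hf; exact hf.false
  · exact hef (Prod.ext k1.symm k2.symm)
  · rw [k1, k2] at hf; exact hf.not_gt he
  · rw [k1, k2] at hf; exact hf.false

theorem isPreconnected_far (R : ℝ) : IsPreconnected {p : ℝ × ℝ | R < |p.1| ∨ R < |p.2|} := by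
  have hc1 : Convex ℝ {p : ℝ × ℝ | R < p.1} := convex_halfSpace_gt (f := Prod.fst) ⟨fun _ _ => rfl, fun _ _ => rfl⟩ R
  have hc2 : Convex ℝ {p : ℝ × ℝ | p.1 < -R} := convex_halfSpace_lt (f := Prod.fst) ⟨fun _ _ => rfl, fun _ _ => rfl⟩ (-R)
  have hc3 : Convex ℝ {p : ℝ × ℝ | R < p.2} := convex_halfSpace_gt (f := Prod.snd) ⟨fun _ _ => rfl, fun _ _ => rfl⟩ R
  have hc4 : Convex ℝ {p : ℝ × ℝ | p.2 < -R} := convex_halfSpace_lt (f := Prod.snd) ⟨fun _ _ => rfl, fun _ _ => rfl⟩ (-R)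
  have h13 := hc1.isPreconnected.union (R + 1, R + 1) (by simp) (by simp) hc3.isPreconnected
  have h132 := h13.union (-R - 1, R + 1) (Or.inr (by simp)) (by simp) hc2.isPreconnected
  have h := h132.union (-R - 1, -R - 1) (Or.inr (by simp)) (by simp) hc4.isPreconnected
  have heq : {p : ℝ × ℝ | R < |p.1| ∨ R < |p.2|} =
      {p : ℝ × ℝ | R < p.1} ∪ {p | R < p.2} ∪ {p | p.1 < -R} ∪ {p | p.2 < -R} := by
    ext p
    simp only [Set.mem_union, Set.mem_ofPred_eq, lt_abs, lt_neg]
    tauto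
  rw [heq]; exact h

theorem convex_orient_nonpos (p q : ℝ × ℝ) : Convex ℝ {y | orient p q y ≤ 0} := by
  intro u hu v hv a b ha hb hab
  simp only [Set.mem_ofPred_eq] at *
  rw [orient_combo p q u v hab]
  nlinarith [mul_nonneg ha (neg_nonneg.2 hu), mul_nonneg hb (neg_nonneg.2 hv)]

theorem not_insideFrame_frame {W : Type*} (P : W → ℝ × ℝ) (o : Fin 3 → W) (i : Fin 3) :
    ¬ InsideFrame P o (P (o i)) := by
  rintro ⟨h1, h2, h3⟩
  fin_cases i
  · exact h1.ne' (orient_left _ _)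
  · exact h2.ne' (orient_left _ _)
  · exact h3.ne' (orient_left _ _)

/-- The pairs of framed points corresponding to a set of pairs of points. -/
def framedPairs (E : Finset (V × V)) : Set ((V ⊕ Fin 3) × (V ⊕ Fin 3)) :=
  Prod.map Sum.inl Sum.inl '' (E : Set (V × V))

theorem exists_cutSystems_of_tethered [Fintype V] {Q : V ⊕ Fin 3 → ℝ × ℝ}
    (hX : Function.Injective fun v : V => (Q (.inl v)).1)
    (hP : ∀ u v w : V, u ≠ v → u ≠ w → v ≠ w →
      orient (Q (.inl u)) (Q (.inl v)) (Q (.inl w)) ≠ 0)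
    (ho : 0 < orient (Q (.inr 0)) (Q (.inr 1)) (Q (.inr 2)))
    (hin : ∀ v : V, InsideFrame Q Sum.inr (Q (.inl v)))
    {K : Set (ℝ × ℝ)} (hK : IsPreconnected K) (hKfar : ∀ R : ℝ, ∃ p ∈ K, R < |p.1| ∨ R < |p.2|)
    {l : ℕ} (hl : 2 * Fintype.card V ≤ 2 ^ l) {H : Finset (V × V)}
    (hH : ∀ e, e ∈ H ↔ (Q (.inl e.1)).1 < (Q (.inl e.2)).1 ∧
      Disjoint (segment ℝ (Q (.inl e.1)) (Q (.inl e.2))) K) :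
    ∃ E : Fin 4 → Finset (V × V),
      (∀ j, ∃ a c, IsCutSystem l (ProperlyCross fun v => Q (.inl v)) a c (E j)) ∧
      (∀ j, E j ⊆ H) ∧
      decodedPairs Q Sum.inr (framedPairs (Finset.univ.biUnion E)) = framedPairs H := by
  set o : Fin 3 → V ⊕ Fin 3 := Sum.inr with ho_def
  set F := outerFace Q (o 0) (framedPairs H) with hF
  have hlt : ∀ e ∈ framedPairs H, (Q e.1).1 < (Q e.2).1 := by
    rintro _ ⟨e, he, rfl⟩
    exact ((hH e).1 he).1
  have hfin : (framedPairs H).Finite := (Finset.finite_toSet H).image _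
  have hins : ∀ e ∈ framedPairs H, ∀ y ∈ segment ℝ (Q e.1) (Q e.2), InsideFrame Q o y := by
    rintro _ ⟨e, he, rfl⟩ y hy
    exact (hin e.1).segment (hin e.2) hy
  obtain ⟨R₀, hR₀⟩ : ∃ R₀ : ℝ, ∀ w, |(Q w).1| ≤ R₀ ∧ |(Q w).2| ≤ R₀ := by
    obtain ⟨R₀, hR₀⟩ := (Set.finite_range fun w => max |(Q w).1| |(Q w).2|).bddAbove
    exact ⟨R₀, fun w => max_le_iff.1 (hR₀ ⟨w, rfl⟩)⟩
  set far := {p : ℝ × ℝ | R₀ < |p.1| ∨ R₀ < |p.2|} with hfar_def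
  have hfard : Disjoint far (segmentUnion Q (framedPairs H)) := by
    rw [disjoint_segmentUnion]
    rintro e - 
    refine Set.disjoint_right.2 fun y hy hyf => ?_
    obtain ⟨a, b, ha, hb, hab, rfl⟩ := hy
    have hbd : ∀ s t : ℝ, |s| ≤ R₀ → |t| ≤ R₀ → |a * s + b * t| ≤ R₀ := by
      intro s t hs ht
      rw [abs_le] at *
      obtain rfl : a = 1 - b := by linarith
      constructor <;> nlinarith
    rcases hyf with h | h
    · exact h.not_ge (hbd _ _ (hR₀ _).1 (hR₀ _).1)
    · exact h.not_ge (hbd _ _ (hR₀ _).2 (hR₀ _).2)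
  set T := {y | orient (Q (o 0)) (Q (o 1)) y ≤ 0} with hT
  have hTd : Disjoint T (segmentUnion Q (framedPairs H)) := by
    rw [disjoint_segmentUnion]
    exact fun e he => Set.disjoint_left.2 fun y hy hye => (hins e he y hye).1.not_ge hy
  have hoT : Q (o 0) ∈ T := (orient_left _ _).le
  have hoF : Q (o 0) ∉ segmentUnion Q (framedPairs H) := Set.disjoint_left.1 hTd hoT
  have hoF' : Q (o 0) ∈ F := mem_connectedComponentIn hoF
  obtain ⟨p₁, hp₁f, hp₁T⟩ : ∃ p₁ ∈ far, p₁ ∈ T := by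
    set d : ℝ × ℝ := ((Q (o 1)).2 - (Q (o 0)).2, (Q (o 0)).1 - (Q (o 1)).1) with hd
    have hd0 : 0 < d.1 ^ 2 + d.2 ^ 2 := by
      have : d.1 ≠ 0 ∨ d.2 ≠ 0 := by
        by_contra! hcon
        simp only [hd] at hcon
        simp only [orient] at ho
        have e1 : (Q (o 1)).2 - (Q (o 0)).2 = 0 := hcon.1
        have e2 : (Q (o 1)).1 - (Q (o 0)).1 = 0 := by linarith [hcon.2]
        have e3 : ((Q (o 1)).1 - (Q (o 0)).1) * ((Q (o 2)).2 - (Q (o 0)).2) -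
          ((Q (o 1)).2 - (Q (o 0)).2) * ((Q (o 2)).1 - (Q (o 0)).1) = 0 := by
          rw [e1, e2]; ring
        exact ho.ne' e3
      rcases this with h | h <;> positivity
    have hgo : ∀ t : ℝ, 0 ≤ t → ((Q (o 0)).1 + t * d.1, (Q (o 0)).2 + t * d.2) ∈ T := by
      intro t ht
      have : orient (Q (o 0)) (Q (o 1)) ((Q (o 0)).1 + t * d.1, (Q (o 0)).2 + t * d.2) =
          -(t * (d.1 ^ 2 + d.2 ^ 2)) := by
        simp only [orient, hd]; ring
      change orient _ _ _ ≤ 0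
      rw [this]; nlinarith [mul_nonneg ht hd0.le]
    have hbig : ∀ q c : ℝ, c ≠ 0 → |q| ≤ R₀ → ∃ t : ℝ, 0 ≤ t ∧ R₀ < |q + t * c| := by
      intro q c hc hq
      have hR : 0 ≤ R₀ := (abs_nonneg q).trans hq
      refine ⟨(2 * R₀ + 1) / |c|, by positivity, ?_⟩
      have h1 : |(2 * R₀ + 1) / |c| * c| = 2 * R₀ + 1 := by
        rw [abs_mul, abs_div, abs_abs, div_mul_cancel₀ _ (abs_ne_zero.2 hc),
          abs_of_pos (by linarith)]
      have h2 := abs_sub_abs_le_abs_sub ((2 * R₀ + 1) / |c| * c) (-q)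
      rw [h1, abs_neg, sub_neg_eq_add] at h2
      have h3 : |(2 * R₀ + 1) / |c| * c + q| = |q + (2 * R₀ + 1) / |c| * c| := by rw [add_comm]
      linarith
    by_cases h1 : d.1 = 0
    · have h2 : d.2 ≠ 0 := by
        rintro h2; rw [h1, h2] at hd0; simp at hd0
      obtain ⟨t, ht, h⟩ := hbig (Q (o 0)).2 d.2 h2 (hR₀ _).2
      exact ⟨_, Or.inr h, hgo t ht⟩
    · obtain ⟨t, ht, h⟩ := hbig (Q (o 0)).1 d.1 h1 (hR₀ _).1
      exact ⟨_, Or.inl h, hgo t ht⟩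
  have hp₁F : p₁ ∈ F := mem_outerFace_of_isPreconnected
    (convex_orient_nonpos _ _).isPreconnected hTd hoT hoF' hp₁T
  have hfarF : ∀ p : ℝ × ℝ, R₀ < |p.1| ∨ R₀ < |p.2| → p ∈ F := fun p hp =>
    mem_outerFace_of_isPreconnected (isPreconnected_far R₀) hfard hp₁f hp₁F hp
  have hKF : K ⊆ F := by
    obtain ⟨p, hp, hpf⟩ := hKfar R₀
    intro q hq
    refine mem_outerFace_of_isPreconnected hK ?_ hp (hfarF p hpf) hq
    rw [disjoint_segmentUnion]
    rintro _ ⟨e, he, rfl⟩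
    exact ((hH e).1 he).2.symm
  have hdisj : ∀ e ∈ H, Disjoint (segment ℝ (Q (.inl e.1)) (Q (.inl e.2))) F := fun e he =>
    Set.disjoint_left.2 fun y hy hyF => connectedComponentIn_subset _ _ hyF
      (Set.mem_biUnion (Set.mem_image_of_mem (Prod.map Sum.inl Sum.inl) he) hy)
  have hseg : ∀ p ∈ F, ∀ q, (∀ e ∈ H, Disjoint (segment ℝ p q)
      (segment ℝ (Q (.inl e.1)) (Q (.inl e.2)))) → q ∈ F := by
    intro p hp q h
    refine mem_outerFace_of_isPreconnected (convex_segment (𝕜 := ℝ) p q).isPreconnected ?_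
      (left_mem_segment ℝ p q) hp (right_mem_segment ℝ p q)
    rw [disjoint_segmentUnion]
    rintro _ ⟨e, he, rfl⟩
    exact h e he
  obtain ⟨E₁, E₂, i1, i2, c1, c2, v1⟩ := exists_cutSystems_of_visible_below
    (P := fun v => Q (.inl v)) hX hP (fun e he => ((hH e).1 he).1) hdisj
    isPreconnected_connectedComponentIn hseg ⟨R₀, hfarF⟩ hl
  obtain ⟨E₃, E₄, i3, i4, c3, c4, v2⟩ := exists_cutSystems_of_visible_above
    (P := fun v => Q (.inl v)) hX hP (fun e he => ((hH e).1 he).1) hdisj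
    isPreconnected_connectedComponentIn hseg ⟨R₀, hfarF⟩ hl
  set E : Fin 4 → Finset (V × V) := ![E₁, E₂, E₃, E₄] with hE
  have hsub : ∀ j, E j ⊆ H := by
    intro j; fin_cases j
    exacts [i1, i2, i3, i4]
  refine ⟨E, fun j => ?_, hsub, ?_⟩
  · fin_cases j
    exacts [c1, c2, c3, c4]
  have hEH : framedPairs (Finset.univ.biUnion E) ⊆ framedPairs H :=
    Set.image_mono fun e he => by
      obtain ⟨j, -, hj⟩ := Finset.mem_biUnion.1 he
      exact hsub j hj
  have hmemE : ∀ j e, e ∈ E j → Prod.map Sum.inl Sum.inl e ∈ framedPairs (Finset.univ.biUnion E) :=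
    fun j e he => Set.mem_image_of_mem _ (Finset.mem_biUnion.2 ⟨j, Finset.mem_univ j, he⟩)
  have hvis := disjoint_outerFace_of_visible_mem (o := o 0) hfin hlt (by
    rintro _ ⟨e, he, rfl⟩ _ ⟨f, hf, rfl⟩ hef
    exact subsingleton_segment_inter (P := fun v => Q (.inl v)) hP ((hH e).1 he).1
      ((hH f).1 hf).1 (fun h => hef (by rw [h]))) hEH hoF (by
    rintro _ ⟨g, hg, rfl⟩ ⟨z, hz, hz1, hz2, hz3⟩
    rcases hz3 with ⟨hz3, hz4⟩ | ⟨hz3, hz4⟩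
    · have := v1 g hg ⟨z, hz, hz1, hz2, hz3, fun f hf hfg y hy =>
        hz4 _ (Set.mem_image_of_mem _ hf) (fun h => hfg (by
          have := (Function.Injective.prodMap Sum.inl_injective Sum.inl_injective) h
          exact this)) y hy⟩
      rcases Finset.mem_union.1 this with h | h
      · exact hmemE 0 g h
      · exact hmemE 1 g h
    · have := v2 g hg ⟨z, hz, hz1, hz2, hz3, fun f hf hfg y hy =>
        hz4 _ (Set.mem_image_of_mem _ hf) (fun h => hfg (by
          have := (Function.Injective.prodMap Sum.inl_injective Sum.inl_injective) h
          exact this)) y hy⟩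
      rcases Finset.mem_union.1 this with h | h
      · exact hmemE 2 g h
      · exact hmemE 3 g h)
  ext e
  constructor
  · rintro ⟨h1, h2, h3, h4⟩
    obtain ⟨u | i, v | j⟩ := e
    · refine ⟨(u, v), (hH _).2 ⟨h1, ?_⟩, rfl⟩
      exact h4.mono_right (hKF.trans (outerFace_mono hEH))
    · exact absurd h3 (not_insideFrame_frame Q o j)
    · exact absurd h2 (not_insideFrame_frame Q o i)
    · exact absurd h2 (not_insideFrame_frame Q o i)
  · intro he
    refine ⟨hlt e he, ?_, ?_, hvis e he⟩
    · obtain ⟨e, -, rfl⟩ := he; exact hin _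
    · obtain ⟨e, -, rfl⟩ := he; exact hin _

end Tethered

section Reduction

theorem SimplePolygon.isPreconnected_boundary (P : SimplePolygon) :
    IsPreconnected P.boundary := by
  have : NeZero P.k := ⟨by have := P.three_le; omega⟩
  have hstep : ∀ i : ZMod P.k, P.verts (i + 1) ∈ segment ℝ (P.verts i) (P.verts (i + 1)) :=
    fun i => right_mem_segment ℝ _ _
  have key : ∀ m : ℕ, IsPreconnected
      (⋃ i ∈ Finset.range (m + 1), segment ℝ (P.verts (i : ℕ)) (P.verts ((i : ℕ) + 1))) := by
    intro m
    induction m with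
    | zero => simpa using (convex_segment (𝕜 := ℝ) (P.verts 0) (P.verts (0 + 1))).isPreconnected
    | succ m ih =>
      rw [Finset.range_add_one, Finset.set_biUnion_insert]
      refine IsPreconnected.union (P.verts ((m + 1 : ℕ) : ZMod P.k)) (left_mem_segment ℝ _ _) ?_
        (convex_segment (𝕜 := ℝ) _ _).isPreconnected ih
      refine Set.mem_biUnion (Finset.mem_coe.2 (Finset.self_mem_range_succ m)) ?_
      push_cast
      exact right_mem_segment ℝ _ _
  have : P.boundary = ⋃ i ∈ Finset.range (P.k - 1 + 1),
      segment ℝ (P.verts (i : ℕ)) (P.verts ((i : ℕ) + 1)) := by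
    ext x
    simp only [SimplePolygon.boundary, Set.mem_iUnion, exists_prop, Finset.mem_range]
    constructor
    · rintro ⟨i, hi⟩
      refine ⟨i.val, ?_, ?_⟩
      · have := ZMod.val_lt i; omega
      · rwa [ZMod.natCast_zmod_val]
    · rintro ⟨i, -, hi⟩
      exact ⟨i, hi⟩
  rw [this]; exact key _

theorem SimplePolygon.boundary_nonempty (P : SimplePolygon) : P.boundary.Nonempty :=
  ⟨P.verts 0, Set.mem_iUnion.2 ⟨0, left_mem_segment ℝ _ _⟩⟩

theorem SimplePolygon.disjoint_toSet_of_disjoint_boundary (P : SimplePolygon) {u v : ℝ × ℝ}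
    (h : Disjoint (segment ℝ u v) P.boundary) (hu : u ∉ P.toSet) :
    Disjoint (segment ℝ u v) P.toSet := by
  refine Set.disjoint_left.2 fun y hy hyP => ?_
  rcases hyP with hyP | ⟨-, hb⟩
  · exact Set.disjoint_left.1 h hy hyP
  · refine hu (Or.inr ⟨Set.disjoint_left.1 h (left_mem_segment ℝ u v), ?_⟩)
    have := (convex_segment (𝕜 := ℝ) u v).isPreconnected.subset_connectedComponentIn
      hy h.subset_compl_right (left_mem_segment ℝ u v)
    rwa [← connectedComponentIn_eq this]

theorem ObstacleRep.adj_iff {V : Type*} {G : SimpleGraph V} (R : ObstacleRep G) (u v : V) :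
    G.Adj u v ↔ u ≠ v ∧ (∀ i, R.pos u ∉ (R.obs i).toSet) ∧ (∀ i, R.pos v ∉ (R.obs i).toSet) ∧
      ∀ i, Disjoint (segment ℝ (R.pos u) (R.pos v)) (R.obs i).boundary := by
  constructor
  · intro h
    have hc := R.edges_clear u v h
    exact ⟨h.ne, fun i => Set.disjoint_left.1 (hc i) (left_mem_segment ℝ _ _),
      fun i => Set.disjoint_left.1 (hc i) (right_mem_segment ℝ _ _),
      fun i => (hc i).mono_right Set.subset_union_left⟩
  · rintro ⟨huv, hu, -, hb⟩
    by_contra hadj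
    obtain ⟨i, y, hy, hyi⟩ := R.nonedges_blocked u v huv hadj
    exact Set.disjoint_left.1
      ((R.obs i).disjoint_toSet_of_disjoint_boundary (hb i) (hu i)) hy hyi

theorem collinear_of_orient_eq_zero {p q r : ℝ × ℝ} (hpq : p ≠ q) (h : orient p q r = 0) :
    Collinear ℝ ({p, q, r} : Set (ℝ × ℝ)) := by
  rw [collinear_iff_of_mem (p₀ := p) (by simp)]
  refine ⟨q - p, ?_⟩
  simp only [Set.mem_insert_iff, Set.mem_singleton_iff, forall_eq_or_imp, forall_eq]
  refine ⟨⟨0, by simp⟩, ⟨1, by simp⟩, ?_⟩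
  simp only [orient] at h
  by_cases h1 : q.1 - p.1 = 0
  · have h2 : q.2 - p.2 ≠ 0 := fun h2 =>
      hpq (Prod.ext (by linarith) (by linarith))
    refine ⟨(r.2 - p.2) / (q.2 - p.2), ?_⟩
    ext
    · have : (q.2 - p.2) * (r.1 - p.1) = 0 := by rw [h1] at h; linarith
      have := (mul_eq_zero.1 this).resolve_left h2
      simp [h1]; linarith
    · simp only [vadd_eq_add, Prod.snd_add, Prod.smul_snd, Prod.snd_sub, smul_eq_mul]
      field_simp; ring
  · refine ⟨(r.1 - p.1) / (q.1 - p.1), ?_⟩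
    ext
    · simp only [vadd_eq_add, Prod.fst_add, Prod.smul_fst, Prod.fst_sub, smul_eq_mul]
      field_simp; ring
    · simp only [vadd_eq_add, Prod.snd_add, Prod.smul_snd, Prod.snd_sub, smul_eq_mul]
      field_simp; linear_combination h

/-- The shear of the plane with slope `ε`. -/
def shear (ε : ℝ) (p : ℝ × ℝ) : ℝ × ℝ := (p.1 + ε * p.2, p.2)

theorem shear_shear (ε : ℝ) (p : ℝ × ℝ) : shear (-ε) (shear ε p) = p := by
  ext <;> simp [shear]

theorem orient_shear (ε : ℝ) (p q y : ℝ × ℝ) :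
    orient (shear ε p) (shear ε q) (shear ε y) = orient p q y := by
  simp only [orient, shear]; ring

theorem shear_mem_segment (ε : ℝ) {p q y : ℝ × ℝ} (h : y ∈ segment ℝ p q) :
    shear ε y ∈ segment ℝ (shear ε p) (shear ε q) := by
  obtain ⟨a, b, ha, hb, hab, rfl⟩ := h
  refine ⟨a, b, ha, hb, hab, ?_⟩
  ext <;> simp [shear]
  ring

theorem exists_shear_injective {V : Type*} [Finite V] {p : V → ℝ × ℝ}
    (hp : Function.Injective p) : ∃ ε, Function.Injective fun v => (shear ε (p v)).1 := by
  have hfin : (⋃ w : V × V, {ε : ℝ | w.1 ≠ w.2 ∧ (shear ε (p w.1)).1 = (shear ε (p w.2)).1}).Finite := by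
    refine Set.finite_iUnion fun w => Set.Subsingleton.finite ?_
    rintro a ⟨hw, ha⟩ b ⟨-, hb⟩
    simp only [shear] at ha hb
    by_contra hab
    have h2 : (p w.1).2 = (p w.2).2 := by
      have : (a - b) * ((p w.1).2 - (p w.2).2) = 0 := by linear_combination ha - hb
      exact sub_eq_zero.1 ((mul_eq_zero.1 this).resolve_left (sub_ne_zero.2 hab))
    exact hw (hp (Prod.ext (by rw [h2] at ha; linarith) h2))
  obtain ⟨ε, hε⟩ := hfin.infinite_compl.nonempty
  refine ⟨ε, fun u v huv => ?_⟩
  by_contra hne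
  exact hε (Set.mem_iUnion.2 ⟨(u, v), hne, huv⟩)

/-- A placement with distinct abscissas in general position, blocked by `h` connected sets. -/
theorem ObstacleRep.exists_blocking {V : Type*} [Finite V] {G : SimpleGraph V}
    (R : ObstacleRep G) {h : ℕ} (hR : R.numObs ≤ h) :
    ∃ (p : V → ℝ × ℝ) (U : Set V) (C : Fin h → Set (ℝ × ℝ)),
      (Function.Injective fun v => (p v).1) ∧
      (∀ u v w, u ≠ v → u ≠ w → v ≠ w → orient (p u) (p v) (p w) ≠ 0) ∧
      (∀ i, IsPreconnected (C i)) ∧ (∀ i, (C i).Nonempty) ∧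
      ∀ u v, G.Adj u v ↔ u ≠ v ∧ u ∉ U ∧ v ∉ U ∧ ∀ i, Disjoint (segment ℝ (p u) (p v)) (C i) := by
  obtain ⟨ε, hε⟩ := exists_shear_injective R.posInj
  obtain ⟨M, hM⟩ := (Set.finite_range fun v => (R.pos v).1).bddAbove
  have hM' : ∀ u v, Disjoint (segment ℝ (R.pos u) (R.pos v)) {((M + 1, 0) : ℝ × ℝ)} := by
    intro u v
    rw [Set.disjoint_singleton_right]
    intro hmem
    have hc : Convex ℝ {p : ℝ × ℝ | p.1 ≤ M} :=
      convex_halfSpace_le (f := Prod.fst) ⟨fun _ _ => rfl, fun _ _ => rfl⟩ M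
    have : (M + 1 : ℝ) ≤ M := hc.segment_subset (hM ⟨u, rfl⟩) (hM ⟨v, rfl⟩) hmem
    linarith
  set D : Fin h → Set (ℝ × ℝ) := fun i =>
    if hi : (i : ℕ) < R.numObs then (R.obs ⟨i, hi⟩).boundary else {(M + 1, 0)} with hD
  have hDc : ∀ i, IsPreconnected (D i) := by
    intro i
    simp only [hD]
    split_ifs
    · exact SimplePolygon.isPreconnected_boundary _
    · exact isPreconnected_singleton
  have hDn : ∀ i, (D i).Nonempty := by
    intro i
    simp only [hD]
    split_ifs
    · exact SimplePolygon.boundary_nonempty _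
    · exact Set.singleton_nonempty _
  have hDd : ∀ u v, (∀ i, Disjoint (segment ℝ (R.pos u) (R.pos v)) (R.obs i).boundary) ↔
      ∀ i, Disjoint (segment ℝ (R.pos u) (R.pos v)) (D i) := by
    intro u v
    constructor
    · intro hd i
      simp only [hD]
      split_ifs
      · exact hd _
      · exact hM' u v
    · intro hd i
      have := hd ⟨i, i.2.trans_le hR⟩
      simpa only [hD, i.2, dif_pos] using this
  refine ⟨fun v => shear ε (R.pos v), {v | ∃ i, R.pos v ∈ (R.obs i).toSet},
    fun i => shear ε '' D i, hε, ?_, fun i => (hDc i).image _ (by unfold shear; fun_prop),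
    fun i => (hDn i).image _, ?_⟩
  · intro u v w huv huw hvw h0
    rw [orient_shear] at h0
    exact R.genPos u v w huv huw hvw
      (collinear_of_orient_eq_zero (fun h => huv (R.posInj h)) h0)
  · intro u v
    rw [R.adj_iff, hDd]
    simp only [Set.mem_ofPred_eq, not_exists]
    have : ∀ i, Disjoint (segment ℝ (R.pos u) (R.pos v)) (D i) ↔
        Disjoint (segment ℝ (shear ε (R.pos u)) (shear ε (R.pos v))) (shear ε '' D i) := by
      intro i
      constructor
      · intro hd
        refine Set.disjoint_right.2 ?_
        rintro _ ⟨y, hy, rfl⟩ hy'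
        have := shear_mem_segment (-ε) hy'
        simp only [shear_shear] at this
        exact Set.disjoint_left.1 hd this hy
      · intro hd
        exact Set.disjoint_left.2 fun y hy hyD => Set.disjoint_left.1 hd
          (shear_mem_segment ε hy) (Set.mem_image_of_mem _ hyD)
    simp only [this]

/-- The vertical ray from `c`, upwards or downwards. -/
def verticalRay (c : ℝ × ℝ) (b : Bool) : Set (ℝ × ℝ) :=
  {p | p.1 = c.1 ∧ if b then c.2 ≤ p.2 else p.2 ≤ c.2}

theorem isPreconnected_verticalRay (c : ℝ × ℝ) (b : Bool) : IsPreconnected (verticalRay c b) := by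
  have h1 : Convex ℝ {p : ℝ × ℝ | p.1 = c.1} :=
    convex_hyperplane (f := Prod.fst) ⟨fun _ _ => rfl, fun _ _ => rfl⟩ _
  cases b
  · have h2 : Convex ℝ {p : ℝ × ℝ | p.2 ≤ c.2} :=
      convex_halfSpace_le (f := Prod.snd) ⟨fun _ _ => rfl, fun _ _ => rfl⟩ _
    exact (h1.inter h2).isPreconnected
  · have h2 : Convex ℝ {p : ℝ × ℝ | c.2 ≤ p.2} :=
      convex_halfSpace_ge (f := Prod.snd) ⟨fun _ _ => rfl, fun _ _ => rfl⟩ _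
    exact (h1.inter h2).isPreconnected

theorem exists_mem_verticalRay_far (c : ℝ × ℝ) (b : Bool) (R : ℝ) :
    ∃ p ∈ verticalRay c b, R < |p.1| ∨ R < |p.2| := by
  cases b
  · refine ⟨(c.1, -(|c.2| + |R| + 1)), ⟨rfl, ?_⟩, Or.inr ?_⟩
    · simp; linarith [neg_abs_le c.2, abs_nonneg R]
    · rw [abs_neg, abs_of_nonneg (by positivity)]
      linarith [le_abs_self R, abs_nonneg c.2]
  · refine ⟨(c.1, |c.2| + |R| + 1), ⟨rfl, ?_⟩, Or.inr ?_⟩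
    · simp; linarith [le_abs_self c.2, abs_nonneg R]
    · rw [abs_of_nonneg (by positivity)]
      linarith [le_abs_self R, abs_nonneg c.2]

theorem disjoint_iff_exists_disjoint_ray {p q c : ℝ × ℝ} (hpq : p.1 < q.1) {C : Set (ℝ × ℝ)}
    (hc : c ∈ C) : Disjoint (segment ℝ p q) C ↔
      ∃ b, Disjoint (segment ℝ p q) (C ∪ verticalRay c b) := by
  constructor
  · intro hd
    by_contra! hcon
    have h1 := hcon true
    have h2 := hcon false
    rw [Set.disjoint_union_right, not_and] at h1 h2
    obtain ⟨y, hy, hy1, hy2⟩ := Set.not_disjoint_iff.1 (h1 hd)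
    obtain ⟨z, hz, hz1, hz2⟩ := Set.not_disjoint_iff.1 (h2 hd)
    simp only [if_true] at hy2
    simp only [Bool.false_eq_true, if_false] at hz2
    have e1 := orient_eq_zero_of_mem_segment hy
    have e2 := orient_eq_zero_of_mem_segment hz
    simp only [orient, hy1] at e1
    simp only [orient, hz1] at e2
    have e3 : (q.1 - p.1) * (y.2 - z.2) = 0 := by linear_combination e1 - e2
    have e4 := (mul_eq_zero.1 e3).resolve_left (sub_ne_zero.2 hpq.ne')
    have : y = c := Prod.ext hy1 (by linarith)
    exact Set.disjoint_left.1 hd hy (this ▸ hc)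
  · rintro ⟨b, hb⟩
    exact hb.mono_right Set.subset_union_left

end Reduction

section Encoding

variable {V : Type*}

/-- A positively oriented triangle with points in general position inside it. -/
structure IsFramed (Q : V ⊕ Fin 3 → ℝ × ℝ) : Prop where
  generic : ∀ u v w : V, u ≠ v → u ≠ w → v ≠ w →
    orient (Q (.inl u)) (Q (.inl v)) (Q (.inl w)) ≠ 0
  frame_pos : 0 < orient (Q (.inr 0)) (Q (.inr 1)) (Q (.inr 2))
  inside : ∀ v : V, InsideFrame Q Sum.inr (Q (.inl v))

/-- The cut systems for the crossing relation of a framed configuration. -/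
def cutSystems (Q : V ⊕ Fin 3 → ℝ × ℝ) (l : ℕ) : Set (Finset (V × V)) :=
  {E | ∃ a c, IsCutSystem l (ProperlyCross fun v => Q (.inl v)) a c E}

/-- The graph encoded by a set `U` of isolated vertices and families of pairs. -/
def decodedGraph {ι : Type*} (Q : V ⊕ Fin 3 → ℝ × ℝ) (U : Finset V)
    (E : (ι × Bool) × Fin 4 → Finset (V × V)) : SimpleGraph V :=
  SimpleGraph.fromRel fun u v => u ∉ U ∧ v ∉ U ∧ ∀ i, ∃ b,
    (Sum.inl u, Sum.inl v) ∈ decodedPairs Q Sum.inr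
      (framedPairs (Finset.univ.biUnion fun j => E ((i, b), j)))

theorem exists_frame [Finite V] (p : V → ℝ × ℝ) : ∃ o : Fin 3 → ℝ × ℝ,
    0 < orient (o 0) (o 1) (o 2) ∧ ∀ v, InsideFrame (Sum.elim p o) Sum.inr (p v) := by
  obtain ⟨M₀, hM₀⟩ := (Set.finite_range fun v => max |(p v).1| |(p v).2|).bddAbove
  set M := |M₀| + 1 with hM
  have hM1 : 0 < M := by positivity
  have hp : ∀ v, |(p v).1| ≤ M ∧ |(p v).2| ≤ M := fun v => by
    have := max_le_iff.1 (hM₀ ⟨v, rfl⟩)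
    have h2 := le_abs_self M₀
    exact ⟨by linarith, by linarith⟩
  refine ⟨![(-10 * M, -2 * M), (10 * M, -2 * M), (0, 10 * M)], ?_, fun v => ?_⟩
  · simp [orient]; nlinarith
  · obtain ⟨h1, h2⟩ := hp v
    rw [abs_le] at h1 h2
    refine ⟨?_, ?_, ?_⟩
    · simp [orient]; nlinarith
    · simp [orient]; nlinarith
    · simp [orient]; nlinarith

theorem ObstacleRep.exists_code [Fintype V] {G : SimpleGraph V} (R : ObstacleRep G) {h : ℕ}
    (hR : R.numObs ≤ h) {l : ℕ} (hl : 2 * Fintype.card V ≤ 2 ^ l) :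
    ∃ (Q : V ⊕ Fin 3 → ℝ × ℝ) (U : Finset V) (E : (Fin h × Bool) × Fin 4 → Finset (V × V)),
      IsFramed Q ∧ (∀ s, E s ∈ cutSystems Q l) ∧
      (∀ s, ∀ e ∈ E s, (Q (.inl e.1)).1 < (Q (.inl e.2)).1) ∧ G = decodedGraph Q U E := by
  obtain ⟨p, U, C, hX, hP, hC, hCn, hG⟩ := R.exists_blocking hR
  obtain ⟨o, ho, hin⟩ := exists_frame p
  choose c hc using hCn
  have hlt : ∀ s : Fin h × Bool, ∃ E : Fin 4 → Finset (V × V),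
      (∀ j, E j ∈ cutSystems (Sum.elim p o) l) ∧
      (∀ j, ∀ e ∈ E j, (p e.1).1 < (p e.2).1) ∧
      ∀ u v, (Sum.inl u, Sum.inl v) ∈ decodedPairs (Sum.elim p o) Sum.inr
        (framedPairs (Finset.univ.biUnion E)) ↔ (p u).1 < (p v).1 ∧
          Disjoint (segment ℝ (p u) (p v)) (C s.1 ∪ verticalRay (c s.1) s.2) := by
    intro s
    obtain ⟨E, h1, h2, h3⟩ := exists_cutSystems_of_tethered (Q := Sum.elim p o) hX hP ho hin
      (K := C s.1 ∪ verticalRay (c s.1) s.2)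
      ((hC s.1).union (c s.1) (hc s.1) ⟨rfl, by split_ifs <;> exact le_rfl⟩
        (isPreconnected_verticalRay _ _))
      (fun R => by
        obtain ⟨q, hq, hq'⟩ := exists_mem_verticalRay_far (c s.1) s.2 R
        exact ⟨q, Or.inr hq, hq'⟩) hl
      (H := Finset.univ.filter fun e => (p e.1).1 < (p e.2).1 ∧
        Disjoint (segment ℝ (p e.1) (p e.2)) (C s.1 ∪ verticalRay (c s.1) s.2))
      (fun e => by simp)
    refine ⟨E, h1, fun j e he => (Finset.mem_filter.1 (h2 j he)).2.1, fun u v => ?_⟩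
    rw [h3]
    simp only [framedPairs, Set.mem_image, Finset.mem_coe, Finset.mem_filter, Finset.mem_univ,
      true_and, Prod.map_apply', Prod.mk.injEq, Sum.inl.injEq]
    constructor
    · rintro ⟨e, he, rfl, rfl⟩; exact he
    · intro he; exact ⟨(u, v), he, rfl, rfl⟩
  choose E hE1 hE2 hE3 using hlt
  refine ⟨Sum.elim p o, U.toFinset, fun s => E s.1 s.2, ⟨hP, ho, hin⟩, fun s => hE1 _ _,
    fun s => hE2 _ _, ?_⟩
  ext u v
  have hdec : ∀ u v, (u ∉ U.toFinset ∧ v ∉ U.toFinset ∧ ∀ i, ∃ b,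
      (Sum.inl u, Sum.inl v) ∈ decodedPairs (Sum.elim p o) Sum.inr
        (framedPairs (Finset.univ.biUnion (E (i, b))))) ↔
      u ∉ U ∧ v ∉ U ∧ ∀ i : Fin h, (p u).1 < (p v).1 ∧ Disjoint (segment ℝ (p u) (p v)) (C i) := by
    intro u v
    simp only [Set.mem_toFinset]
    refine and_congr_right fun _ => and_congr_right fun _ => forall_congr' fun i => ?_
    simp only [hE3]
    rw [exists_and_left]
    exact and_congr_right fun huv => (disjoint_iff_exists_disjoint_ray huv (hc i)).symm
  rw [hG, decodedGraph, SimpleGraph.fromRel_adj]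
  refine and_congr_right fun huv => ?_
  rw [hdec, hdec, segment_symm ℝ (p v) (p u)]
  constructor
  · rintro ⟨hu, hv, hd⟩
    rcases lt_trichotomy (p u).1 (p v).1 with hlt | heq | hlt
    · exact Or.inl ⟨hu, hv, fun i => ⟨hlt, hd i⟩⟩
    · exact absurd (hX heq) huv
    · exact Or.inr ⟨hv, hu, fun i => ⟨hlt, hd i⟩⟩
  · rintro (⟨hu, hv, hd⟩ | ⟨hv, hu, hd⟩)
    · exact ⟨hu, hv, fun i => (hd i).2⟩
    · exact ⟨hu, hv, fun i => (hd i).2⟩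

theorem cutSystems_subset_of_configType_eq {Q Q' : V ⊕ Fin 3 → ℝ × ℝ}
    (h : configType Q' = configType Q) (l : ℕ) : cutSystems Q l ⊆ cutSystems Q' l := by
  rintro E ⟨a, c, hE⟩
  exact ⟨a, c, hE.mono_rel fun e f hef =>
    ProperlyCross.of_configType_eq h (e := Prod.map Sum.inl Sum.inl e)
      (f := Prod.map Sum.inl Sum.inl f) hef⟩

theorem decodedGraph_eq_of_configType_eq [Finite V] {ι : Type*} {Q Q' : V ⊕ Fin 3 → ℝ × ℝ}
    (h : configType Q' = configType Q) (hQ : IsFramed Q) (U : Finset V)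
    {E : (ι × Bool) × Fin 4 → Finset (V × V)}
    (hE : ∀ s, ∀ e ∈ E s, (Q (.inl e.1)).1 < (Q (.inl e.2)).1) :
    decodedGraph Q' U E = decodedGraph Q U E := by
  have : ∀ i b, decodedPairs Q' Sum.inr
      (framedPairs (Finset.univ.biUnion fun j => E ((i, b), j))) =
      decodedPairs Q Sum.inr (framedPairs (Finset.univ.biUnion fun j => E ((i, b), j))) := by
    intro i b
    refine decodedPairs_eq_of_configType_eq h hQ.frame_pos ?_ ?_
    · rintro _ ⟨e, he, rfl⟩
      obtain ⟨j, -, hj⟩ := Finset.mem_biUnion.1 he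
      exact hE _ e hj
    · rintro _ ⟨e, -, rfl⟩
      exact ⟨hQ.inside _, hQ.inside _⟩
  simp only [decodedGraph, this]

theorem ncard_cutSystems_le [Fintype V] {Q : V ⊕ Fin 3 → ℝ × ℝ} (hQ : IsFramed Q) (l : ℕ) :
    ((cutSystems Q l).ncard : ℝ) ≤ ((2 ^ l) ^ Fintype.card V *
      (4 ^ (2 * (Fintype.card V * l)) * Real.exp (l * 2 ^ l))) ^ 2 :=
  ncard_cutSystem_le (fun _ _ h => ⟨h.ne.1, h.ne.2.1⟩)
    fun M N hM hN h1 h2 => eq_of_pairwise_properlyCross hQ.generic M N hM hN h1 h2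

theorem ncard_obstacleRep_le [Fintype V] (h l : ℕ) (hl : 2 * Fintype.card V ≤ 2 ^ l) :
    (Nat.card {G : SimpleGraph V // ∃ R : ObstacleRep G, R.numObs ≤ h} : ℝ) ≤
      (Set.range (configType : (V ⊕ Fin 3 → ℝ × ℝ) → _)).ncard * (2 ^ Fintype.card V *
      (((2 ^ l) ^ Fintype.card V *
        (4 ^ (2 * (Fintype.card V * l)) * Real.exp (l * 2 ^ l))) ^ 2) ^ (h * 2 * 4)) := by
  set B : ℝ := ((2 ^ l) ^ Fintype.card V *
    (4 ^ (2 * (Fintype.card V * l)) * Real.exp (l * 2 ^ l))) ^ 2 with hB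
  set T : Set (TypeIndex (V ⊕ Fin 3) → SignType) := configType '' {Q | IsFramed Q} with hT
  have hrep : ∀ t : T, ∃ Q : V ⊕ Fin 3 → ℝ × ℝ, IsFramed Q ∧ configType Q = t.1 := fun t => t.2
  choose Q hQ1 hQ2 using hrep
  have : Fintype T := Fintype.ofFinite T
  set S : T → Finset (SimpleGraph V) := fun t =>
    (Finset.univ ×ˢ Fintype.piFinset fun _ : (Fin h × Bool) × Fin 4 =>
      (cutSystems (Q t) l).toFinset).image fun x => decodedGraph (Q t) x.1 x.2 with hS
  have hcover : {G : SimpleGraph V | ∃ R : ObstacleRep G, R.numObs ≤ h} ⊆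
      (Finset.univ.biUnion S : Finset (SimpleGraph V)) := by
    rintro G ⟨R, hR⟩
    obtain ⟨Q', U, E, hQ', hE1, hE2, rfl⟩ := R.exists_code hR hl
    have ht : configType (Q ⟨configType Q', Set.mem_image_of_mem _ hQ'⟩) = configType Q' := hQ2 _
    refine Finset.mem_coe.2 (Finset.mem_biUnion.2 ⟨⟨configType Q', Set.mem_image_of_mem _ hQ'⟩,
      Finset.mem_univ _, Finset.mem_image.2 ⟨(U, E), ?_, ?_⟩⟩)
    · refine Finset.mem_product.2 ⟨Finset.mem_univ _, Fintype.mem_piFinset.2 fun s => ?_⟩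
      exact Set.mem_toFinset.2 (cutSystems_subset_of_configType_eq ht l (hE1 s))
    · exact decodedGraph_eq_of_configType_eq ht hQ' U hE2
  have hcard : ∀ t, ((S t).card : ℝ) ≤ 2 ^ Fintype.card V * B ^ (h * 2 * 4) := by
    intro t
    have h1 : (S t).card ≤ 2 ^ Fintype.card V * (cutSystems (Q t) l).ncard ^ (h * 2 * 4) := by
      refine Finset.card_image_le.trans ?_
      rw [Finset.card_product, Fintype.card_piFinset, Finset.prod_const, Finset.card_univ,
        Fintype.card_finset, Set.ncard_eq_toFinset_card']
      simp
    calc ((S t).card : ℝ) ≤ 2 ^ Fintype.card V *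
          ((cutSystems (Q t) l).ncard : ℝ) ^ (h * 2 * 4) := by exact_mod_cast h1
      _ ≤ _ := by
          gcongr
          exact ncard_cutSystems_le (hQ1 t) l
  have h1 : Nat.card {G : SimpleGraph V // ∃ R : ObstacleRep G, R.numObs ≤ h} ≤
      ∑ t : T, (S t).card := by
    refine le_trans ?_ Finset.card_biUnion_le
    rw [← Set.ncard_coe_finset]
    exact Set.ncard_le_ncard hcover (Finset.finite_toSet _)
  calc (Nat.card {G : SimpleGraph V // ∃ R : ObstacleRep G, R.numObs ≤ h} : ℝ)
      ≤ ∑ t : T, ((S t).card : ℝ) := by exact_mod_cast h1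
    _ ≤ ∑ _t : T, 2 ^ Fintype.card V * B ^ (h * 2 * 4) := Finset.sum_le_sum fun t _ => hcard t
    _ = (T.ncard : ℝ) * (2 ^ Fintype.card V * B ^ (h * 2 * 4)) := by
        rw [Finset.sum_const, nsmul_eq_mul, Finset.card_univ, ← Nat.card_eq_fintype_card]
        rfl
    _ ≤ _ := by
        have hTr : T.ncard ≤ (Set.range (configType : (V ⊕ Fin 3 → ℝ × ℝ) → _)).ncard :=
          Set.ncard_le_ncard (Set.image_subset_range _ _) (Set.toFinite _)
        have : 0 ≤ B := by positivity
        gcongr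

end Encoding

section Asymptotics

theorem card_typeIndex (W : Type*) [Fintype W] : Fintype.card (TypeIndex W) =
    Fintype.card W ^ 4 + (Fintype.card W ^ 6 + (Fintype.card W ^ 3 + Fintype.card W ^ 2)) := by
  simp only [TypeIndex, Fintype.card_sum, Fintype.card_prod]
  ring

theorem ncard_configType_le_pow {n : ℕ} (hn : 2 ≤ n) :
    (Set.range (configType : (Fin n ⊕ Fin 3 → ℝ × ℝ) → _)).ncard ≤ n ^ (140 * n) := by
  refine ncard_configType_le.trans ?_
  have hW : Fintype.card (Fin n ⊕ Fin 3) = n + 3 := by simp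
  rw [card_typeIndex, Fintype.card_prod, hW, Fintype.card_bool]
  have h1 : n + 3 ≤ n ^ 3 := by
    have : 4 * n ≤ n ^ 3 := by nlinarith [Nat.mul_le_mul hn hn]
    omega
  have hbase : (n + 3) * 2 * (2 + ((n + 3) ^ 4 + ((n + 3) ^ 6 + ((n + 3) ^ 3 + (n + 3) ^ 2))) *
      (2 * 4)) + 1 ≤ n ^ 28 := by
    have e4 : (n + 3) ^ 4 ≤ (n + 3) ^ 6 := Nat.pow_le_pow_right (by omega) (by omega)
    have e3 : (n + 3) ^ 3 ≤ (n + 3) ^ 6 := Nat.pow_le_pow_right (by omega) (by omega)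
    have e2 : (n + 3) ^ 2 ≤ (n + 3) ^ 6 := Nat.pow_le_pow_right (by omega) (by omega)
    have e0 : 1 ≤ (n + 3) ^ 6 := Nat.one_le_pow _ _ (by omega)
    calc _ ≤ (n + 3) * 2 * (34 * (n + 3) ^ 6) + 1 := by gcongr; omega
      _ ≤ 2 ^ 7 * (n + 3) ^ 7 := by
          have : (n + 3) * 2 * (34 * (n + 3) ^ 6) = 68 * (n + 3) ^ 7 := by ring
          have h7 : 1 ≤ (n + 3) ^ 7 := Nat.one_le_pow _ _ (by omega)
          omega
      _ ≤ n ^ 7 * (n ^ 3) ^ 7 := by gcongr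
      _ = n ^ 28 := by ring
  calc _ ≤ (n ^ 28) ^ ((n + 3) * 2) := Nat.pow_le_pow_left hbase _
    _ ≤ (n ^ 28) ^ (5 * n) := Nat.pow_le_pow_right (Nat.pow_pos (by omega)) (by omega)
    _ = n ^ (140 * n) := by rw [← pow_mul]; congr 1; ring

theorem cutSystem_bound_le {n l : ℕ} (hn : 2 ≤ n) (hl : 2 ^ l ≤ 4 * n) :
    ((2 ^ l : ℝ) ^ n * (4 ^ (2 * (n * l)) * Real.exp (l * 2 ^ l))) ^ 2 ≤
      Real.exp (78 * (n * Real.log n)) := by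
  have hn0 : (0 : ℝ) < n := by exact_mod_cast (by omega : 0 < n)
  have hn2 : (2 : ℝ) ≤ n := by exact_mod_cast hn
  have hlog2 : Real.log 2 ≤ Real.log n := Real.log_le_log (by norm_num) hn2
  have hl2 := Real.log_two_gt_d9
  have hlr : (2 : ℝ) ^ l ≤ 4 * n := by exact_mod_cast hl
  have hll : l * Real.log 2 ≤ 3 * Real.log n := by
    have h1 := Real.log_le_log (by positivity) hlr
    rw [Real.log_pow, Real.log_mul (by norm_num) hn0.ne',
      show (4 : ℝ) = 2 ^ 2 by norm_num, Real.log_pow] at h1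
    push_cast at h1
    linarith
  have hl6 : (l : ℝ) ≤ 6 * Real.log n := by
    have : (0 : ℝ) ≤ l := Nat.cast_nonneg l
    nlinarith
  have hlogn : 0 ≤ Real.log n := by linarith
  have e1 : ((2 : ℝ) ^ l) ^ n = Real.exp (n * (l * Real.log 2)) := by
    rw [← Real.rpow_natCast, ← Real.rpow_natCast, ← Real.rpow_mul (by norm_num),
      Real.rpow_def_of_pos (by norm_num)]
    congr 1; ring
  have e2 : (4 : ℝ) ^ (2 * (n * l)) = Real.exp (4 * (n * (l * Real.log 2))) := by
    rw [← Real.rpow_natCast, Real.rpow_def_of_pos (by norm_num),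
      show (4 : ℝ) = 2 ^ 2 by norm_num, Real.log_pow]
    congr 1; push_cast; ring
  have e3 : (l : ℝ) * 2 ^ l ≤ 24 * (n * Real.log n) := by
    calc (l : ℝ) * 2 ^ l ≤ (6 * Real.log n) * (4 * n) := by gcongr
      _ = _ := by ring
  have e4 : (n : ℝ) * (l * Real.log 2) ≤ 3 * (n * Real.log n) := by
    calc (n : ℝ) * (l * Real.log 2) ≤ n * (3 * Real.log n) := by gcongr
      _ = _ := by ring
  rw [e1, e2, ← Real.exp_add, ← Real.exp_add, ← Real.exp_nat_mul, Real.exp_le_exp]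
  push_cast
  linarith

end Asymptotics

/-- The number of labeled `n`-vertex graphs with obstacle number at most `h`
is at most `2^{c·h·n·log n}`. -/
theorem count_graphs_bounded_obstacle_number :
    ∃ c : ℝ, 0 < c ∧ ∀ h n : ℕ, 1 ≤ h → 2 ≤ n →
      (Nat.card {G : SimpleGraph (Fin n) // ∃ R : ObstacleRep G, R.numObs ≤ h} : ℝ) ≤
        (2 : ℝ) ^ (c * (h : ℝ) * (n : ℝ) * Real.log (n : ℝ)) := by
  refine ⟨2000, by norm_num, fun h n hh hn => ?_⟩
  have hn0 : (0 : ℝ) < n := by exact_mod_cast (by omega : 0 < n)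
  have hn2 : (2 : ℝ) ≤ n := by exact_mod_cast hn
  have hlog2 : Real.log 2 ≤ Real.log n := Real.log_le_log (by norm_num) hn2
  have hl2 := Real.log_two_gt_d9
  have hh1 : (1 : ℝ) ≤ h := by exact_mod_cast hh
  obtain ⟨l, hl1, hl2'⟩ : ∃ l : ℕ, 2 * n ≤ 2 ^ l ∧ 2 ^ l ≤ 4 * n := by
    refine ⟨Nat.log 2 n + 2, ?_, ?_⟩
    · have := Nat.lt_pow_succ_log_self (b := 2) (by norm_num) n
      rw [pow_succ]; simp only [Nat.succ_eq_add_one] at this; omega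
    · have := Nat.pow_log_le_self 2 (x := n) (by omega)
      rw [pow_add]; omega
  have hmain := ncard_obstacleRep_le (V := Fin n) h l (by rwa [Fintype.card_fin])
  rw [Fintype.card_fin] at hmain
  set x := (n : ℝ) * Real.log n with hx
  have hx0 : 0 ≤ x := mul_nonneg hn0.le (by linarith)
  have hB := cutSystem_bound_le hn hl2'
  have h1 : ((Set.range (configType : (Fin n ⊕ Fin 3 → ℝ × ℝ) → _)).ncard : ℝ) ≤
      Real.exp (140 * x) := by
    calc ((Set.range (configType : (Fin n ⊕ Fin 3 → ℝ × ℝ) → _)).ncard : ℝ)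
        ≤ (n : ℝ) ^ (140 * n) := by exact_mod_cast ncard_configType_le_pow hn
      _ = Real.exp (140 * x) := by
          rw [← Real.rpow_natCast, Real.rpow_def_of_pos hn0]
          congr 1; rw [hx]; push_cast; ring
  have h2 : (2 : ℝ) ^ n ≤ Real.exp x := by
    rw [← Real.rpow_natCast, Real.rpow_def_of_pos (by norm_num), Real.exp_le_exp, hx, mul_comm]
    gcongr
  calc (Nat.card {G : SimpleGraph (Fin n) // ∃ R : ObstacleRep G, R.numObs ≤ h} : ℝ)
      ≤ _ := hmain
    _ ≤ Real.exp (140 * x) * (Real.exp x * Real.exp (78 * x) ^ (h * 2 * 4)) := by gcongr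
    _ = Real.exp (141 * x + 624 * (h * x)) := by
        rw [← Real.exp_nat_mul, ← Real.exp_add, ← Real.exp_add]
        congr 1; push_cast; ring
    _ ≤ (2 : ℝ) ^ (2000 * (h : ℝ) * n * Real.log n) := by
        rw [Real.rpow_def_of_pos (by norm_num), Real.exp_le_exp]
        have h3 : x ≤ h * x := by nlinarith
        have h4 : Real.log 2 * (2000 * (h : ℝ) * n * Real.log n) =
          2000 * Real.log 2 * (h * x) := by rw [hx]; ring
        rw [h4]
        have : 765 ≤ 2000 * Real.log 2 := by linarith
        nlinarith [mul_le_mul_of_nonneg_right this (hx0.trans h3)]
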